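/- Boundary Harnack principle for the heat equation in C^{α,1/2} domains with arbitrary α>0 (Theorem 1.3): Let α∈(0,1] and K>0. There exists a constant C>0 depending only on n, α and K such that the following holds. Assume [g]_{C^{α,1/2}} ≤ K, and let u and v be positive solutions of the heat equation ∂_t u = Δu and ∂_t v = Δv in 𝒞₁, with u vanishing continuously on Γ. Then for every (x,t) ∈ 𝒞_{1/2} one has u(x,t)/v(x,t) ≤ C · u(Ē)/v(E̲). -/

import Mathlib

noncomputable section
open scoped BigOperators
open Classical

abbrev Spc (m : ℕ) := EuclideanSpace ℝ (Fin (m + 1))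
abbrev Spc' (m : ℕ) := EuclideanSpace ℝ (Fin m)

/-- The horizontal coordinates `x' ∈ ℝ^{n-1}` of a point `x ∈ ℝⁿ`. -/
def xprime {m : ℕ} (x : Spc m) : Spc' m :=
  (WithLp.equiv 2 _).symm fun i => x i.castSucc

/-- The last (vertical) coordinate `x_n` of a point `x ∈ ℝⁿ`. -/
def xlast {m : ℕ} (x : Spc m) : ℝ := x (Fin.last m)

/-- Build a point of `ℝⁿ` from `x' ∈ ℝ^{n-1}` and the vertical coordinate. -/
def mkPt {m : ℕ} (x' : Spc' m) (xn : ℝ) : Spc m :=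
  (WithLp.equiv 2 _).symm fun i => if h : i = Fin.last m then xn else x' (i.castPred h)

/-- The `i`-th standard basis vector. -/
def eVec (m : ℕ) (i : Fin (m + 1)) : Spc m := EuclideanSpace.single i 1

/-- The entry `∂²u/∂xᵢ∂xⱼ` of the spatial Hessian of `u(x,t)` at `p = (x,t)`. -/
def sHess {m : ℕ} (u : Spc m × ℝ → ℝ) (p : Spc m × ℝ) (i j : Fin (m + 1)) : ℝ :=
  fderiv ℝ (fun y => fderiv ℝ (fun z => u (z, p.2)) y (eVec m j)) p.1 (eVec m i)

/-- The operator `Lu = tr(A(x) D²ₓu)` at the point `p = (x,t)`. -/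
def Lop {m : ℕ} (A : Spc m → Matrix (Fin (m + 1)) (Fin (m + 1)) ℝ)
    (u : Spc m × ℝ → ℝ) (p : Spc m × ℝ) : ℝ :=
  ∑ i, ∑ j, A p.1 i j * sHess u p j i

/-- Uniform ellipticity with symmetric coefficients: `λ|ξ|² ≤ ξ·A(x)ξ ≤ Λ|ξ|²`. -/
def IsElliptic {m : ℕ} (lam Lam : ℝ)
    (A : Spc m → Matrix (Fin (m + 1)) (Fin (m + 1)) ℝ) : Prop :=
  (∀ x, (A x).IsSymm) ∧
  ∀ (x ξ : Spc m),
    lam * ‖ξ‖ ^ 2 ≤ ∑ i, ∑ j, ξ i * A x i j * ξ j ∧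
      ∑ i, ∑ j, ξ i * A x i j * ξ j ≤ Lam * ‖ξ‖ ^ 2

/-- `u` is (pointwise) a solution of `u_t = Lu` on `Ω`: twice continuously
differentiable in `x`, differentiable in `t`, with `∂ₜu = tr(A(x)D²ₓu)`. -/
def SolvesL {m : ℕ} (A : Spc m → Matrix (Fin (m + 1)) (Fin (m + 1)) ℝ)
    (u : Spc m × ℝ → ℝ) (Ω : Set (Spc m × ℝ)) : Prop :=
  ∀ p ∈ Ω, ContDiffAt ℝ 2 (fun y => u (y, p.2)) p.1 ∧
    HasDerivAt (fun s => u (p.1, s)) (Lop A u p) p.2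

/-- `u` is a pointwise subsolution: `u_t ≤ Lu` on `Ω`. -/
def SubSolvesL {m : ℕ} (A : Spc m → Matrix (Fin (m + 1)) (Fin (m + 1)) ℝ)
    (u : Spc m × ℝ → ℝ) (Ω : Set (Spc m × ℝ)) : Prop :=
  ∀ p ∈ Ω, ContDiffAt ℝ 2 (fun y => u (y, p.2)) p.1 ∧
    DifferentiableAt ℝ (fun s => u (p.1, s)) p.2 ∧
    deriv (fun s => u (p.1, s)) p.2 ≤ Lop A u p

/-- `u` solves the heat equation `∂ₜu = Δu` on `Ω`. -/
def SolvesHeat {m : ℕ} (u : Spc m × ℝ → ℝ) (Ω : Set (Spc m × ℝ)) : Prop :=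
  ∀ p ∈ Ω, ContDiffAt ℝ 2 (fun y => u (y, p.2)) p.1 ∧
    HasDerivAt (fun s => u (p.1, s)) (∑ i, sHess u p i i) p.2

/-- The graph `Γ = {x_n = g(x',t)}`. -/
def graphSet {m : ℕ} (g : Spc' m → ℝ → ℝ) : Set (Spc m × ℝ) :=
  {p | xlast p.1 = g (xprime p.1) p.2}

/-- The cylinder `𝒞_r` of size `r` on top of the graph of `g`. -/
def Cyl {m : ℕ} (g : Spc' m → ℝ → ℝ) (r : ℝ) : Set (Spc m × ℝ) :=
  {p | ‖xprime p.1‖ < r ∧ -r ^ 2 < p.2 ∧ p.2 < r ^ 2 ∧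
    g (xprime p.1) p.2 < xlast p.1 ∧ xlast p.1 < g (xprime p.1) p.2 + r}

/-- The point `Ē = ((0', g(0',1/2) + 1/2), 1/2)`. -/
def Ebar {m : ℕ} (g : Spc' m → ℝ → ℝ) : Spc m × ℝ := (mkPt 0 (g 0 (1 / 2) + 1 / 2), 1 / 2)

/-- The point `E̲ = ((0', g(0',−1/2) + 1/2), −1/2)`. -/
def Eund {m : ℕ} (g : Spc' m → ℝ → ℝ) : Spc m × ℝ := (mkPt 0 (g 0 (-(1 / 2)) + 1 / 2), -(1 / 2))

/-- `u` vanishes continuously on `Γ`: `u(Q) → 0` as `Q → P` within `Ω`,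
for every `P ∈ Γ` in the closure of `Ω`. -/
def VanishesOn {m : ℕ} (u : Spc m × ℝ → ℝ) (Ω Γ : Set (Spc m × ℝ)) : Prop :=
  ∀ P ∈ Γ ∩ closure Ω, Filter.Tendsto u (nhdsWithin P Ω) (nhds 0)

/-- `[g]_{C^{α,β}} ≤ K`. -/
def HolderSemi {m : ℕ} (α β K : ℝ) (g : Spc' m → ℝ → ℝ) : Prop :=
  ∀ x' y' t s, |g x' t - g y' s| ≤ K * (‖x' - y'‖ ^ α + |t - s| ^ β)

/-- The backward-in-time cylinder `𝒞_r^−` (Lipschitz setting, parabolic scaling). -/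
def CylB {m : ℕ} (g : Spc' m → ℝ → ℝ) (r : ℝ) : Set (Spc m × ℝ) :=
  {p | (∀ i : Fin m, -r < xprime p.1 i ∧ xprime p.1 i < r) ∧ -r ^ 2 < p.2 ∧ p.2 ≤ 0 ∧
    g (xprime p.1) p.2 < xlast p.1 ∧ xlast p.1 < g (xprime p.1) p.2 + r}

/-- The set `𝒜_r` of points of `𝒞_r^−` at height at least `δr` above `Γ`. -/
def ASet {m : ℕ} (g : Spc' m → ℝ → ℝ) (δ r : ℝ) : Set (Spc m × ℝ) :=
  {p ∈ CylB g r | g (xprime p.1) p.2 + δ * r ≤ xlast p.1}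

/-- The backward-in-time cylinder `𝒞_r^−` (Hölder setting, time interval `(−r,0]`). -/
def CylBH {m : ℕ} (g : Spc' m → ℝ → ℝ) (r : ℝ) : Set (Spc m × ℝ) :=
  {p | (∀ i : Fin m, -r < xprime p.1 i ∧ xprime p.1 i < r) ∧ -r < p.2 ∧ p.2 ≤ 0 ∧
    g (xprime p.1) p.2 < xlast p.1 ∧ xlast p.1 < g (xprime p.1) p.2 + r}

/-- The set `𝒜_r` of points of the Hölder cylinder `𝒞_r^−` at height at least `r^β` above `Γ`. -/
def ASetH {m : ℕ} (g : Spc' m → ℝ → ℝ) (β r : ℝ) : Set (Spc m × ℝ) :=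
  {p ∈ CylBH g r | g (xprime p.1) p.2 + r ^ β ≤ xlast p.1}

/-- The height `h_Γ(x,t) = x_n − g(x',t)` above the graph. -/
def hGamma {m : ℕ} (g : Spc' m → ℝ → ℝ) (p : Spc m × ℝ) : ℝ :=
  xlast p.1 - g (xprime p.1) p.2

open Filter Topology Set

/-- `f` has first and second derivatives `d1`, `d2` at `x` along the `i`-th coordinate line. -/
def HasLine2 {m : ℕ} (f : Spc m → ℝ) (x : Spc m) (i : Fin (m + 1)) (d1 d2 : ℝ) : Prop :=
  ∃ φ : ℝ → ℝ, φ 0 = d1 ∧ (∀ᶠ s in 𝓝 (0 : ℝ), HasDerivAt (fun s => f (x + s • eVec m i)) (φ s) s) ∧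
    HasDerivAt φ d2 0

/-- `(∂ₜ - Δ) u = c` at `p`, where the derivatives are only required along coordinate lines and
the first spatial derivatives are recorded in `a`. -/
def HeatGrad {m : ℕ} (u : Spc m × ℝ → ℝ) (p : Spc m × ℝ) (a : Fin (m + 1) → ℝ) (c : ℝ) : Prop :=
  ∃ b : Fin (m + 1) → ℝ, (∀ i, HasLine2 (fun y => u (y, p.2)) p.1 i (a i) (b i)) ∧
    HasDerivAt (fun s => u (p.1, s)) (∑ i, b i + c) p.2

/-- `(∂ₜ - Δ) u = c` at `p`, with derivatives taken along coordinate lines. -/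
def HeatOp {m : ℕ} (u : Spc m × ℝ → ℝ) (p : Spc m × ℝ) (c : ℝ) : Prop :=
  ∃ a, HeatGrad u p a c

section Calculus

variable {m : ℕ}

lemma eVec_apply (i j : Fin (m + 1)) : eVec m i j = if j = i then 1 else 0 := by
  simp [eVec]

lemma norm_eVec (i : Fin (m + 1)) : ‖eVec m i‖ = 1 := by
  simp [eVec]

lemma HasLine2.add {f g : Spc m → ℝ} {x i a b a' b'} (hf : HasLine2 f x i a b)
    (hg : HasLine2 g x i a' b') : HasLine2 (fun y => f y + g y) x i (a + a') (b + b') := by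
  obtain ⟨φ, h0, h1, h2⟩ := hf
  obtain ⟨ψ, k0, k1, k2⟩ := hg
  refine ⟨fun s => φ s + ψ s, by simp [h0, k0], ?_, h2.add k2⟩
  filter_upwards [h1, k1] with s hs ks using hs.add ks

lemma HasLine2.const_mul {f : Spc m → ℝ} {x i a b} (c : ℝ) (hf : HasLine2 f x i a b) :
    HasLine2 (fun y => c * f y) x i (c * a) (c * b) := by
  obtain ⟨φ, h0, h1, h2⟩ := hf
  refine ⟨fun s => c * φ s, by simp [h0], ?_, h2.const_mul c⟩
  filter_upwards [h1] with s hs using hs.const_mul c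

lemma hasLine2_const (c : ℝ) (x : Spc m) (i) : HasLine2 (fun _ => c) x i 0 0 :=
  ⟨fun _ => 0, rfl, Eventually.of_forall fun s => hasDerivAt_const s c, hasDerivAt_const _ _⟩

lemma HeatGrad.add {u v : Spc m × ℝ → ℝ} {p a a' c c'} (hu : HeatGrad u p a c)
    (hv : HeatGrad v p a' c') : HeatGrad (fun q => u q + v q) p (fun i => a i + a' i) (c + c') := by
  obtain ⟨b, h1, h2⟩ := hu
  obtain ⟨b', k1, k2⟩ := hv
  refine ⟨fun i => b i + b' i, fun i => (h1 i).add (k1 i), ?_⟩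
  exact (h2.add k2).congr_deriv (by rw [Finset.sum_add_distrib]; ring)

lemma HeatGrad.const_mul {u : Spc m × ℝ → ℝ} {p a c} (l : ℝ) (hu : HeatGrad u p a c) :
    HeatGrad (fun q => l * u q) p (fun i => l * a i) (l * c) := by
  obtain ⟨b, h1, h2⟩ := hu
  refine ⟨fun i => l * b i, fun i => (h1 i).const_mul l, ?_⟩
  exact (h2.const_mul l).congr_deriv (by rw [← Finset.mul_sum]; ring)

lemma HeatOp.add {u v : Spc m × ℝ → ℝ} {p c c'} (hu : HeatOp u p c) (hv : HeatOp v p c') :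
    HeatOp (fun q => u q + v q) p (c + c') := by
  obtain ⟨a, hu⟩ := hu
  obtain ⟨a', hv⟩ := hv
  exact ⟨_, hu.add hv⟩

lemma HeatOp.const_mul {u : Spc m × ℝ → ℝ} {p c} (l : ℝ) (hu : HeatOp u p c) :
    HeatOp (fun q => l * u q) p (l * c) := by
  obtain ⟨a, hu⟩ := hu
  exact ⟨_, hu.const_mul l⟩

lemma HeatOp.sub {u v : Spc m × ℝ → ℝ} {p c c'} (hu : HeatOp u p c) (hv : HeatOp v p c') :
    HeatOp (fun q => u q - v q) p (c - c') := by
  convert hu.add (hv.const_mul (-1)) using 1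
  · funext q; ring
  · ring

lemma heatOp_time {τ : ℝ → ℝ} {d : ℝ} {p : Spc m × ℝ} (h : HasDerivAt τ d p.2) :
    HeatOp (fun q : Spc m × ℝ => τ q.2) p d :=
  ⟨fun _ => 0, fun _ => 0, fun i => hasLine2_const (τ p.2) p.1 i, by simpa using h⟩

lemma heatOp_const (l : ℝ) (p : Spc m × ℝ) : HeatOp (fun _ => l) p 0 :=
  heatOp_time (τ := fun _ => l) (hasDerivAt_const p.2 l)

lemma HeatOp.sum {ι : Type*} (s : Finset ι) {u : ι → Spc m × ℝ → ℝ} {p} {c : ι → ℝ}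
    (h : ∀ i ∈ s, HeatOp (u i) p (c i)) :
    HeatOp (fun q => ∑ i ∈ s, u i q) p (∑ i ∈ s, c i) := by
  induction s using Finset.induction_on with
  | empty => simpa using heatOp_const 0 p
  | insert a s ha ih =>
    simp only [Finset.sum_insert ha]
    exact (h a (by simp)).add (ih fun i hi => h i (by simp [hi]))

lemma hasLine2_coord {φ φ' : ℝ → ℝ} {d : ℝ} {x : Spc m} (j i : Fin (m + 1))
    (h1 : ∀ s, HasDerivAt φ (φ' s) s) (h2 : HasDerivAt φ' d (x j)) :
    HasLine2 (fun y => φ (y j)) x i (if j = i then φ' (x j) else 0) (if j = i then d else 0) := by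
  by_cases h : j = i
  · subst h
    simp only [if_true]
    refine ⟨fun s => φ' (x j + s), by simp, Eventually.of_forall fun s => ?_, ?_⟩
    · have : HasDerivAt (fun s : ℝ => x j + s) 1 s := (hasDerivAt_id s).const_add _
      have := (h1 (x j + s)).comp s this
      simpa [Function.comp_def, eVec_apply] using this
    · have h3 : HasDerivAt (fun s : ℝ => x j + s) 1 0 := (hasDerivAt_id 0).const_add _
      have h2' : HasDerivAt φ' d (x j + 0) := by simpa using h2
      simpa [Function.comp_def] using h2'.comp 0 h3
  · simp only [h, if_false]
    have : (fun s : ℝ => φ ((x + s • eVec m i) j)) = fun _ => φ (x j) := by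
      funext s; simp [eVec_apply, h]
    refine ⟨fun _ => 0, rfl, Eventually.of_forall fun s => ?_, hasDerivAt_const _ _⟩
    rw [this]; exact hasDerivAt_const _ _

lemma heatOp_coord {φ φ' : ℝ → ℝ} {d : ℝ} {p : Spc m × ℝ} (j : Fin (m + 1))
    (h1 : ∀ s, HasDerivAt φ (φ' s) s) (h2 : HasDerivAt φ' d (p.1 j)) :
    HeatOp (fun q : Spc m × ℝ => φ (q.1 j)) p (-d) := by
  refine ⟨_, _, fun i => hasLine2_coord j i h1 h2, ?_⟩
  simpa using hasDerivAt_const p.2 (φ (p.1 j))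

lemma heatOp_cosh (a z s : ℝ) (j : Fin (m + 1)) (p : Spc m × ℝ) :
    HeatOp (fun q : Spc m × ℝ => Real.exp (a ^ 2 * (q.2 - s)) * Real.cosh (a * (q.1 j - z))) p 0 := by
  have e1 : ∀ r, HasDerivAt (fun r => Real.cosh (a * (r - z))) (a * Real.sinh (a * (r - z))) r := by
    intro r
    have : HasDerivAt (fun r : ℝ => a * (r - z)) a r := by
      simpa using ((hasDerivAt_id r).sub_const z).const_mul a
    simpa [mul_comm] using this.cosh
  have e2 : HasDerivAt (fun r => a * Real.sinh (a * (r - z)))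
      (a * (a * Real.cosh (a * (p.1 j - z)))) (p.1 j) := by
    have : HasDerivAt (fun r : ℝ => a * (r - z)) a (p.1 j) := by
      simpa using ((hasDerivAt_id (p.1 j)).sub_const z).const_mul a
    simpa [mul_comm] using this.sinh.const_mul a
  refine ⟨_, _, fun i => (hasLine2_coord (x := p.1) j i e1 e2).const_mul
    (Real.exp (a ^ 2 * (p.2 - s))), ?_⟩
  have : HasDerivAt (fun r : ℝ => a ^ 2 * (r - s)) (a ^ 2) p.2 := by
    simpa using ((hasDerivAt_id p.2).sub_const s).const_mul (a ^ 2)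
  refine (this.exp.mul_const (Real.cosh (a * (p.1 j - z)))).congr_deriv ?_
  simp
  ring

lemma HeatOp.of_solves {u : Spc m × ℝ → ℝ} {p : Spc m × ℝ}
    (h : ContDiffAt ℝ 2 (fun y => u (y, p.2)) p.1)
    (h' : HasDerivAt (fun s => u (p.1, s)) (∑ i, sHess u p i i) p.2) : HeatOp u p 0 := by
  refine ⟨fun i => fderiv ℝ (fun z => u (z, p.2)) p.1 (eVec m i), fun i => sHess u p i i,
    fun i => ?_, by simpa using h'⟩
  have hl : ∀ s : ℝ, HasDerivAt (fun s : ℝ => p.1 + s • eVec m i) (eVec m i) s := fun s => by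
    simpa using ((hasDerivAt_id s).smul_const (eVec m i)).const_add p.1
  have hl0 : p.1 + (0 : ℝ) • eVec m i = p.1 := by simp
  refine ⟨fun s => fderiv ℝ (fun z => u (z, p.2)) (p.1 + s • eVec m i) (eVec m i), by simp, ?_, ?_⟩
  · have h1 : ∀ᶠ y in 𝓝 p.1, DifferentiableAt ℝ (fun y => u (y, p.2)) y := by
      filter_upwards [h.eventually (by simp)] with y hy using hy.differentiableAt (by simp)
    have hc : Tendsto (fun s : ℝ => p.1 + s • eVec m i) (𝓝 0) (𝓝 p.1) := by
      have := (hl 0).continuousAt.tendsto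
      rwa [hl0] at this
    filter_upwards [hc.eventually h1] with s hs
    exact hs.hasFDerivAt.comp_hasDerivAt s (hl s)
  · have h2 : DifferentiableAt ℝ (fun y => fderiv ℝ (fun z => u (z, p.2)) y (eVec m i)) p.1 := by
      have := (h.fderiv_right (m := 1) (by norm_num)).differentiableAt (by simp)
      exact this.clm_apply (differentiableAt_const _)
    have h3 := h2.hasFDerivAt
    rw [← hl0] at h3
    have := h3.comp_hasDerivAt (0 : ℝ) (hl 0)
    simpa [sHess, Function.comp_def] using this

lemma second_deriv_nonneg_of_isLocalMin {h φ : ℝ → ℝ} {d : ℝ}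
    (h1 : ∀ᶠ s in 𝓝 (0 : ℝ), HasDerivAt h (φ s) s) (h2 : HasDerivAt φ d 0)
    (hm : IsLocalMin h 0) : 0 ≤ d := by
  by_contra hd
  push Not at hd
  have e : deriv h =ᶠ[𝓝 0] φ := by
    filter_upwards [h1] with s hs using hs.deriv
  have hdd : deriv (deriv h) 0 = d := by rw [e.deriv_eq, h2.deriv]
  have hM : IsLocalMax h 0 := isLocalMax_of_deriv_deriv_neg (by rw [hdd]; exact hd)
    hm.deriv_eq_zero h1.self_of_nhds.continuousAt
  have hc : h =ᶠ[𝓝 0] fun _ => h 0 := by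
    filter_upwards [hm, hM] with s a b using le_antisymm b a
  have hc' : deriv h =ᶠ[𝓝 0] fun _ => 0 := by
    simpa using hc.deriv
  have : deriv (deriv h) 0 = 0 := by rw [hc'.deriv_eq]; simp
  linarith

lemma deriv_nonpos_of_left_min {h : ℝ → ℝ} {d t : ℝ} (h1 : HasDerivAt h d t)
    (hm : ∀ᶠ s in 𝓝[<] t, h t ≤ h s) : d ≤ 0 := by
  have h2 := (hasDerivAt_iff_tendsto_slope.1 h1).mono_left
    (nhdsWithin_mono t (fun s (hs : s < t) => hs.ne) : 𝓝[<] t ≤ 𝓝[≠] t)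
  refine le_of_tendsto h2 ?_
  filter_upwards [hm, self_mem_nhdsWithin] with s hs hst
  rw [slope_def_field]
  exact div_nonpos_of_nonneg_of_nonpos (by linarith) (by linarith [mem_Iio.1 hst])

/-- Minimum principle on a compact set: every point is either good already, or an interior point
from below in time at which `w` is a supersolution. -/
theorem heat_min_principle {w : Spc m × ℝ → ℝ} {Q : Set (Spc m × ℝ)} (hQ : IsCompact Q)
    (hw : ContinuousOn w Q)
    (h : ∀ p ∈ Q, 0 ≤ w p ∨ ((∀ᶠ y in 𝓝 p.1, (y, p.2) ∈ Q) ∧ (∀ᶠ s in 𝓝[<] p.2, (p.1, s) ∈ Q) ∧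
      ∃ c, 0 ≤ c ∧ HeatOp w p c)) : ∀ p ∈ Q, 0 ≤ w p := by
  intro p hp
  by_contra hneg
  push Not at hneg
  obtain ⟨tl, htl⟩ : ∃ tl, ∀ q ∈ Q, tl ≤ q.2 := by
    obtain ⟨q, _, hq2⟩ := hQ.exists_isMinOn ⟨p, hp⟩ (continuous_snd.continuousOn)
    exact ⟨q.2, fun r hr => hq2 hr⟩
  set ε := -w p / (2 * (p.2 - tl + 1)) with hε
  have hpos : 0 < p.2 - tl + 1 := by linarith [htl p hp]
  have hεp : 0 < ε := by rw [hε]; exact div_pos (by linarith) (by linarith)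
  have hWp : w p + ε * (p.2 - tl) < 0 := by
    have : ε * (p.2 - tl + 1) = -w p / 2 := by rw [hε]; field_simp
    nlinarith
  obtain ⟨q, hq, hqm⟩ := hQ.exists_isMinOn (f := fun q => w q + ε * (q.2 - tl)) ⟨p, hp⟩
    (hw.add (by fun_prop))
  have hqm' : ∀ r ∈ Q, w q + ε * (q.2 - tl) ≤ w r + ε * (r.2 - tl) := fun r hr => hqm hr
  have hWq := hqm' p hp
  have hwq : w q < 0 := by nlinarith [htl q hq]
  rcases h q hq with h | ⟨h1, h2, c, hc, a, b, h3, h4⟩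
  · linarith
  have hb : ∀ i, 0 ≤ b i := by
    intro i
    obtain ⟨φ, _, k1, k2⟩ := h3 i
    refine second_deriv_nonneg_of_isLocalMin k1 k2 ?_
    have hc : Tendsto (fun s : ℝ => q.1 + s • eVec m i) (𝓝 0) (𝓝 q.1) := by
      have : Continuous (fun s : ℝ => q.1 + s • eVec m i) := by fun_prop
      simpa using this.tendsto 0
    filter_upwards [hc.eventually h1] with s hs
    have := hqm' _ hs
    simp only [zero_smul, add_zero]
    linarith
  have h5 : HasDerivAt (fun s => w (q.1, s) + ε * (s - tl)) (∑ i, b i + c + ε) q.2 := by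
    have := ((hasDerivAt_id q.2).sub_const tl).const_mul ε
    exact (h4.add this).congr_deriv (by simp)
  have := deriv_nonpos_of_left_min h5 (by
    filter_upwards [h2] with s hs using hqm' _ hs)
  have : 0 ≤ ∑ i, b i := Finset.sum_nonneg fun i _ => hb i
  linarith

end Calculus

section Gradient

variable {m : ℕ}

lemma HasLine2.comp_of_line {f : Spc m → ℝ} {T : Spc m → Spc m} {x : Spc m} {i : Fin (m + 1)}
    {a b l : ℝ} (hl : l * l = 1) (hT : ∀ s : ℝ, T (x + s • eVec m i) = T x + (l * s) • eVec m i)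
    (h : HasLine2 f (T x) i a b) : HasLine2 (fun y => f (T y)) x i (l * a) b := by
  obtain ⟨φ, h0, h1, h2⟩ := h
  have hd : ∀ s : ℝ, HasDerivAt (fun s : ℝ => l * s) l s := fun s => by
    simpa using (hasDerivAt_id s).const_mul l
  refine ⟨fun s => l * φ (l * s), by simp [h0], ?_, ?_⟩
  · have : Tendsto (fun s : ℝ => l * s) (𝓝 0) (𝓝 0) := by
      simpa using (hd 0).continuousAt.tendsto
    filter_upwards [this.eventually h1] with s hs
    have := hs.comp s (hd s)
    simp only [hT]
    exact this.congr_deriv (by ring)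
  · have h2' : HasDerivAt φ b (l * 0) := by simpa using h2
    refine ((h2'.comp 0 (hd 0)).const_mul l).congr_deriv ?_
    linear_combination b * hl

lemma HeatOp.translate {u : Spc m × ℝ → ℝ} {p : Spc m × ℝ} {c τ : ℝ} {k : Spc m}
    (h : HeatOp u (p.1 + k, p.2 + τ) c) : HeatOp (fun q => u (q.1 + k, q.2 + τ)) p c := by
  obtain ⟨a, b, h1, h2⟩ := h
  refine ⟨fun i => 1 * a i, b, fun i => ?_, ?_⟩
  · refine HasLine2.comp_of_line (f := fun y => u (y, p.2 + τ)) (T := fun y => y + k)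
      (by norm_num) (fun s => ?_) (h1 i)
    simp only [one_mul]; abel
  · have : HasDerivAt (fun s : ℝ => s + τ) 1 p.2 := (hasDerivAt_id _).add_const _
    simpa [Function.comp_def] using HasDerivAt.comp p.2 h2 this

/-- Reflection of the `i`-th coordinate about the hyperplane `x i = z`. -/
def reflAt (i : Fin (m + 1)) (z : ℝ) (x : Spc m) : Spc m := x - (2 * (x i - z)) • eVec m i

lemma reflAt_apply (i : Fin (m + 1)) (z : ℝ) (x : Spc m) (j) :
    reflAt i z x j = if j = i then 2 * z - x i else x j := by
  by_cases h : j = i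
  · subst h; simp [reflAt, eVec_apply]; ring
  · simp [reflAt, eVec_apply, h]

lemma continuous_reflAt (i : Fin (m + 1)) (z : ℝ) : Continuous (reflAt (m := m) i z) := by
  unfold reflAt; fun_prop

lemma HeatOp.refl {u : Spc m × ℝ → ℝ} {p : Spc m × ℝ} {c z : ℝ} {i : Fin (m + 1)}
    (h : HeatOp u (reflAt i z p.1, p.2) c) : HeatOp (fun q => u (reflAt i z q.1, q.2)) p c := by
  obtain ⟨a, b, h1, h2⟩ := h
  refine ⟨fun j => (if j = i then -1 else 1) * a j, b, fun j => ?_, h2⟩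
  refine HasLine2.comp_of_line (f := fun y => u (y, p.2)) (T := reflAt i z)
    (by split_ifs <;> norm_num) (fun s => ?_) (h1 j)
  ext k
  simp only [reflAt_apply, PiLp.add_apply, PiLp.smul_apply, eVec_apply, smul_eq_mul]
  by_cases hj : j = i
  · subst hj
    by_cases hk : k = j
    · subst hk; simp; ring
    · simp [hk]
  · by_cases hk : k = i
    · subst hk; simp [hj, Ne.symm hj]
    · simp [hj, hk]

/-- Closed coordinate box of half-width `r` about `z`, for times in `[t - r ^ 2, t]`. -/
def pBox (z : Spc m) (t r : ℝ) : Set (Spc m × ℝ) :=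
  {p | (∀ j, |p.1 j - z j| ≤ r) ∧ t - r ^ 2 ≤ p.2 ∧ p.2 ≤ t}

lemma abs_coord_le (x : Spc m) (j) : |x j| ≤ ‖x‖ := by
  simpa using PiLp.norm_apply_le x j

lemma norm_le_of_coord {x : Spc m} {r : ℝ} (h : ∀ j, |x j| ≤ r) :
    ‖x‖ ≤ (m + 1) * r := by
  have hx : x = ∑ j, x j • eVec m j := by
    ext k; simp [eVec_apply]
  rw [hx]
  refine (norm_sum_le _ _).trans ?_
  calc ∑ j, ‖x j • eVec m j‖ ≤ ∑ _j : Fin (m + 1), r := by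
        refine Finset.sum_le_sum fun j _ => ?_
        rw [norm_smul, norm_eVec]; simpa using h j
    _ = (m + 1) * r := by simp

lemma isCompact_pBox (z : Spc m) (t r : ℝ) : IsCompact (pBox z t r) := by
  refine ((isCompact_closedBall z ((m + 1) * r)).prod (isCompact_Icc (a := t - r ^ 2) (b := t))).of_isClosed_subset
    ?_ ?_
  · have : pBox z t r = (⋂ j, {p : Spc m × ℝ | |p.1 j - z j| ≤ r}) ∩ {p | t - r ^ 2 ≤ p.2} ∩ {p | p.2 ≤ t} := by
      ext p; simp [pBox, and_assoc]
    rw [this]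
    refine ((isClosed_iInter fun j => ?_).inter ?_).inter ?_
    · exact isClosed_le (by fun_prop) continuous_const
    · exact isClosed_le continuous_const (by fun_prop)
    · exact isClosed_le (by fun_prop) continuous_const
  · rintro p ⟨h1, h2, h3⟩
    refine ⟨?_, h2, h3⟩
    rw [mem_closedBall_iff_norm]
    exact norm_le_of_coord (by simpa using h1)

lemma sub_refl_le {w : Spc m × ℝ → ℝ} {z : Spc m} {t r M : ℝ} (hr : 0 < r)
    (hw : ContinuousOn w (pBox z t r)) (hs : ∀ p ∈ pBox z t r, HeatOp w p 0)
    (hM : ∀ p ∈ pBox z t r, |w p| ≤ M) (i : Fin (m + 1)) {s : ℝ} (hs0 : 0 ≤ s) (hsr : s ≤ r) :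
    w (z + s • eVec m i, t) - w (z - s • eVec m i, t) ≤ (4 * m + 10) * M * s / r := by
  have hM0 : 0 ≤ M := (abs_nonneg _).trans (hM (z, t) ⟨by simp [hr.le], by nlinarith, le_rfl⟩)
  set A : ℝ := m + 2 with hA
  let V : Spc m × ℝ → ℝ := fun p => 2 * M * ((∑ j, (1 / r ^ 2) * (p.1 j - z j) ^ 2) + (t - p.2) / r ^ 2
    + A * (2 * ((p.1 i - z i) / r) - ((p.1 i - z i) / r) ^ 2))
  let W : Spc m × ℝ → ℝ := fun p => V p - (w p - w (reflAt i (z i) p.1, p.2))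
  let Q : Set (Spc m × ℝ) := pBox z t r ∩ {p | z i ≤ p.1 i}
  have hQc : IsCompact Q :=
    (isCompact_pBox z t r).inter_right (isClosed_le continuous_const (by fun_prop))
  have hrefl : ∀ p ∈ pBox z t r, (reflAt i (z i) p.1, p.2) ∈ pBox z t r := by
    rintro p ⟨h1, h2⟩
    refine ⟨fun j => ?_, h2⟩
    simp only [reflAt_apply]
    split_ifs with h
    · subst h; rw [show 2 * z j - p.1 j - z j = -(p.1 j - z j) by ring, abs_neg]; exact h1 j
    · exact h1 j
  have hVc : Continuous V := by fun_prop
  have hWc : ContinuousOn W Q := by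
    refine hVc.continuousOn.sub ((hw.mono inter_subset_left).sub ?_)
    refine (hw.comp (f := fun p : Spc m × ℝ => (reflAt i (z i) p.1, p.2)) ?_ hrefl).mono inter_subset_left
    exact ((continuous_reflAt i (z i)).comp continuous_fst).prodMk continuous_snd |>.continuousOn
  have hVop : ∀ p, HeatOp V p (2 * M * ((∑ _j : Fin (m + 1), -(1 / r ^ 2 * 2)) + -(1 / r ^ 2) + -(A * (-2 / r ^ 2)))) := by
    intro p
    refine HeatOp.const_mul _ ((HeatOp.add (HeatOp.sum _ fun j _ => ?_) ?_).add ?_)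
    · refine heatOp_coord (φ := fun x => 1 / r ^ 2 * (x - z j) ^ 2) (φ' := fun x => 1 / r ^ 2 * (2 * (x - z j))) j ?_ ?_
      · intro x
        refine ((((hasDerivAt_id x).sub_const (z j)).pow 2).const_mul (1 / r ^ 2)).congr_deriv ?_
        simp
      · refine ((((hasDerivAt_id _).sub_const (z j)).const_mul 2).const_mul (1 / r ^ 2)).congr_deriv ?_
        simp
    · refine heatOp_time (τ := fun s => (t - s) / r ^ 2) ?_
      refine (((hasDerivAt_id _).const_sub t).div_const (r ^ 2)).congr_deriv ?_
      ring
    · refine heatOp_coord (φ := fun x => A * (2 * ((x - z i) / r) - ((x - z i) / r) ^ 2))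
        (φ' := fun x => A * (2 * (1 / r) - 2 * ((x - z i) / r) * (1 / r))) i ?_ ?_
      · intro x
        have h1 := ((hasDerivAt_id x).sub_const (z i)).div_const r
        refine (((h1.const_mul 2).sub (h1.pow 2)).const_mul A).congr_deriv ?_
        simp
      · have h1 := ((hasDerivAt_id (p.1 i)).sub_const (z i)).div_const r
        refine ((((h1.const_mul 2).mul_const (1 / r)).const_sub (2 * (1 / r))).const_mul A).congr_deriv ?_
        field_simp
  have key : ∀ p ∈ Q, 0 ≤ W p := by
    refine heat_min_principle hQc hWc fun p hp => ?_
    obtain ⟨⟨h1, h2, h3⟩, h4⟩ := hp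
    have h4 : z i ≤ p.1 i := h4
    have hy0 : 0 ≤ (p.1 i - z i) / r := div_nonneg (by linarith) hr.le
    have hy1 : (p.1 i - z i) / r ≤ 1 := by
      rw [div_le_one hr]; exact (le_abs_self _).trans (h1 i)
    have hA0 : 0 ≤ A * (2 * ((p.1 i - z i) / r) - ((p.1 i - z i) / r) ^ 2) := by
      refine mul_nonneg (by positivity) (by nlinarith)
    have hsum0 : ∀ j, 0 ≤ 1 / r ^ 2 * (p.1 j - z j) ^ 2 := fun j => by positivity
    have hsum : 0 ≤ ∑ j, 1 / r ^ 2 * (p.1 j - z j) ^ 2 := Finset.sum_nonneg fun j _ => hsum0 j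
    have ht : 0 ≤ (t - p.2) / r ^ 2 := div_nonneg (by linarith) (by positivity)
    have hwM : w p - w (reflAt i (z i) p.1, p.2) ≤ 2 * M := by
      have a1 := abs_le.1 (hM p ⟨h1, h2, h3⟩)
      have a2 := abs_le.1 (hM _ (hrefl p ⟨h1, h2, h3⟩))
      linarith
    have big : 1 ≤ (∑ j, 1 / r ^ 2 * (p.1 j - z j) ^ 2) + (t - p.2) / r ^ 2
        + A * (2 * ((p.1 i - z i) / r) - ((p.1 i - z i) / r) ^ 2) → 0 ≤ W p := by
      intro hb
      have : 2 * M * 1 ≤ V p := mul_le_mul_of_nonneg_left hb (by linarith)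
      show 0 ≤ V p - _
      linarith
    by_cases c1 : p.2 = t - r ^ 2
    · left; apply big
      have : (t - p.2) / r ^ 2 = 1 := by rw [c1]; field_simp; ring
      linarith
    by_cases c2 : ∃ j, |p.1 j - z j| = r
    · left; apply big
      obtain ⟨j, hj⟩ := c2
      have e : 1 / r ^ 2 * (p.1 j - z j) ^ 2 = 1 := by
        rw [← sq_abs (p.1 j - z j), hj]; field_simp
      have := Finset.single_le_sum (fun j _ => hsum0 j) (Finset.mem_univ j)
      rw [e] at this
      linarith
    by_cases c3 : p.1 i = z i
    · left
      have : reflAt i (z i) p.1 = p.1 := by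
        ext k; rw [reflAt_apply]; split_ifs with h
        · subst h; rw [c3]; ring
        · rfl
      have : 0 ≤ V p := mul_nonneg (by linarith) (by linarith)
      show 0 ≤ V p - _
      rw [‹reflAt i (z i) p.1 = p.1›]
      simpa using this
    right
    push Not at c2
    have h1' : ∀ j, |p.1 j - z j| < r := fun j => lt_of_le_of_ne (h1 j) (c2 j)
    have h2' : t - r ^ 2 < p.2 := lt_of_le_of_ne h2 (Ne.symm c1)
    have h4' : z i < p.1 i := lt_of_le_of_ne h4 (Ne.symm c3)
    refine ⟨?_, ?_, _, ?_, (hVop p).sub ((hs p ⟨h1, h2, h3⟩).sub (HeatOp.refl (hs _ (hrefl p ⟨h1, h2, h3⟩))))⟩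
    · have e1 : ∀ᶠ y : Spc m in 𝓝 p.1, ∀ j, |y j - z j| < r := by
        rw [eventually_all]
        intro j
        exact (isOpen_lt (by fun_prop) continuous_const).mem_nhds (h1' j)
      have e2 : ∀ᶠ y : Spc m in 𝓝 p.1, z i < y i :=
        (isOpen_lt continuous_const (by fun_prop)).mem_nhds h4'
      filter_upwards [e1, e2] with y k1 k2 using ⟨⟨fun j => (k1 j).le, h2, h3⟩, k2.le⟩
    · filter_upwards [self_mem_nhdsWithin, mem_nhdsWithin_of_mem_nhds (lt_mem_nhds h2')] with s k1 k2
      exact ⟨⟨h1, le_of_lt k2, (le_of_lt k1).trans h3⟩, h4⟩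
    · simp only [Finset.sum_const, Finset.card_univ, Fintype.card_fin, sub_zero, nsmul_eq_mul]
      refine mul_nonneg (by linarith) ?_
      have : ((m + 1 : ℕ) : ℝ) * -(1 / r ^ 2 * 2) + -(1 / r ^ 2) + -(A * (-2 / r ^ 2)) = 1 / r ^ 2 := by
        rw [hA]; push_cast; field_simp; ring
      rw [this]; positivity
  have hmem : (z + s • eVec m i, t) ∈ Q := by
    refine ⟨⟨fun j => ?_, by nlinarith, le_rfl⟩, ?_⟩
    · simp only [PiLp.add_apply, PiLp.smul_apply, eVec_apply, smul_eq_mul, add_sub_cancel_left]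
      split_ifs
      · simpa [abs_of_nonneg hs0] using hsr
      · simpa using hr.le
    · simp [eVec_apply, hs0]
  have h := key _ hmem
  have hre : reflAt i (z i) (z + s • eVec m i) = z - s • eVec m i := by
    ext k; rw [reflAt_apply]; split_ifs with hk
    · subst hk; simp [eVec_apply]; ring
    · simp [eVec_apply, hk]
  have hV : V (z + s • eVec m i, t) = 2 * M * (s ^ 2 / r ^ 2 + A * (2 * (s / r) - (s / r) ^ 2)) := by
    simp only [V]
    congr 1
    simp [eVec_apply, Finset.sum_ite_eq']
    ring
  have : W (z + s • eVec m i, t) = V (z + s • eVec m i, t) -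
      (w (z + s • eVec m i, t) - w (z - s • eVec m i, t)) := by
    simp only [W, hre]
  rw [this, hV] at h
  have hy1 : s / r ≤ 1 := by rw [div_le_one hr]; exact hsr
  have hy0 : 0 ≤ s / r := by positivity
  have e1 : s ^ 2 / r ^ 2 = (s / r) ^ 2 := by rw [div_pow]
  have e2 : (4 * m + 10) * M * s / r = 2 * M * ((2 * A + 1) * (s / r)) := by rw [hA]; ring
  rw [e2]
  have : 2 * M * (s ^ 2 / r ^ 2 + A * (2 * (s / r) - (s / r) ^ 2)) ≤ 2 * M * ((2 * A + 1) * (s / r)) := by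
    refine mul_le_mul_of_nonneg_left ?_ (by linarith)
    rw [e1]
    have : 0 ≤ A * (s / r) ^ 2 := by positivity
    nlinarith
  linarith

/-- Interior gradient estimate, in the form of a symmetric difference bound. -/
theorem abs_sub_le_of_pBox {w : Spc m × ℝ → ℝ} {z : Spc m} {t r M : ℝ} (hr : 0 < r)
    (hw : ContinuousOn w (pBox z t r)) (hs : ∀ p ∈ pBox z t r, HeatOp w p 0)
    (hM : ∀ p ∈ pBox z t r, |w p| ≤ M) (i : Fin (m + 1)) {s : ℝ} (hs0 : 0 ≤ s) (hsr : s ≤ r) :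
    |w (z + s • eVec m i, t) - w (z - s • eVec m i, t)| ≤ (4 * m + 10) * M * s / r := by
  have h1 := sub_refl_le hr hw hs hM i hs0 hsr
  have h2 := sub_refl_le (w := fun p => -1 * w p) hr (continuousOn_const.mul hw)
    (fun p hp => by simpa using (hs p hp).const_mul (-1)) (fun p hp => by simpa using hM p hp) i hs0 hsr
  rw [abs_le]
  constructor <;> linarith

/-- The partial derivative `∂u/∂xᵢ` at `p`. -/
def pderiv (u : Spc m × ℝ → ℝ) (i : Fin (m + 1)) (p : Spc m × ℝ) : ℝ :=
  deriv (fun s : ℝ => u (p.1 + s • eVec m i, p.2)) 0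

lemma HasLine2.hasDerivAt {f : Spc m → ℝ} {x i a b} (h : HasLine2 f x i a b) :
    HasDerivAt (fun s : ℝ => f (x + s • eVec m i)) a 0 := by
  obtain ⟨φ, rfl, h1, _⟩ := h
  exact h1.self_of_nhds

lemma HeatOp.hasDerivAt_pderiv {u : Spc m × ℝ → ℝ} {p c} (h : HeatOp u p c) (i) :
    HasDerivAt (fun s : ℝ => u (p.1 + s • eVec m i, p.2)) (pderiv u i p) 0 := by
  obtain ⟨a, b, h1, _⟩ := h
  exact (h1 i).hasDerivAt.differentiableAt.hasDerivAt

lemma HeatOp.hasDerivAt_line {u : Spc m × ℝ → ℝ} {x : Spc m} {s t c : ℝ} {i}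
    (h : HeatOp u (x + s • eVec m i, t) c) :
    HasDerivAt (fun s : ℝ => u (x + s • eVec m i, t)) (pderiv u i (x + s • eVec m i, t)) s := by
  have h1 := h.hasDerivAt_pderiv i
  have h2 : HasDerivAt (fun r : ℝ => r - s) 1 s := (hasDerivAt_id s).sub_const s
  have h3 := HasDerivAt.comp_of_eq s h1 h2 (by simp)
  simp only [mul_one] at h3
  refine h3.congr_of_eventuallyEq (Eventually.of_forall fun r => ?_)
  simp only [Function.comp, add_assoc, ← add_smul]
  congr 4; ring

theorem abs_pderiv_le {w : Spc m × ℝ → ℝ} {z : Spc m} {t r M : ℝ} (hr : 0 < r)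
    (hw : ContinuousOn w (pBox z t r)) (hs : ∀ p ∈ pBox z t r, HeatOp w p 0)
    (hM : ∀ p ∈ pBox z t r, |w p| ≤ M) (i : Fin (m + 1)) :
    |pderiv w i (z, t)| ≤ (2 * m + 5) * M / r := by
  have hz : (z, t) ∈ pBox z t r := ⟨by simp [hr.le], by nlinarith, le_rfl⟩
  have h1 : HasDerivAt (fun s : ℝ => w (z + s • eVec m i, t)) (pderiv w i (z, t)) 0 :=
    (hs _ hz).hasDerivAt_pderiv i
  have h1' : HasDerivAt (fun s : ℝ => w (z - s • eVec m i, t)) (-pderiv w i (z, t)) 0 := by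
    have := HasDerivAt.comp_of_eq (0 : ℝ) h1 (hasDerivAt_neg (0 : ℝ)) (by simp)
    simpa [Function.comp_def, sub_eq_add_neg] using this
  have h2 := h1.sub h1'
  have h3 := ((hasDerivAt_iff_tendsto_slope.1 h2).mono_left
    (nhdsWithin_mono 0 (fun s (hs : 0 < s) => ne_of_gt hs) : 𝓝[>] (0 : ℝ) ≤ 𝓝[≠] 0)).abs
  have h4 : |pderiv w i (z, t) - -pderiv w i (z, t)| ≤ (4 * m + 10) * M / r := by
    refine le_of_tendsto h3 ?_
    filter_upwards [self_mem_nhdsWithin, mem_nhdsWithin_of_mem_nhds (gt_mem_nhds hr)] with s k1 k2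
    have k1 : 0 < s := k1
    have := abs_sub_le_of_pBox hr hw hs hM i k1.le (le_of_lt k2)
    rw [slope_def_field, abs_div, sub_zero, abs_of_pos k1, div_le_iff₀ k1]
    simp only [Pi.sub_apply, zero_smul, add_zero, sub_zero, sub_self]
    calc _ ≤ _ := this
      _ = _ := by ring
  rw [show pderiv w i (z, t) - -pderiv w i (z, t) = 2 * pderiv w i (z, t) by ring, abs_mul] at h4
  norm_num at h4
  have e : (4 * m + 10) * M / r = 2 * ((2 * m + 5) * M / r) := by ring
  linarith

end Gradient

@[simp] lemma xprime_apply {m : ℕ} (x : Spc m) (i : Fin m) : xprime x i = x i.castSucc := rfl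

lemma xprime_add {m : ℕ} (x y : Spc m) : xprime (x + y) = xprime x + xprime y := rfl

lemma xprime_sub {m : ℕ} (x y : Spc m) : xprime (x - y) = xprime x - xprime y := rfl

lemma xprime_smul {m : ℕ} (c : ℝ) (x : Spc m) : xprime (c • x) = c • xprime x := rfl

lemma xlast_add {m : ℕ} (x y : Spc m) : xlast (x + y) = xlast x + xlast y := rfl

lemma xlast_sub {m : ℕ} (x y : Spc m) : xlast (x - y) = xlast x - xlast y := rfl

lemma xlast_smul {m : ℕ} (c : ℝ) (x : Spc m) : xlast (c • x) = c * xlast x := rfl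

lemma xprime_eVec_last (m : ℕ) : xprime (eVec m (Fin.last m)) = 0 := by
  ext i
  simp [eVec_apply, (Fin.castSucc_lt_last i).ne]

lemma xlast_eVec_last (m : ℕ) : xlast (eVec m (Fin.last m)) = 1 := by
  simp [xlast, eVec_apply]

lemma xprime_add_smul_eVec {m : ℕ} (x : Spc m) (c : ℝ) : xprime (x + c • eVec m (Fin.last m)) = xprime x := by
  rw [xprime_add, xprime_smul, xprime_eVec_last, smul_zero, add_zero]

lemma xlast_add_smul_eVec {m : ℕ} (x : Spc m) (c : ℝ) : xlast (x + c • eVec m (Fin.last m)) = xlast x + c := by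
  rw [xlast_add, xlast_smul, xlast_eVec_last, mul_one]

@[simp] lemma xprime_mkPt {m : ℕ} (a : Spc' m) (b : ℝ) : xprime (mkPt a b) = a := by
  ext i
  simp [mkPt, (Fin.castSucc_lt_last i).ne]

@[simp] lemma xlast_mkPt {m : ℕ} (a : Spc' m) (b : ℝ) : xlast (mkPt a b) = b := by
  simp [xlast, mkPt]

lemma norm_sq_eq_xprime_xlast {m : ℕ} (x : Spc m) : ‖x‖ ^ 2 = ‖xprime x‖ ^ 2 + xlast x ^ 2 := by
  rw [EuclideanSpace.norm_sq_eq, EuclideanSpace.norm_sq_eq, Fin.sum_univ_castSucc]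
  simp [xlast]

lemma norm_xprime_le {m : ℕ} (x : Spc m) : ‖xprime x‖ ≤ ‖x‖ := by
  have := norm_sq_eq_xprime_xlast x
  exact abs_le_of_sq_le_sq' (by nlinarith [sq_nonneg (xlast x)]) (norm_nonneg x) |>.2

lemma abs_xlast_le {m : ℕ} (x : Spc m) : |xlast x| ≤ ‖x‖ := abs_coord_le x _

lemma norm_le_xprime_xlast {m : ℕ} (x : Spc m) : ‖x‖ ≤ ‖xprime x‖ + |xlast x| := by
  have h := norm_sq_eq_xprime_xlast x
  have := norm_nonneg (xprime x)
  have := abs_nonneg (xlast x)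
  refine abs_le_of_sq_le_sq' ?_ (by positivity) |>.2
  nlinarith [sq_abs (xlast x)]

lemma continuous_xprime {m : ℕ} : Continuous (xprime : Spc m → Spc' m) := by
  refine continuous_iff_continuousAt.2 fun x => ?_
  rw [ContinuousAt, tendsto_iff_norm_sub_tendsto_zero]
  refine squeeze_zero (fun _ => norm_nonneg _) (fun y => ?_) (tendsto_iff_norm_sub_tendsto_zero.1 (tendsto_id (x := 𝓝 x)))
  rw [← xprime_sub]
  exact norm_xprime_le _

lemma continuous_xlast {m : ℕ} : Continuous (xlast : Spc m → ℝ) := by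
  unfold xlast
  fun_prop

lemma eq_mkPt {m : ℕ} (x : Spc m) : x = mkPt (xprime x) (xlast x) := by
  rw [← sub_eq_zero, ← norm_eq_zero]
  refine le_antisymm ((norm_le_xprime_xlast _).trans ?_) (norm_nonneg _)
  simp [xprime_sub, xlast_sub]

lemma eq_mkPt_hGamma {m : ℕ} (g : Spc' m → ℝ → ℝ) (x : Spc m) (t : ℝ) :
    x = mkPt (xprime x) (g (xprime x) t + hGamma g (x, t)) := by
  conv_lhs => rw [eq_mkPt x]
  simp [hGamma]

lemma continuous_hGamma {m : ℕ} {g : Spc' m → ℝ → ℝ} (hg : Continuous (fun q : Spc' m × ℝ => g q.1 q.2)) :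
    Continuous (hGamma g) := by
  unfold hGamma
  have h1 : Continuous fun p : Spc m × ℝ => g (xprime p.1) p.2 :=
    hg.comp ((continuous_xprime.comp continuous_fst).prodMk continuous_snd)
  exact (continuous_xlast.comp continuous_fst).sub h1

lemma mem_Cyl_iff {m : ℕ} {g : Spc' m → ℝ → ℝ} {r : ℝ} {p : Spc m × ℝ} :
    p ∈ Cyl g r ↔ ‖xprime p.1‖ < r ∧ -r ^ 2 < p.2 ∧ p.2 < r ^ 2 ∧ 0 < hGamma g p ∧ hGamma g p < r := by
  simp only [Cyl, hGamma, mem_ofPred_eq, sub_pos, sub_lt_iff_lt_add']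

lemma isOpen_Cyl {m : ℕ} {g : Spc' m → ℝ → ℝ} (hg : Continuous (fun q : Spc' m × ℝ => g q.1 q.2)) (r : ℝ) :
    IsOpen (Cyl g r) := by
  have e : Cyl g r = {p | ‖xprime p.1‖ < r} ∩ ({p | -r ^ 2 < p.2} ∩ ({p | p.2 < r ^ 2} ∩
      ({p | 0 < hGamma g p} ∩ {p | hGamma g p < r}))) := by
    ext p
    exact mem_Cyl_iff
  rw [e]
  have h := continuous_hGamma hg
  exact (isOpen_lt (continuous_xprime.comp continuous_fst).norm continuous_const).inter
    ((isOpen_lt continuous_const continuous_snd).inter ((isOpen_lt continuous_snd continuous_const).inter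
      ((isOpen_lt continuous_const h).inter (isOpen_lt h continuous_const))))

lemma abs_hGamma_sub_le {m : ℕ} {g : Spc' m → ℝ → ℝ} {α β K : ℝ} (hK : 0 ≤ K) (hα : 0 ≤ α) (hg : HolderSemi α β K g)
    (x y : Spc m) (s t : ℝ) :
    |hGamma g (x, s) - hGamma g (y, t)| ≤ ‖x - y‖ + K * (‖x - y‖ ^ α + |s - t| ^ β) := by
  have h1 := hg (xprime x) (xprime y) s t
  have h2 := abs_xlast_le (x - y)
  have h3 : ‖xprime x - xprime y‖ ^ α ≤ ‖x - y‖ ^ α :=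
    Real.rpow_le_rpow (norm_nonneg _) (by rw [← xprime_sub]; exact norm_xprime_le _) hα
  have h4 : hGamma g (x, s) - hGamma g (y, t) = xlast (x - y) - (g (xprime x) s - g (xprime y) t) := by
    simp only [hGamma, xlast_sub]; ring
  rw [h4]
  refine (abs_sub _ _).trans (add_le_add h2 (h1.trans ?_))
  gcongr

section Boost

variable {m : ℕ}

lemma dist_le_of_mem_pBox {z : Spc m} {t r : ℝ} {q : Spc m × ℝ} (hq : q ∈ pBox z t r) :
    dist q (z, t) ≤ max ((m + 1) * r) (r ^ 2) := by
  obtain ⟨h1, h2, h3⟩ := hq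
  rw [Prod.dist_eq]
  refine max_le_max ?_ ?_
  · rw [dist_eq_norm]; exact norm_le_of_coord (by simpa using h1)
  · rw [Real.dist_eq, abs_le]; constructor <;> dsimp only <;> nlinarith

theorem continuousAt_pderiv {u : Spc m × ℝ → ℝ} {Ω : Set (Spc m × ℝ)} (hΩ : IsOpen Ω)
    (hu : ContinuousOn u Ω) (hs : ∀ p ∈ Ω, HeatOp u p 0) (i : Fin (m + 1)) {p : Spc m × ℝ}
    (hp : p ∈ Ω) : ContinuousAt (pderiv u i) p := by
  obtain ⟨R, hR, hRΩ⟩ := Metric.nhds_basis_closedBall.mem_iff.1 (hΩ.mem_nhds hp)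
  set r : ℝ := min 1 (R / (2 * (m + 1))) with hr
  have hr0 : 0 < r := lt_min one_pos (by positivity)
  have hr1 : (m + 1) * r ≤ R / 2 := by
    calc (m + 1) * r ≤ (m + 1) * (R / (2 * (m + 1))) := by gcongr; exact min_le_right _ _
      _ = R / 2 := by field_simp
  have hr2 : r ^ 2 ≤ R / 2 := by
    have a1 : r ≤ 1 := min_le_left _ _
    have a2 : r ≤ (m + 1) * r := by
      have : (0 : ℝ) ≤ m * r := by positivity
      linarith
    nlinarith
  have hbox : ∀ q ∈ pBox p.1 p.2 r, dist q p ≤ R / 2 := fun q hq =>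
    (dist_le_of_mem_pBox hq).trans (max_le hr1 hr2)
  have huc := (isCompact_closedBall p R).uniformContinuousOn_of_continuous (hu.mono hRΩ)
  rw [Metric.uniformContinuousOn_iff] at huc
  rw [Metric.continuousAt_iff]
  intro ε hε
  set ε' := ε * r / (2 * (2 * m + 5)) with hε'
  have hε'0 : 0 < ε' := by positivity
  obtain ⟨δ, hδ, hδu⟩ := huc ε' hε'0
  refine ⟨min δ (R / 2), by positivity, fun q hq => ?_⟩
  have hq1 : dist q p < δ := hq.trans_le (min_le_left _ _)
  have hq2 : dist q p ≤ R / 2 := (hq.trans_le (min_le_right _ _)).le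
  let T : Spc m × ℝ → Spc m × ℝ := fun y => (y.1 + (q.1 - p.1), y.2 + (q.2 - p.2))
  have hT : ∀ y, T y = y + (q - p) := fun y => rfl
  have hTd : ∀ y, dist (T y) y = dist q p := fun y => by
    rw [hT, dist_eq_norm, dist_eq_norm]; simp
  have hTm : ∀ y ∈ pBox p.1 p.2 r, T y ∈ Metric.closedBall p R := fun y hy => by
    rw [Metric.mem_closedBall]
    have := dist_triangle (T y) y p
    have := hbox y hy
    rw [hTd] at *; linarith
  have hm : ∀ y ∈ pBox p.1 p.2 r, y ∈ Metric.closedBall p R := fun y hy => by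
    rw [Metric.mem_closedBall]; have := hbox y hy; linarith
  have hTu : ∀ y ∈ pBox p.1 p.2 r, HeatOp (fun y => u (T y)) y 0 := fun y hy =>
    HeatOp.translate (hs _ (hRΩ (hTm y hy)))
  have hpp : p ∈ pBox p.1 p.2 r := ⟨by simp [hr0.le], by nlinarith, le_rfl⟩
  have hTp : T p = q := by rw [hT]; abel
  have key := abs_pderiv_le (w := fun y => u (T y) - u y) (M := ε') hr0 (z := p.1) (t := p.2)
    (ContinuousOn.sub (hu.comp (by fun_prop) fun y hy => hRΩ (hTm y hy)) (hu.mono fun y hy => hRΩ (hm y hy)))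
    (fun y hy => by simpa using (hTu y hy).sub (hs y (hRΩ (hm y hy))))
    (fun y hy => by
      have := hδu (T y) (hTm y hy) y (hm y hy) (by rwa [hTd])
      rw [Real.dist_eq] at this; exact this.le) i
  have e : pderiv (fun y => u (T y) - u y) i p = pderiv u i q - pderiv u i p := by
    have h1 := (hs q (by rw [← hTp]; exact hRΩ (hTm p hpp))).hasDerivAt_pderiv i
    have h2 := (hs p hp).hasDerivAt_pderiv i
    have h3 := (h1.sub h2).deriv
    rw [← h3]
    unfold pderiv
    congr 1
    funext s
    simp only [T, Pi.sub_apply]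
    congr 3
    · abel
    · ring
  rw [e] at key
  rw [Real.dist_eq]
  refine key.trans_lt ?_
  rw [hε']
  rw [show (2 * m + 5) * (ε * r / (2 * (2 * m + 5))) / r = ε / 2 by field_simp]
  linarith

lemma isLittleO_sub_sub_deriv {α : Type*} {l : Filter α} {v : α → ℝ} {w : ℝ} (hv : Tendsto v l (𝓝 w))
    {f f' : α → ℝ → ℝ} {d : ℝ} (df' : ∀ᶠ p in l ×ˢ 𝓝 w, HasDerivAt (f p.1) (f' p.1 p.2) p.2)
    (cf' : Tendsto (fun p : α × ℝ => f' p.1 p.2) (l ×ˢ 𝓝 w) (𝓝 d)) :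
    (fun χ => f χ (v χ) - f χ w - (v χ - w) * d) =o[l] (fun χ => v χ - w) := by
  rw [Asymptotics.isLittleO_iff]
  intro ε hε
  have hw : Tendsto (fun _ : α => w) l (𝓝 w) := tendsto_const_nhds
  rw [← nhdsWithin_univ] at df' cf'
  replace df' : ∀ᶠ χ in l, ∀ z ∈ segment ℝ w (v χ), HasDerivAt (f χ) (f' χ z) z :=
    df'.segment_of_prod_nhdsWithin hw hv (by simp)
  have cf'' : ∀ᶠ χ in l, ∀ z ∈ segment ℝ w (v χ), dist (f' χ z) d < ε :=
    (Metric.tendsto_nhds.1 cf' ε hε).segment_of_prod_nhdsWithin hw hv (by simp)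
  filter_upwards [df', cf''] with χ df' cf'
  have := Convex.norm_image_sub_le_of_norm_hasDerivWithin_le (f := fun z => f χ z - z * d)
    (f' := fun z => f' χ z - 1 * d) (C := ε) (s := segment ℝ w (v χ))
    (fun z hz => ((df' z hz).sub ((hasDerivAt_id z).mul_const d)).hasDerivWithinAt)
    (fun z hz => by simpa [dist_eq_norm] using (cf' z hz).le)
    (convex_segment ..) (left_mem_segment ..) (right_mem_segment ..)
  refine le_of_eq_of_le ?_ this
  congr 1; ring

/-- Derivative of a solution along a path moving in the direction of a coordinate axis. -/
theorem hasDerivAt_moving {u : Spc m × ℝ → ℝ} {Ω : Set (Spc m × ℝ)} (hΩ : IsOpen Ω)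
    (hu : ContinuousOn u Ω) (hs : ∀ p ∈ Ω, HeatOp u p 0) (i : Fin (m + 1)) {x : Spc m} {t : ℝ}
    {ξ : ℝ → ℝ} {ξ' d : ℝ} (hξ : HasDerivAt ξ ξ' t) (hp : (x + ξ t • eVec m i, t) ∈ Ω)
    (hd : HasDerivAt (fun s => u (x + ξ t • eVec m i, s)) d t) :
    HasDerivAt (fun s => u (x + ξ s • eVec m i, s))
      (d + ξ' * pderiv u i (x + ξ t • eVec m i, t)) t := by
  have hc := continuousAt_pderiv hΩ hu hs i hp
  have hmap : Tendsto (fun q : ℝ × ℝ => (x + q.2 • eVec m i, q.1)) (𝓝 t ×ˢ 𝓝 (ξ t))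
      (𝓝 (x + ξ t • eVec m i, t)) := by
    rw [← nhds_prod_eq]
    have : Continuous (fun q : ℝ × ℝ => (x + q.2 • eVec m i, q.1)) := by fun_prop
    exact this.tendsto (t, ξ t)
  have hlo := isLittleO_sub_sub_deriv (f := fun s a => u (x + a • eVec m i, s))
    (f' := fun s a => pderiv u i (x + a • eVec m i, s)) hξ.continuousAt
    (by
      filter_upwards [hmap.eventually (hΩ.mem_nhds hp)] with q hq
      exact HeatOp.hasDerivAt_line (hs _ hq))
    (hc.tendsto.comp hmap)
  have h1 : HasDerivAt (fun s => u (x + ξ s • eVec m i, s) - u (x + ξ t • eVec m i, s))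
      (ξ' * pderiv u i (x + ξ t • eVec m i, t)) t := by
    have h2 : HasDerivAt (fun s => (ξ s - ξ t) * pderiv u i (x + ξ t • eVec m i, t))
        (ξ' * pderiv u i (x + ξ t • eVec m i, t)) t := (hξ.sub_const _).mul_const _
    rw [hasDerivAt_iff_isLittleO] at h2 ⊢
    have h3 := hlo.trans_isBigO hξ.isBigO_sub
    refine (h3.add h2).congr_left fun s => ?_
    simp
  refine ((h1.add hd).congr_of_eventuallyEq (Eventually.of_forall fun s => ?_)).congr_deriv (by ring)
  simp

/-- Galilean-type boost of a solution of the heat equation. -/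
theorem HeatOp.boost {u : Spc m × ℝ → ℝ} {Ω : Set (Spc m × ℝ)} (hΩ : IsOpen Ω)
    (hu : ContinuousOn u Ω) (hs : ∀ p ∈ Ω, HeatOp u p 0) (i : Fin (m + 1)) {p : Spc m × ℝ}
    {ξ : ℝ → ℝ} {c a t : ℝ} (hξ : HasDerivAt ξ (2 * c) p.2)
    (hp : (p.1 + ξ p.2 • eVec m i, p.2) ∈ Ω) :
    HeatOp (fun q => Real.exp (c * (q.1 i - a) + c ^ 2 * (q.2 - t)) *
      u (q.1 + ξ q.2 • eVec m i, q.2)) p 0 := by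
  obtain ⟨a', b, h1, h2⟩ := hs _ hp
  have ha' : a' i = pderiv u i (p.1 + ξ p.2 • eVec m i, p.2) := (h1 i).hasDerivAt.deriv.symm
  set e := Real.exp (c * (p.1 i - a) + c ^ 2 * (p.2 - t)) with he
  set v := u (p.1 + ξ p.2 • eVec m i, p.2) with hv
  refine ⟨fun j => if j = i then e * (c * v + a' i) else e * a' j,
    fun j => e * b j + if j = i then e * (c ^ 2 * v + 2 * c * a' i) else 0, fun j => ?_, ?_⟩
  · have hj := h1 j
    have hj' : HasLine2 (fun y => u (y + ξ p.2 • eVec m i, p.2)) p.1 j (a' j) (b j) := by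
      have := HasLine2.comp_of_line (T := fun y => y + ξ p.2 • eVec m i) (l := 1) (x := p.1)
        (by norm_num) (fun s => by simp only [one_mul]; abel) hj
      simpa using this
    by_cases hji : j = i
    · subst hji
      obtain ⟨φ, k0, k1, k2⟩ := hj'
      simp only [if_true]
      let E : ℝ → ℝ := fun s => Real.exp (c * (p.1 j + s - a) + c ^ 2 * (p.2 - t))
      have hE : ∀ s, HasDerivAt E (E s * c) s := by
        intro s
        have : HasDerivAt (fun s : ℝ => c * (p.1 j + s - a) + c ^ 2 * (p.2 - t)) c s := by
          have := ((((hasDerivAt_id s).const_add (p.1 j)).sub_const a).const_mul c).add_const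
            (c ^ 2 * (p.2 - t))
          exact this.congr_deriv (by simp)
        exact this.exp
      have hE0 : E 0 = e := by simp [E, he]
      let f : ℝ → ℝ := fun s => u (p.1 + s • eVec m j + ξ p.2 • eVec m j, p.2)
      have hf0 : f 0 = v := by simp [f, hv]
      refine ⟨fun s => E s * c * f s + E s * φ s, ?_, ?_, ?_⟩
      · simp only [hE0, hf0, k0]; ring
      · filter_upwards [k1] with s hs
        refine ((hE s).mul hs).congr_of_eventuallyEq (Eventually.of_forall fun r => ?_)
        simp [E, eVec_apply]
      · have hf : HasDerivAt f (φ 0) 0 := k1.self_of_nhds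
        refine ((((hE 0).mul_const c).mul hf).add ((hE 0).mul k2)).congr_deriv ?_
        simp only [hE0, hf0, k0]; ring
    · simp only [hji, if_false]
      have := hj'.const_mul e
      have h3 : HasLine2 (fun y : Spc m => Real.exp (c * (y i - a) + c ^ 2 * (p.2 - t)) *
          u (y + ξ p.2 • eVec m i, p.2)) p.1 j (e * a' j) (e * b j) := by
        obtain ⟨φ, k0, k1, k2⟩ := this
        refine ⟨φ, k0, ?_, k2⟩
        filter_upwards [k1] with s hs
        refine hs.congr_of_eventuallyEq (Eventually.of_forall fun r => ?_)
        simp [eVec_apply, Ne.symm hji, he]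
      simpa using h3
  · have h3 := hasDerivAt_moving hΩ hu hs i hξ hp h2
    have h4 : HasDerivAt (fun s => Real.exp (c * (p.1 i - a) + c ^ 2 * (s - t))) (e * c ^ 2) p.2 := by
      have : HasDerivAt (fun s : ℝ => c * (p.1 i - a) + c ^ 2 * (s - t)) (c ^ 2) p.2 := by
        have := (((hasDerivAt_id p.2).sub_const t).const_mul (c ^ 2)).const_add (c * (p.1 i - a))
        exact this.congr_deriv (by simp)
      exact this.exp
    refine (h4.mul h3).congr_deriv ?_
    rw [Finset.sum_add_distrib, ← Finset.mul_sum]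
    simp only [Finset.sum_ite_eq', Finset.mem_univ, if_true, ← ha', ← he, ← hv]
    ring

end Boost

section Spread

variable {m : ℕ}

lemma norm_sq_line (x y : Spc m) (i : Fin (m + 1)) (s : ℝ) :
    ‖x + s • eVec m i - y‖ ^ 2 = ‖x - y‖ ^ 2 + 2 * s * (x i - y i) + s ^ 2 := by
  rw [show x + s • eVec m i - y = (x - y) + s • eVec m i by abel, norm_add_sq_real, norm_smul, norm_eVec]
  have : inner ℝ (x - y) (s • eVec m i) = s * (x i - y i) := by
    rw [inner_smul_right, eVec, EuclideanSpace.inner_single_right]; simp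
  rw [this, Real.norm_eq_abs, mul_one, sq_abs]; ring

lemma norm_sq_eq_sum (x : Spc m) : ‖x‖ ^ 2 = ∑ i, x i ^ 2 := by
  rw [EuclideanSpace.norm_sq_eq]; simp

/-- The caloric operator on the spreading barrier. -/
lemma heatOp_barrier (y : Spc m) (S β t0 : ℝ) (q : ℕ) (p : Spc m × ℝ) (hψ : 0 < S + β * (p.2 - t0)) :
    HeatOp (fun r : Spc m × ℝ => (S + β * (r.2 - t0) - ‖r.1 - y‖ ^ 2) ^ 2 / (S + β * (r.2 - t0)) ^ q) p
      ((2 * β * (S + β * (p.2 - t0) - ‖p.1 - y‖ ^ 2) * (S + β * (p.2 - t0))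
        - q * β * (S + β * (p.2 - t0) - ‖p.1 - y‖ ^ 2) ^ 2
        + 4 * (m + 1) * (S + β * (p.2 - t0) - ‖p.1 - y‖ ^ 2) * (S + β * (p.2 - t0))
        - 8 * ‖p.1 - y‖ ^ 2 * (S + β * (p.2 - t0))) / (S + β * (p.2 - t0)) ^ (q + 1)) := by
  set ψ := S + β * (p.2 - t0) with hψd
  set ρ := ‖p.1 - y‖ ^ 2 with hρ
  refine ⟨fun i => 2 * (ψ - ρ) * (-(2 * (p.1 i - y i))) / ψ ^ q,
    fun i => (2 * (2 * (p.1 i - y i)) ^ 2 - 4 * (ψ - ρ)) / ψ ^ q, fun i => ?_, ?_⟩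
  · let h : ℝ → ℝ := fun s => ψ - (ρ + 2 * s * (p.1 i - y i) + s ^ 2)
    let h' : ℝ → ℝ := fun s => -(2 * (p.1 i - y i) + 2 * s)
    have hh : ∀ s, HasDerivAt h (h' s) s := by
      intro s
      have h1 := ((((hasDerivAt_id s).const_mul 2).mul_const (p.1 i - y i)).const_add ρ).add
        ((hasDerivAt_id s).pow 2)
      exact (h1.const_sub ψ).congr_deriv (by simp [h'])
    have hh' : HasDerivAt h' (-2) 0 :=
      ((((hasDerivAt_id (0 : ℝ)).const_mul 2).const_add (2 * (p.1 i - y i))).neg).congr_deriv (by simp)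
    refine ⟨fun s => 2 * h s * h' s / ψ ^ q, by simp [h, h'], Eventually.of_forall fun s => ?_, ?_⟩
    · refine ((((hh s).pow 2).div_const (ψ ^ q)).congr_of_eventuallyEq
        (Eventually.of_forall fun r => ?_)).congr_deriv (by simp)
      simp only [norm_sq_line]; rfl
    · refine ((((hh 0).const_mul 2).mul hh').div_const (ψ ^ q)).congr_deriv ?_
      simp only [h, h']
      ring
  · have hl : HasDerivAt (fun s : ℝ => S + β * (s - t0)) β p.2 :=
      ((((hasDerivAt_id p.2).sub_const t0).const_mul β).const_add S).congr_deriv (by simp)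
    have h1 := ((hl.sub_const ρ).pow 2).div (hl.pow q) (pow_pos hψ q).ne'
    refine h1.congr_deriv ?_
    have hsum : ∑ i, (2 * (2 * (p.1 i - y i)) ^ 2 - 4 * (ψ - ρ)) / ψ ^ q
        = (8 * ρ - 4 * (m + 1) * (ψ - ρ)) / ψ ^ q := by
      rw [← Finset.sum_div, Finset.sum_sub_distrib, hρ, norm_sq_eq_sum, Finset.mul_sum]
      congr 2
      · refine Finset.sum_congr rfl fun i _ => ?_
        simp; ring
      · simp; ring
    simp only [Pi.pow_apply]
    rw [hsum, ← hψd]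
    have hψ0 : ψ ≠ 0 := hψ.ne'
    rcases q with _ | q
    · simp; field_simp; ring
    · simp only [Nat.add_sub_cancel]
      push_cast
      field_simp
      ring

/-- Paraboloid on which positivity spreads. -/
def spreadSet (y : Spc m) (S β t0 t1 : ℝ) : Set (Spc m × ℝ) :=
  {p | t0 ≤ p.2 ∧ p.2 ≤ t1 ∧ ‖p.1 - y‖ ^ 2 ≤ S + β * (p.2 - t0)}

lemma isCompact_spreadSet (y : Spc m) {S β t0 t1 : ℝ} (hβ : 0 ≤ β) :
    IsCompact (spreadSet y S β t0 t1) := by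
  refine ((isCompact_closedBall y (Real.sqrt (S + β * (t1 - t0)))).prod
    (isCompact_Icc (a := t0) (b := t1))).of_isClosed_subset ?_ ?_
  · have e : spreadSet y S β t0 t1 = {p : Spc m × ℝ | t0 ≤ p.2} ∩ ({p | p.2 ≤ t1} ∩
        {p | ‖p.1 - y‖ ^ 2 ≤ S + β * (p.2 - t0)}) := rfl
    rw [e]
    exact ((isClosed_le continuous_const (by fun_prop)).inter
      ((isClosed_le (by fun_prop) continuous_const).inter (isClosed_le (by fun_prop) (by fun_prop))))
  · rintro p ⟨h1, h2, h3⟩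
    refine ⟨?_, h1, h2⟩
    rw [mem_closedBall_iff_norm]
    refine Real.le_sqrt_of_sq_le (h3.trans ?_)
    gcongr

theorem spread_barrier_le {u : Spc m × ℝ → ℝ} {y : Spc m} {S β t0 t1 M : ℝ} {q : ℕ} (hS : 0 < S)
    (hβ : 0 < β) (hM : 0 ≤ M) (hq : (2 * β + 4 * (m + 1) + 8) ^ 2 ≤ 32 * β * q)
    (hu : ContinuousOn u (spreadSet y S β t0 t1))
    (hs : ∀ p ∈ spreadSet y S β t0 t1, HeatOp u p 0)
    (hpos : ∀ p ∈ spreadSet y S β t0 t1, 0 ≤ u p)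
    (hini : ∀ x, ‖x - y‖ ^ 2 ≤ S → M ≤ u (x, t0)) {p : Spc m × ℝ} (hp : p ∈ spreadSet y S β t0 t1) :
    M * (S ^ q / S ^ 2) * ((S + β * (p.2 - t0) - ‖p.1 - y‖ ^ 2) ^ 2 / (S + β * (p.2 - t0)) ^ q) ≤ u p := by
  set A := M * (S ^ q / S ^ 2) with hA
  have hA0 : 0 ≤ A := by positivity
  let Z : Spc m × ℝ → ℝ := fun r =>
    (S + β * (r.2 - t0) - ‖r.1 - y‖ ^ 2) ^ 2 / (S + β * (r.2 - t0)) ^ q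
  have hψ : ∀ r ∈ spreadSet y S β t0 t1, 0 < S + β * (r.2 - t0) := fun r hr => by
    have := mul_nonneg hβ.le (sub_nonneg.2 hr.1); linarith
  suffices h : ∀ r ∈ spreadSet y S β t0 t1, 0 ≤ u r - A * Z r by
    have := h p hp; linarith
  refine heat_min_principle (isCompact_spreadSet y hβ.le) (hu.sub (continuousOn_const.mul ?_)) ?_
  · refine ContinuousOn.div (by fun_prop) (by fun_prop) fun r hr => (pow_pos (hψ r hr) q).ne'
  intro r hr
  have hψr := hψ r hr
  obtain ⟨h1, h2, h3⟩ := hr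
  by_cases c1 : r.2 = t0
  · left
    rw [c1] at h3
    have h3' : ‖r.1 - y‖ ^ 2 ≤ S := by simpa using h3
    have := hini r.1 h3'
    rw [← c1] at this
    have hz : A * Z r ≤ M := by
      simp only [Z, c1, sub_self, mul_zero, add_zero, hA]
      have : M * (S ^ q / S ^ 2) * ((S - ‖r.1 - y‖ ^ 2) ^ 2 / S ^ q) = M * ((S - ‖r.1 - y‖ ^ 2) ^ 2 / S ^ 2) := by
        field_simp
      rw [this]
      refine mul_le_of_le_one_right hM ?_
      rw [div_le_one (by positivity)]
      have := sq_nonneg ‖r.1 - y‖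
      gcongr
      linarith
    linarith
  by_cases c2 : ‖r.1 - y‖ ^ 2 = S + β * (r.2 - t0)
  · left
    have : Z r = 0 := by simp [Z, c2]
    rw [this]; simpa using hpos r ⟨h1, h2, h3⟩
  right
  have h1' : t0 < r.2 := lt_of_le_of_ne h1 (Ne.symm c1)
  have h3' : ‖r.1 - y‖ ^ 2 < S + β * (r.2 - t0) := lt_of_le_of_ne h3 c2
  refine ⟨?_, ?_, _, ?_, (hs r ⟨h1, h2, h3⟩).sub ((heatOp_barrier y S β t0 q r hψr).const_mul A)⟩
  · have : ∀ᶠ z : Spc m in 𝓝 r.1, ‖z - y‖ ^ 2 < S + β * (r.2 - t0) :=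
      (isOpen_lt (by fun_prop) continuous_const).mem_nhds h3'
    filter_upwards [this] with z hz using ⟨h1, h2, hz.le⟩
  · have : ∀ᶠ s in 𝓝 r.2, ‖r.1 - y‖ ^ 2 < S + β * (s - t0) :=
      (isOpen_lt continuous_const (by fun_prop)).mem_nhds h3'
    filter_upwards [self_mem_nhdsWithin, mem_nhdsWithin_of_mem_nhds (lt_mem_nhds h1'),
      mem_nhdsWithin_of_mem_nhds this] with s k1 k2 k3
    exact ⟨le_of_lt k2, (le_of_lt k1).trans h2, k3.le⟩
  · rw [zero_sub, ← mul_neg]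
    refine mul_nonneg hA0 ?_
    rw [← neg_div]
    refine div_nonneg ?_ (by positivity)
    generalize hψe : S + β * (r.2 - t0) = ψ at *
    generalize ‖r.1 - y‖ ^ 2 = ρ at *
    have e : 0 ≤ ψ - ρ := by linarith
    set s := ψ - ρ with hse
    have hρ : ρ = ψ - s := by rw [hse]; ring
    rw [hρ]
    have k : (2 * β + 4 * (m + 1) + 8) ^ 2 * s ^ 2 ≤ 32 * β * q * s ^ 2 := by gcongr
    nlinarith [sq_nonneg ((2 * β + 4 * (m + 1) + 8) * s - 16 * ψ)]

/-- Spreading of positivity: a lower bound on a ball propagates polynomially in the scale. -/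
theorem spread {u : Spc m × ℝ → ℝ} {y : Spc m} {S β t0 t1 M : ℝ} {q : ℕ} (hS : 0 < S)
    (hβ : 0 < β) (hM : 0 ≤ M) (hq : (2 * β + 4 * (m + 1) + 8) ^ 2 ≤ 32 * β * q)
    (hu : ContinuousOn u (spreadSet y S β t0 t1))
    (hs : ∀ p ∈ spreadSet y S β t0 t1, HeatOp u p 0)
    (hpos : ∀ p ∈ spreadSet y S β t0 t1, 0 ≤ u p)
    (hini : ∀ x, ‖x - y‖ ^ 2 ≤ S → M ≤ u (x, t0)) {x : Spc m} (ht : t0 ≤ t1)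
    (hx : 2 * ‖x - y‖ ^ 2 ≤ S + β * (t1 - t0)) :
    M / 4 * (S / (S + β * (t1 - t0))) ^ q ≤ u (x, t1) := by
  have h0 := mul_nonneg hβ.le (sub_nonneg.2 ht)
  have hψ : 0 < S + β * (t1 - t0) := by linarith
  refine le_trans ?_ (spread_barrier_le hS hβ hM hq hu hs hpos hini (p := (x, t1))
    ⟨ht, le_rfl, by dsimp only; nlinarith [sq_nonneg ‖x - y‖]⟩)
  dsimp only
  generalize hψe : S + β * (t1 - t0) = ψ at *
  have h1 : ψ ^ 2 / 4 ≤ (ψ - ‖x - y‖ ^ 2) ^ 2 := by nlinarith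
  have h2 : S ^ 2 ≤ ψ ^ 2 := by nlinarith
  rw [div_pow]
  have e1 : M / 4 * (S ^ q / ψ ^ q) = M * S ^ q / ψ ^ q * (1 / 4) := by ring
  have e2 : M * (S ^ q / S ^ 2) * ((ψ - ‖x - y‖ ^ 2) ^ 2 / ψ ^ q) =
      M * S ^ q / ψ ^ q * ((ψ - ‖x - y‖ ^ 2) ^ 2 / S ^ 2) := by ring
  rw [e1, e2]
  refine mul_le_mul_of_nonneg_left ?_ (by positivity)
  rw [le_div_iff₀ (by positivity)]
  linarith

end Spread

section Harnack

variable {m : ℕ}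

lemma abs_sub_le_of_coord_lipschitz {f : Spc m → ℝ} {x0 : Spc m} {δ L : ℝ}
    (h : ∀ (w : Spc m) (i : Fin (m + 1)) (s : ℝ), (∀ j, |w j - x0 j| ≤ δ) →
      (∀ j, |(w + s • eVec m i) j - x0 j| ≤ δ) → |f (w + s • eVec m i) - f w| ≤ L * |s|)
    {x : Spc m} (hx : ∀ j, |x j - x0 j| ≤ δ) : |f x - f x0| ≤ L * ∑ j, |x j - x0 j| := by
  have hδ : 0 ≤ δ := (abs_nonneg _).trans (hx 0)
  have key : ∀ T : Finset (Fin (m + 1)),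
      |f (x0 + ∑ j ∈ T, (x j - x0 j) • eVec m j) - f x0| ≤ L * ∑ j ∈ T, |x j - x0 j| := by
    have hc : ∀ (T : Finset (Fin (m + 1))) (k), (x0 + ∑ j ∈ T, (x j - x0 j) • eVec m j) k - x0 k
        = if k ∈ T then x k - x0 k else 0 := by
      intro T k
      simp [eVec_apply]
    have hb : ∀ (T : Finset (Fin (m + 1))) (k),
        |(x0 + ∑ j ∈ T, (x j - x0 j) • eVec m j) k - x0 k| ≤ δ := by
      intro T k
      rw [hc]; split_ifs
      · exact hx k
      · simpa using hδ
    intro T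
    induction T using Finset.induction_on with
    | empty => simp
    | insert i T hi ih =>
      have e : x0 + ∑ j ∈ insert i T, (x j - x0 j) • eVec m j =
          (x0 + ∑ j ∈ T, (x j - x0 j) • eVec m j) + (x i - x0 i) • eVec m i := by
        rw [Finset.sum_insert hi]; abel
      have h1 := h (x0 + ∑ j ∈ T, (x j - x0 j) • eVec m j) i (x i - x0 i) (hb T)
        (by rw [← e]; exact hb _)
      rw [← e] at h1
      rw [Finset.sum_insert (f := fun j => |x j - x0 j|) hi, mul_add]
      have := abs_sub_le (f (x0 + ∑ j ∈ insert i T, (x j - x0 j) • eVec m j))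
        (f (x0 + ∑ j ∈ T, (x j - x0 j) • eVec m j)) (f x0)
      linarith
  have e : x0 + ∑ j, (x j - x0 j) • eVec m j = x := by
    ext k; simp [eVec_apply]
  simpa [e] using key Finset.univ

/-- Interior Lipschitz estimate in the space variables. -/
theorem abs_sub_le_of_bounded {w : Spc m × ℝ → ℝ} {x0 : Spc m} {t δ M : ℝ} (hδ : 0 < δ)
    (hw : ContinuousOn w (pBox x0 t (2 * δ))) (hs : ∀ p ∈ pBox x0 t (2 * δ), HeatOp w p 0)
    (hM : ∀ p ∈ pBox x0 t (2 * δ), |w p| ≤ M) {x : Spc m} (hx : ∀ j, |x j - x0 j| ≤ δ) :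
    |w (x, t) - w (x0, t)| ≤ (2 * m + 5) * M / δ * ∑ j, |x j - x0 j| := by
  refine abs_sub_le_of_coord_lipschitz (f := fun y => w (y, t)) (δ := δ) (fun y i s hy hys => ?_) hx
  set z := y + (s / 2) • eVec m i with hz
  have hzb : ∀ j, |z j - x0 j| ≤ δ := by
    intro j
    have e : z j - x0 j = ((y j - x0 j) + ((y + s • eVec m i) j - x0 j)) / 2 := by
      simp [hz]; ring
    rw [e, abs_div, abs_two, div_le_iff₀ two_pos]
    linarith [abs_add_le (y j - x0 j) ((y + s • eVec m i) j - x0 j), hy j, hys j]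
  have hsub : pBox z t δ ⊆ pBox x0 t (2 * δ) := by
    rintro p ⟨h1, h2, h3⟩
    refine ⟨fun j => ?_, by nlinarith, h3⟩
    have := abs_sub_le (p.1 j) (z j) (x0 j)
    linarith [h1 j, hzb j]
  have hs2 : |s| / 2 ≤ δ := by
    have e : s = ((y + s • eVec m i) i - x0 i) - (y i - x0 i) := by simp [eVec_apply]
    have := abs_sub ((y + s • eVec m i) i - x0 i) (y i - x0 i)
    rw [← e] at this
    linarith [hy i, hys i]
  have h := abs_sub_le_of_pBox hδ (hw.mono hsub) (fun p hp => hs p (hsub hp))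
    (fun p hp => hM p (hsub hp)) i (s := |s| / 2) (by positivity) hs2
  have e2 : (2 * m + 5) * M / δ * |s| = (4 * m + 10) * M * (|s| / 2) / δ := by ring
  rw [e2]
  refine le_of_eq_of_le ?_ h
  rcases le_total 0 s with h0 | h0
  · rw [abs_of_nonneg h0, hz]
    congr 4
    · rw [add_assoc, ← add_smul]; congr 2; ring
    · abel
  · rw [abs_of_nonpos h0, hz, abs_sub_comm]
    congr 4
    · rw [add_assoc, ← add_smul, show s / 2 + -s / 2 = 0 by ring]; simp
    · rw [add_sub_assoc, ← sub_smul]; congr 2; ring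

/-- The cylinder `B̄(z, 9ρ) × [s - ρ², s + ρ²]`. -/
def hCyl (z : Spc m) (s ρ : ℝ) : Set (Spc m × ℝ) :=
  Metric.closedBall z (9 * ρ) ×ˢ Icc (s - ρ ^ 2) (s + ρ ^ 2)

/-- Parabolic distance used as a weight in the proof of the Harnack inequality. -/
def landisDist (z : Spc m) (s ρ : ℝ) (p : Spc m × ℝ) : ℝ :=
  min (2 * ρ - ‖p.1 - z‖) (Real.sqrt (p.2 - s + ρ ^ 2))

lemma continuous_landisDist (z : Spc m) (s ρ : ℝ) : Continuous (landisDist z s ρ) := by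
  unfold landisDist; fun_prop

/-- Landis-type selection of a point at which `u` is large and locally controlled. -/
lemma exists_landis_point {u : Spc m × ℝ → ℝ} {z x : Spc m} {s ρ : ℝ} {q : ℕ} (hq : q ≠ 0) (hρ : 0 < ρ)
    (hu : ContinuousOn u (Metric.closedBall z (2 * ρ) ×ˢ Icc (s - ρ ^ 2) s))
    (hpos : ∀ p ∈ Metric.closedBall z (2 * ρ) ×ˢ Icc (s - ρ ^ 2) s, 0 ≤ u p)
    (hx : ‖x - z‖ ≤ ρ) (hux : 0 < u (x, s)) :
    ∃ x1 t1 d1, 0 < d1 ∧ d1 ≤ ρ ∧ ‖x1 - z‖ + d1 ≤ 2 * ρ ∧ d1 ^ 2 ≤ t1 - s + ρ ^ 2 ∧ t1 ≤ s ∧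
      u (x, s) * ρ ^ q ≤ u (x1, t1) * d1 ^ q ∧
      ∀ r : Spc m × ℝ, ‖r.1 - x1‖ ≤ d1 / 2 → t1 - d1 ^ 2 / 4 ≤ r.2 → r.2 ≤ t1 →
        u r ≤ 2 ^ q * u (x1, t1) := by
  set P : Set (Spc m × ℝ) := Metric.closedBall z (2 * ρ) ×ˢ Icc (s - ρ ^ 2) s with hP
  have hxP : (x, s) ∈ P := ⟨by rw [mem_closedBall_iff_norm]; linarith, by nlinarith, le_rfl⟩
  obtain ⟨⟨x1, t1⟩, hp1, hmax⟩ := ((isCompact_closedBall z (2 * ρ)).prod isCompact_Icc).exists_isMaxOn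
    ⟨_, hxP⟩ (hu.mul ((continuous_landisDist z s ρ).pow q).continuousOn)
  have hmax' : ∀ r ∈ P, u r * landisDist z s ρ r ^ q ≤ u (x1, t1) * landisDist z s ρ (x1, t1) ^ q :=
    fun r hr => hmax hr
  have hdx : ρ ≤ landisDist z s ρ (x, s) := by
    refine le_min (by dsimp only; linarith) ?_
    simp [Real.sqrt_sq hρ.le]
  have hM1' : 0 ≤ u (x1, t1) := hpos _ hp1
  obtain ⟨hp1a, hp1b, hp1c⟩ := hp1
  rw [mem_closedBall_iff_norm] at hp1a
  simp only at hp1a hp1b hp1c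
  have hda : landisDist z s ρ (x1, t1) ≤ 2 * ρ - ‖x1 - z‖ := min_le_left _ _
  have hdb' : landisDist z s ρ (x1, t1) ≤ Real.sqrt (t1 - s + ρ ^ 2) := min_le_right _ _
  have hd10' : 0 ≤ landisDist z s ρ (x1, t1) := le_min (by dsimp only; linarith) (Real.sqrt_nonneg _)
  generalize landisDist z s ρ (x1, t1) = d1 at *
  generalize hM1 : u (x1, t1) = M1 at *
  have hmain : u (x, s) * ρ ^ q ≤ M1 * d1 ^ q :=
    le_trans (by gcongr) (hmax' _ hxP)
  have hd10 : 0 < d1 := by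
    rcases hd10'.eq_or_lt with h | h
    · rw [← h, zero_pow hq, mul_zero] at hmain
      have : 0 < u (x, s) * ρ ^ q := by positivity
      linarith
    · exact h
  have hdb : d1 ^ 2 ≤ t1 - s + ρ ^ 2 := by
    calc d1 ^ 2 ≤ Real.sqrt (t1 - s + ρ ^ 2) ^ 2 := by gcongr
      _ = _ := Real.sq_sqrt (by linarith)
  have hd1ρ : d1 ≤ ρ := abs_le_of_sq_le_sq' (by linarith) hρ.le |>.2
  refine ⟨x1, t1, d1, hd10, hd1ρ, by linarith, hdb, hp1c, by rwa [hM1], fun r h1 h2 h3 => ?_⟩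
  rw [hM1]
  have h4 : ‖r.1 - z‖ ≤ d1 / 2 + ‖x1 - z‖ := by
    have := norm_sub_le_norm_sub_add_norm_sub r.1 x1 z; linarith
  have hrP : r ∈ P := by
    refine ⟨?_, by linarith [sq_nonneg d1], by linarith⟩
    rw [mem_closedBall_iff_norm]; linarith
  have h5 : d1 / 2 ≤ landisDist z s ρ r := by
    refine le_min (by linarith) ?_
    refine Real.le_sqrt_of_sq_le ?_
    rw [div_pow]; linarith [sq_nonneg d1]
  have h6 := hmax' r hrP
  have h7 : u r * (d1 / 2) ^ q ≤ M1 * d1 ^ q :=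
    le_trans (mul_le_mul_of_nonneg_left (by gcongr) (hpos r hrP)) h6
  rw [div_pow, ← mul_div_assoc, div_le_iff₀ (by positivity)] at h7
  have h8 : u r * d1 ^ q ≤ (2 ^ q * M1) * d1 ^ q := by linarith
  exact le_of_mul_le_mul_right h8 (by positivity)

/-- A nonnegative solution controlled by `B` times its value at the centre is at least half of this
value on a ball of comparable size. -/
lemma half_le_of_bounded {u : Spc m × ℝ → ℝ} {x1 : Spc m} {t1 d1 B θ : ℝ} (hd1 : 0 < d1) (hB : 1 ≤ B)
    (hθ : θ = 1 / (8 * (m + 1) ^ 2 * (2 * m + 5) * B))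
    (hgood : ∀ r : Spc m × ℝ, ‖r.1 - x1‖ ≤ d1 / 2 → t1 - d1 ^ 2 / 4 ≤ r.2 → r.2 ≤ t1 →
        ContinuousAt u r ∨ ContinuousWithinAt u {r : Spc m × ℝ | ‖r.1 - x1‖ ≤ d1 / 2 ∧ t1 - d1 ^ 2 / 4 ≤ r.2 ∧ r.2 ≤ t1} r)
    (hs : ∀ r : Spc m × ℝ, ‖r.1 - x1‖ ≤ d1 / 2 → t1 - d1 ^ 2 / 4 ≤ r.2 → r.2 ≤ t1 →
        HeatOp u r 0 ∧ 0 ≤ u r ∧ u r ≤ B * u (x1, t1))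
    {w : Spc m} (hw : ‖w - x1‖ ≤ θ * d1) : u (x1, t1) / 2 ≤ u (w, t1) := by
  have hm0 : (0 : ℝ) ≤ m := Nat.cast_nonneg m
  have hθ0 : 0 < θ := by rw [hθ]; positivity
  have hθ1 : θ * (4 * (m + 1)) ≤ 1 := by
    rw [hθ, one_div_mul_eq_div, div_le_one (by positivity)]
    have h1 : (1 : ℝ) ≤ (m + 1) * (2 * m + 5) * B :=
      one_le_mul_of_one_le_of_one_le (one_le_mul_of_one_le_of_one_le (by linarith) (by linarith)) hB
    have h2 := mul_le_mul_of_nonneg_left h1 (show (0 : ℝ) ≤ 8 * (m + 1) by positivity)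
    linarith
  obtain ⟨δ, hδ⟩ : ∃ δ, δ = d1 / (4 * (m + 1)) := ⟨_, rfl⟩
  have hδ0 : 0 < δ := by rw [hδ]; positivity
  have hδ1 : (m + 1) * (2 * δ) = d1 / 2 := by rw [hδ]; field_simp; ring
  have hδ2 : (2 * δ) ^ 2 ≤ d1 ^ 2 / 4 := by
    have : 2 * δ ≤ d1 / 2 := by nlinarith
    calc (2 * δ) ^ 2 ≤ (d1 / 2) ^ 2 := by gcongr
      _ = _ := by ring
  have hbox : ∀ r ∈ pBox x1 t1 (2 * δ), ‖r.1 - x1‖ ≤ d1 / 2 ∧ t1 - d1 ^ 2 / 4 ≤ r.2 ∧ r.2 ≤ t1 := by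
    rintro r ⟨h1, h2, h3⟩
    refine ⟨?_, by linarith, h3⟩
    rw [← hδ1]
    exact norm_le_of_coord (by simpa using h1)
  have hwδ : ∀ j, |w j - x1 j| ≤ θ * d1 := fun j => (abs_coord_le (w - x1) j).trans hw
  have hθδ : θ * d1 ≤ δ := by
    rw [hδ, le_div_iff₀ (by positivity)]
    have := mul_le_mul_of_nonneg_right hθ1 hd1.le
    linarith
  have hM0 : 0 ≤ u (x1, t1) :=
    (hs (x1, t1) (by simp; positivity) (by linarith [sq_nonneg d1]) le_rfl).2.1
  have h := abs_sub_le_of_bounded (w := u) hδ0 (fun r hr => by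
      obtain ⟨h1, h2, h3⟩ := hbox r hr
      rcases hgood r h1 h2 h3 with h | h
      · exact h.continuousWithinAt
      · exact h.mono hbox)
    (fun r hr => (hs r (hbox r hr).1 (hbox r hr).2.1 (hbox r hr).2.2).1) (M := B * u (x1, t1))
    (fun r hr => by
      have := hs r (hbox r hr).1 (hbox r hr).2.1 (hbox r hr).2.2
      rw [abs_of_nonneg this.2.1]; exact this.2.2)
    (fun j => (hwδ j).trans hθδ)
  have hsum : ∑ j, |w j - x1 j| ≤ (m + 1) * (θ * d1) := by
    calc ∑ j, |w j - x1 j| ≤ ∑ _j : Fin (m + 1), θ * d1 := Finset.sum_le_sum fun j _ => hwδ j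
      _ = _ := by simp
  have h2 : (2 * m + 5) * (B * u (x1, t1)) / δ * ∑ j, |w j - x1 j| ≤ u (x1, t1) / 2 := by
    calc _ ≤ (2 * m + 5) * (B * u (x1, t1)) / δ * ((m + 1) * (θ * d1)) := by
          have : 0 ≤ B := by linarith
          gcongr
      _ = u (x1, t1) / 2 := by
        rw [hδ, hθ]
        have : B ≠ 0 := by positivity
        field_simp; ring
  have := (abs_le.1 (h.trans h2)).1
  linarith

theorem exists_harnack (m : ℕ) : ∃ C : ℝ, 1 ≤ C ∧ ∀ (u : Spc m × ℝ → ℝ) (z : Spc m) (s ρ : ℝ), 0 < ρ →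
    ContinuousOn u (hCyl z s ρ) → (∀ p ∈ hCyl z s ρ, HeatOp u p 0) → (∀ p ∈ hCyl z s ρ, 0 ≤ u p) →
    ∀ x y, ‖x - z‖ ≤ ρ → ‖y - z‖ ≤ ρ → u (x, s) ≤ C * u (y, s + ρ ^ 2) := by
  have hm0 : (0 : ℝ) ≤ m := Nat.cast_nonneg m
  obtain ⟨q, hq0, hq⟩ : ∃ q : ℕ, q ≠ 0 ∧ (2 * 18 + 4 * ((m : ℝ) + 1) + 8) ^ 2 ≤ 32 * 18 * q := by
    refine ⟨(m + 12) ^ 2, by positivity, ?_⟩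
    push_cast; nlinarith
  obtain ⟨B, hB⟩ : ∃ B : ℝ, B = 2 ^ (2 * q) := ⟨_, rfl⟩
  have hB1 : 1 ≤ B := by rw [hB]; exact one_le_pow₀ (by norm_num)
  obtain ⟨θ, hθ⟩ : ∃ θ : ℝ, θ = 1 / (8 * (m + 1) ^ 2 * (2 * m + 5) * B) := ⟨_, rfl⟩
  have hθ0 : 0 < θ := by rw [hθ]; positivity
  have hθ2 : θ ≤ 1 := by
    rw [hθ, div_le_one (by positivity)]
    exact one_le_mul_of_one_le_of_one_le (one_le_mul_of_one_le_of_one_le (by nlinarith) (by linarith)) hB1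
  have hC : (1 : ℝ) ≤ 37 / θ ^ 2 := by
    rw [le_div_iff₀ (by positivity)]; nlinarith
  refine ⟨8 * (37 / θ ^ 2) ^ q, ?_, ?_⟩
  · have := one_le_pow₀ hC (n := q); linarith
  intro u z s ρ hρ hu hs hpos x y hx hy
  have hρ2 : 0 < ρ ^ 2 := by positivity
  have hPQ : Metric.closedBall z (2 * ρ) ×ˢ Icc (s - ρ ^ 2) s ⊆ hCyl z s ρ := by
    refine prod_mono (Metric.closedBall_subset_closedBall (by linarith)) (Icc_subset_Icc le_rfl ?_)
    linarith
  have hyQ : (y, s + ρ ^ 2) ∈ hCyl z s ρ :=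
    ⟨by rw [mem_closedBall_iff_norm]; linarith, by dsimp only; linarith, le_rfl⟩
  have hxQ : (x, s) ∈ hCyl z s ρ :=
    ⟨by rw [mem_closedBall_iff_norm]; linarith, by dsimp only; linarith, by dsimp only; linarith⟩
  have huy := hpos _ hyQ
  rcases (hpos _ hxQ).eq_or_lt with hux0 | hux0
  · rw [← hux0]; positivity
  obtain ⟨x1, t1, d1, hd10, hd1ρ, hxz, hd1t, ht1, hmain, hloc⟩ := exists_landis_point (q := 2 * q)
    (by omega) hρ (hu.mono hPQ) (fun p hp => hpos p (hPQ hp)) hx hux0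
  have hQ : ∀ r : Spc m × ℝ, ‖r.1 - x1‖ ≤ d1 / 2 → t1 - d1 ^ 2 / 4 ≤ r.2 → r.2 ≤ t1 →
      r ∈ hCyl z s ρ := by
    intro r h1 h2 h3
    have := norm_sub_le_norm_sub_add_norm_sub r.1 x1 z
    refine ⟨?_, by linarith [sq_nonneg d1], by linarith⟩
    rw [mem_closedBall_iff_norm]; linarith
  have hM0 : 0 ≤ u (x1, t1) := hpos _ (hQ _ (by simp; positivity) (by dsimp only; linarith [sq_nonneg d1]) le_rfl)
  have hini : ∀ w : Spc m, ‖w - x1‖ ^ 2 ≤ (θ * d1) ^ 2 → u (x1, t1) / 2 ≤ u (w, t1) := by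
    intro w hw
    refine half_le_of_bounded hd10 hB1 hθ (fun r h1 h2 h3 => Or.inr ((hu r (hQ r h1 h2 h3)).mono ?_))
      (fun r h1 h2 h3 => ⟨hs r (hQ r h1 h2 h3), hpos r (hQ r h1 h2 h3), by rw [hB]; exact hloc r h1 h2 h3⟩)
      (abs_le_of_sq_le_sq' hw (by positivity) |>.2)
    rintro r ⟨h1, h2, h3⟩; exact hQ r h1 h2 h3
  obtain ⟨t2, ht2⟩ : ∃ t2, t2 = s + ρ ^ 2 := ⟨_, rfl⟩
  have hτ1 : ρ ^ 2 ≤ t2 - t1 := by linarith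
  have hτ2 : t2 - t1 ≤ 2 * ρ ^ 2 := by linarith [sq_nonneg d1]
  have hS : (θ * d1) ^ 2 ≤ ρ ^ 2 := by
    have : θ * d1 ≤ 1 * ρ := by gcongr
    rw [one_mul] at this
    gcongr
  have hsub : spreadSet x1 ((θ * d1) ^ 2) 18 t1 t2 ⊆ hCyl z s ρ := by
    rintro r ⟨h1, h2, h3⟩
    refine ⟨?_, by linarith [sq_nonneg d1], by linarith⟩
    rw [mem_closedBall_iff_norm]
    have h4 : ‖r.1 - x1‖ ^ 2 ≤ (7 * ρ) ^ 2 := by rw [mul_pow]; linarith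
    have h5 : ‖r.1 - x1‖ ≤ 7 * ρ := abs_le_of_sq_le_sq' h4 (by positivity) |>.2
    have := norm_sub_le_norm_sub_add_norm_sub r.1 x1 z
    linarith
  have hyx : ‖y - x1‖ ^ 2 ≤ 9 * ρ ^ 2 := by
    have h := norm_sub_le_norm_sub_add_norm_sub y z x1
    rw [norm_sub_rev z x1] at h
    have : ‖y - x1‖ ≤ 3 * ρ := by linarith
    calc ‖y - x1‖ ^ 2 ≤ (3 * ρ) ^ 2 := by gcongr
      _ = _ := by ring
  have hsp := spread (u := u) (y := x1) (S := (θ * d1) ^ 2) (β := 18) (t0 := t1) (t1 := t2)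
    (M := u (x1, t1) / 2) (q := q) (by positivity) (by norm_num) (by positivity) hq
    (hu.mono hsub) (fun p hp => hs p (hsub hp)) (fun p hp => hpos p (hsub hp)) hini (x := y)
    (by linarith) (by linarith [sq_nonneg (θ * d1)])
  have h3 : u (x1, t1) / 2 / 4 * ((θ * d1) ^ 2 / (37 * ρ ^ 2)) ^ q ≤ u (y, t2) := by
    refine le_trans ?_ hsp
    have : 0 < (θ * d1) ^ 2 + 18 * (t2 - t1) := by linarith [sq_nonneg (θ * d1)]
    gcongr
    linarith
  have h4 : u (x, s) ≤ u (x1, t1) * d1 ^ (2 * q) / ρ ^ (2 * q) := by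
    rw [le_div_iff₀ (by positivity)]; exact hmain
  rw [← ht2]
  calc u (x, s) ≤ u (x1, t1) * d1 ^ (2 * q) / ρ ^ (2 * q) := h4
    _ = 8 * (37 / θ ^ 2) ^ q * (u (x1, t1) / 2 / 4 * ((θ * d1) ^ 2 / (37 * ρ ^ 2)) ^ q) := by
      rw [div_pow, div_pow, mul_pow, mul_pow, mul_pow, pow_mul, pow_mul]
      field_simp
      ring
    _ ≤ _ := by gcongr

/-- A constant for which the Harnack inequality on `hCyl` holds. -/
def harnackC (m : ℕ) : ℝ := Classical.choose (exists_harnack m)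

lemma one_le_harnackC (m : ℕ) : 1 ≤ harnackC m := (Classical.choose_spec (exists_harnack m)).1

theorem harnack {u : Spc m × ℝ → ℝ} {z : Spc m} {s ρ : ℝ} (hρ : 0 < ρ)
    (hu : ContinuousOn u (hCyl z s ρ)) (hs : ∀ p ∈ hCyl z s ρ, HeatOp u p 0)
    (hpos : ∀ p ∈ hCyl z s ρ, 0 ≤ u p) {x y : Spc m} (hx : ‖x - z‖ ≤ ρ) (hy : ‖y - z‖ ≤ ρ) :
    u (x, s) ≤ harnackC m * u (y, s + ρ ^ 2) :=
  (Classical.choose_spec (exists_harnack m)).2 u z s ρ hρ hu hs hpos x y hx hy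

/-- Harnack inequality along a segment, in `k` steps of size `ρ`. -/
theorem harnack_chain {u : Spc m × ℝ → ℝ} {ρ : ℝ} (hρ : 0 < ρ) (k : ℕ) {x y : Spc m} {s : ℝ}
    (hxy : ‖y - x‖ ≤ k * ρ)
    (hgood : ∀ w τ, (∃ θ ∈ Icc (0 : ℝ) 1, ‖w - (x + θ • (y - x))‖ ≤ 9 * ρ) →
      s - ρ ^ 2 ≤ τ → τ ≤ s + k * ρ ^ 2 →
      ContinuousAt u (w, τ) ∧ HeatOp u (w, τ) 0 ∧ 0 ≤ u (w, τ)) :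
    u (x, s) ≤ harnackC m ^ k * u (y, s + k * ρ ^ 2) := by
  rcases Nat.eq_zero_or_pos k with hk | hk
  · subst hk
    have : y = x := by
      have : ‖y - x‖ ≤ 0 := by simpa using hxy
      simpa [sub_eq_zero] using this
    simp [this]
  have hk' : (0 : ℝ) < k := by exact_mod_cast hk
  let X : ℕ → Spc m := fun j => x + ((j : ℝ) / k) • (y - x)
  have hX0 : X 0 = x := by simp [X]
  have hXk : X k = y := by simp [X, hk'.ne']
  have key : ∀ j : ℕ, j ≤ k → u (x, s) ≤ harnackC m ^ j * u (X j, s + j * ρ ^ 2) := by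
    intro j
    induction j with
    | zero => intro _; simp [hX0]
    | succ j ih =>
      intro hj
      have ih := ih (by omega)
      have hj' : (j : ℝ) + 1 ≤ k := by exact_mod_cast hj
      have hjk : (j : ℝ) / k ∈ Icc (0 : ℝ) 1 :=
        ⟨by positivity, by rw [div_le_one hk']; linarith⟩
      have hsub : ∀ p ∈ hCyl (X j) (s + j * ρ ^ 2) ρ,
          ContinuousAt u p ∧ HeatOp u p 0 ∧ 0 ≤ u p := by
        rintro ⟨w, τ⟩ ⟨h1, h2, h3⟩
        rw [mem_closedBall_iff_norm] at h1
        refine hgood w τ ⟨_, hjk, h1⟩ ?_ ?_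
        · have : 0 ≤ (j : ℝ) * ρ ^ 2 := by positivity
          dsimp only at h2; linarith
        · dsimp only at h3
          nlinarith [sq_nonneg ρ]
      have hstep := harnack (u := u) (z := X j) (s := s + j * ρ ^ 2) (x := X j) (y := X (j + 1)) hρ
        (fun p hp => (hsub p hp).1.continuousWithinAt) (fun p hp => (hsub p hp).2.1)
        (fun p hp => (hsub p hp).2.2) (by simpa using hρ.le) (by
          have : X (j + 1) - X j = (1 / (k : ℝ)) • (y - x) := by
            simp only [X, add_sub_add_left_eq_sub, ← sub_smul]
            congr 1; push_cast; ring
          rw [this, norm_smul, Real.norm_of_nonneg (by positivity), one_div_mul_eq_div,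
            div_le_iff₀ hk']
          linarith)
      have e : s + j * ρ ^ 2 + ρ ^ 2 = s + (j + 1 : ℕ) * ρ ^ 2 := by push_cast; ring
      rw [e] at hstep
      calc u (x, s) ≤ harnackC m ^ j * u (X j, s + j * ρ ^ 2) := ih
        _ ≤ harnackC m ^ j * (harnackC m * u (X (j + 1), s + (j + 1 : ℕ) * ρ ^ 2)) := by
          have := one_le_harnackC m
          gcongr
        _ = _ := by rw [pow_succ]; ring
  simpa [hXk] using key k le_rfl

end Harnack

/-- The closed parabolic box around `(x0, t0)`. -/
def sBox {m : ℕ} (x0 : Spc m) (t0 r : ℝ) : Set (Spc m × ℝ) :=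
  {p | ‖p.1 - x0‖ ≤ r ∧ t0 - r ^ 2 ≤ p.2 ∧ p.2 ≤ t0 + r ^ 2}

lemma isCompact_sBox {m : ℕ} (x0 : Spc m) (t0 r : ℝ) : IsCompact (sBox x0 t0 r) := by
  have : sBox x0 t0 r = Metric.closedBall x0 r ×ˢ Icc (t0 - r ^ 2) (t0 + r ^ 2) := by
    ext p
    simp [sBox, dist_eq_norm]
  rw [this]
  exact (isCompact_closedBall _ _).prod isCompact_Icc

lemma sBox_mem_nhds {m : ℕ} (x0 : Spc m) (t0 : ℝ) {r : ℝ} (hr : 0 < r) : sBox x0 t0 r ∈ 𝓝 (x0, t0) := by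
  have : sBox x0 t0 r = Metric.closedBall x0 r ×ˢ Icc (t0 - r ^ 2) (t0 + r ^ 2) := by
    ext p
    simp [sBox, dist_eq_norm]
  rw [this]
  have := sq_pos_of_pos hr
  exact prod_mem_nhds (Metric.closedBall_mem_nhds _ hr) (Icc_mem_nhds (by linarith) (by linarith))

lemma sBox_mono {m : ℕ} (x0 : Spc m) (t0 : ℝ) {r r' : ℝ} (hr : 0 ≤ r) (h : r ≤ r') :
    sBox x0 t0 r ⊆ sBox x0 t0 r' := fun p hp => by
  have : r ^ 2 ≤ r' ^ 2 := pow_le_pow_left₀ hr h 2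
  exact ⟨hp.1.trans h, by linarith [hp.2.1], by linarith [hp.2.2]⟩

section growth

variable {m : ℕ} {f : Spc m × ℝ → ℝ} {x0 : Spc m} {t0 r : ℝ} {F : Set (Spc m × ℝ)}

lemma exists_nearest_fst (hF : IsCompact F) (h0 : (x0, t0) ∈ F) {x : Spc m} (hx : x ∉ Prod.fst '' F) :
    ∃ z ∈ Prod.fst '' F, 0 < ‖x - z‖ ∧ ‖x - z‖ ≤ ‖x - x0‖ ∧ ∀ w, ‖w - x‖ < ‖x - z‖ → w ∉ Prod.fst '' F := by
  obtain ⟨z, hz, hd⟩ := (hF.image continuous_fst).exists_infDist_eq_dist ⟨x0, (x0, t0), h0, rfl⟩ x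
  rw [dist_eq_norm] at hd
  refine ⟨z, hz, ?_, ?_, ?_⟩
  · rw [norm_pos_iff, sub_ne_zero]
    rintro rfl
    exact hx hz
  · rw [← hd, ← dist_eq_norm]
    exact Metric.infDist_le_dist_of_mem ⟨(x0, t0), h0, rfl⟩
  · intro w hw hwF
    have := Metric.infDist_le_dist_of_mem (x := x) hwF
    rw [hd, dist_comm, dist_eq_norm] at this
    linarith

lemma ge_of_ge_on_cross (hF : IsCompact F) (hFr : F ⊆ sBox x0 t0 r) (h0 : (x0, t0) ∈ F)
    (hgood : ∀ p ∈ sBox x0 t0 r, p ∉ F → ContinuousAt f p ∧ HeatOp f p 0)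
    (hpos : ∀ p ∈ sBox x0 t0 r, 0 ≤ f p) {S : ℝ}
    (hS : ∀ p ∈ sBox x0 t0 r, p.1 ∈ Prod.fst '' F ∨ p.2 ∈ Prod.snd '' F → S ≤ f p) :
    ∀ p ∈ sBox x0 t0 (r / 8), S ≤ harnackC m ^ 100 * f p := by
  rintro ⟨x, t⟩ hp
  have hr : 0 ≤ r := by have := (norm_nonneg _).trans hp.1; linarith
  have hp' : (x, t) ∈ sBox x0 t0 r := sBox_mono x0 t0 (by positivity) (by linarith) hp
  have hH := one_le_harnackC m
  by_cases hc : x ∈ Prod.fst '' F ∨ t ∈ Prod.snd '' F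
  · exact (hS _ hp' hc).trans (le_mul_of_one_le_left (hpos _ hp') (one_le_pow₀ hH))
  push Not at hc
  obtain ⟨hx, ht⟩ := hc
  obtain ⟨z, hz, hd0, hdx, hzball⟩ := exists_nearest_fst hF h0 hx
  obtain ⟨d, hd⟩ : ∃ d, d = ‖x - z‖ := ⟨_, rfl⟩
  rw [← hd] at hd0 hdx hzball
  obtain ⟨hp1, hp2, hp3⟩ := hp
  simp only at hp1 hp2 hp3
  have hdr : d ≤ r / 8 := hdx.trans hp1
  have hd2 : d ^ 2 ≤ (r / 8) ^ 2 := pow_le_pow_left₀ hd0.le hdr 2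
  by_cases hb : ∃ b ∈ Prod.snd '' F, t - d ^ 2 ≤ b ∧ b < t
  · obtain ⟨b, hbF, hb1, hb2⟩ := hb
    obtain ⟨ρ, hρ⟩ : ∃ ρ, ρ = Real.sqrt (t - b) / 10 := ⟨_, rfl⟩
    have hρ2 : 100 * ρ ^ 2 = t - b := by
      rw [hρ, div_pow, Real.sq_sqrt (by linarith)]; ring
    have hρ0 : 0 < ρ := by
      rw [hρ]
      exact div_pos (Real.sqrt_pos.2 (by linarith)) (by norm_num)
    have hρd : 10 * ρ ≤ d := by
      refine abs_le_of_sq_le_sq' (by nlinarith) hd0.le |>.2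
    have := harnack_chain (u := f) hρ0 100 (x := x) (y := x) (s := b) (by simp; positivity) ?_
    · have e : b + (100 : ℕ) * ρ ^ 2 = t := by push_cast; linarith
      rw [e] at this
      refine (hS (x, b) ⟨hp'.1, ?_, ?_⟩ (Or.inr hbF)).trans this
      · simp only; nlinarith
      · simp only; nlinarith
    · rintro w τ ⟨θ, hθ, hw⟩ h1 h2
      push_cast at h2
      simp only [sub_self, smul_zero, add_zero] at hw
      have hm : (w, τ) ∈ sBox x0 t0 r := by
        refine ⟨?_, ?_, ?_⟩
        · have := norm_sub_le_norm_sub_add_norm_sub w x x0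
          simp only; linarith
        · simp only; nlinarith
        · simp only; nlinarith
      have hg := hgood _ hm (fun h => hzball w (by linarith) ⟨_, h, rfl⟩)
      exact ⟨hg.1, hg.2, hpos _ hm⟩
  · push Not at hb
    have := harnack_chain (u := f) (ρ := d / 2) (by positivity) 2 (x := z) (y := x) (s := t - d ^ 2 / 2)
      (by push_cast; linarith) ?_
    · have e : t - d ^ 2 / 2 + (2 : ℕ) * (d / 2) ^ 2 = t := by push_cast; ring
      rw [e] at this
      obtain ⟨q, hq, rfl⟩ := hz
      refine (hS (q.1, t - d ^ 2 / 2) ⟨(hFr hq).1, ?_, ?_⟩ (Or.inl ⟨q, hq, rfl⟩)).trans (this.trans ?_)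
      · simp only; nlinarith
      · simp only; nlinarith
      · exact mul_le_mul_of_nonneg_right (pow_le_pow_right₀ hH (by norm_num)) (hpos _ hp')
    · rintro w τ ⟨θ, hθ, hw⟩ h1 h2
      push_cast at h2
      have hm : (w, τ) ∈ sBox x0 t0 r := by
        refine ⟨?_, ?_, ?_⟩
        · have h3 := norm_sub_le_norm_sub_add_norm_sub w (z + θ • (x - z)) x
          have h4 := norm_sub_le_norm_sub_add_norm_sub w x x0
          have h5 : ‖z + θ • (x - z) - x‖ ≤ d := by
            have : z + θ • (x - z) - x = (θ - 1) • (x - z) := by module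
            rw [this, norm_smul, ← hd, Real.norm_eq_abs, abs_of_nonpos (by linarith [hθ.2])]
            nlinarith [hθ.1]
          simp only; linarith
        · simp only; nlinarith
        · simp only; nlinarith
      have hg := hgood _ hm (fun h => by
        have h6 : τ ∈ Prod.snd '' F := ⟨_, h, rfl⟩
        have := hb τ h6 (by nlinarith)
        have h7 : τ = t := by nlinarith
        exact ht (h7 ▸ h6))
      exact ⟨hg.1, hg.2, hpos _ hm⟩

lemma le_of_le_on_cross (hF : IsCompact F) (hFr : F ⊆ sBox x0 t0 r) (h0 : (x0, t0) ∈ F)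
    (hgood : ∀ p ∈ sBox x0 t0 r, p ∉ F → ContinuousAt f p ∧ HeatOp f p 0)
    (hpos : ∀ p ∈ sBox x0 t0 r, 0 ≤ f p) {S : ℝ}
    (hS : ∀ p ∈ sBox x0 t0 r, p.1 ∈ Prod.fst '' F ∨ p.2 ∈ Prod.snd '' F → f p ≤ S) :
    ∀ p ∈ sBox x0 t0 (r / 8), f p ≤ harnackC m ^ 100 * S := by
  rintro ⟨x, t⟩ hp
  have hr : 0 ≤ r := by have := (norm_nonneg _).trans hp.1; linarith
  have hp' : (x, t) ∈ sBox x0 t0 r := sBox_mono x0 t0 (by positivity) (by linarith) hp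
  have hH := one_le_harnackC m
  have hS0 : 0 ≤ S := (hpos _ (hFr h0)).trans (hS _ (hFr h0) (Or.inl ⟨_, h0, rfl⟩))
  by_cases hc : x ∈ Prod.fst '' F ∨ t ∈ Prod.snd '' F
  · exact (hS _ hp' hc).trans (le_mul_of_one_le_left hS0 (one_le_pow₀ hH))
  push Not at hc
  obtain ⟨hx, ht⟩ := hc
  obtain ⟨z, hz, hd0, hdx, hzball⟩ := exists_nearest_fst hF h0 hx
  obtain ⟨d, hd⟩ : ∃ d, d = ‖x - z‖ := ⟨_, rfl⟩
  rw [← hd] at hd0 hdx hzball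
  obtain ⟨hp1, hp2, hp3⟩ := hp
  simp only at hp1 hp2 hp3
  have hdr : d ≤ r / 8 := hdx.trans hp1
  have hd2 : d ^ 2 ≤ (r / 8) ^ 2 := pow_le_pow_left₀ hd0.le hdr 2
  have hball : ∀ w τ ρ, 10 * ρ ≤ d → 0 < ρ → ‖w - x‖ ≤ 9 * ρ → t - d ^ 2 ≤ τ → τ ≤ t + d ^ 2 →
      ContinuousAt f (w, τ) ∧ HeatOp f (w, τ) 0 ∧ 0 ≤ f (w, τ) := by
    intro w τ ρ hρ hρ0 hw h1 h2
    have hm : (w, τ) ∈ sBox x0 t0 r := by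
      refine ⟨?_, ?_, ?_⟩
      · have := norm_sub_le_norm_sub_add_norm_sub w x x0
        simp only; linarith
      · simp only; nlinarith
      · simp only; nlinarith
    have hg := hgood _ hm (fun h => hzball w (by linarith) ⟨_, h, rfl⟩)
    exact ⟨hg.1, hg.2, hpos _ hm⟩
  by_cases hb : ∃ b ∈ Prod.snd '' F, t < b ∧ b ≤ t + d ^ 2
  · obtain ⟨b, hbF, hb1, hb2⟩ := hb
    obtain ⟨ρ, hρ⟩ : ∃ ρ, ρ = Real.sqrt (b - t) / 10 := ⟨_, rfl⟩
    have hρ2 : 100 * ρ ^ 2 = b - t := by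
      rw [hρ, div_pow, Real.sq_sqrt (by linarith)]; ring
    have hρ0 : 0 < ρ := by
      rw [hρ]
      exact div_pos (Real.sqrt_pos.2 (by linarith)) (by norm_num)
    have hρd : 10 * ρ ≤ d := by
      refine abs_le_of_sq_le_sq' (by nlinarith) hd0.le |>.2
    have := harnack_chain (u := f) hρ0 100 (x := x) (y := x) (s := t) (by simp; positivity) ?_
    · have e : t + (100 : ℕ) * ρ ^ 2 = b := by push_cast; linarith
      rw [e] at this
      refine this.trans (mul_le_mul_of_nonneg_left (hS (x, b) ⟨hp'.1, ?_, ?_⟩ (Or.inr hbF)) (by positivity))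
      · simp only; nlinarith
      · simp only; nlinarith
    · rintro w τ ⟨θ, hθ, hw⟩ h1 h2
      push_cast at h2
      simp only [sub_self, smul_zero, add_zero] at hw
      exact hball w τ ρ hρd hρ0 hw (by nlinarith) (by nlinarith)
  · push Not at hb
    have k1 := harnack_chain (u := f) (ρ := d / 10) (by positivity) 1 (x := x) (y := x) (s := t)
      (by simp; positivity) (by
        rintro w τ ⟨θ, hθ, hw⟩ h1 h2
        push_cast at h2
        simp only [sub_self, smul_zero, add_zero] at hw
        exact hball w τ (d / 10) (by linarith) (by positivity) hw (by nlinarith) (by nlinarith))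
    have k2 := harnack_chain (u := f) (ρ := d / 10) (by positivity) 10 (x := x) (y := z)
      (s := t + (1 : ℕ) * (d / 10) ^ 2)
      (by rw [norm_sub_rev, ← hd]; push_cast; linarith) ?_
    · have hzS : f (z, t + (1 : ℕ) * (d / 10) ^ 2 + (10 : ℕ) * (d / 10) ^ 2) ≤ S := by
        obtain ⟨q, hq, rfl⟩ := hz
        refine hS _ ⟨(hFr hq).1, ?_, ?_⟩ (Or.inl ⟨q, hq, rfl⟩)
        · push_cast; nlinarith
        · push_cast; nlinarith
      calc f (x, t) ≤ _ := k1
        _ ≤ harnackC m ^ 1 * (harnackC m ^ 10 * S) := by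
          refine mul_le_mul_of_nonneg_left (k2.trans ?_) (by positivity)
          exact mul_le_mul_of_nonneg_left hzS (by positivity)
        _ = harnackC m ^ 11 * S := by ring
        _ ≤ _ := mul_le_mul_of_nonneg_right (pow_le_pow_right₀ hH (by norm_num)) hS0
    · rintro w τ ⟨θ, hθ, hw⟩ h1 h2
      push_cast at h1 h2
      have hm : (w, τ) ∈ sBox x0 t0 r := by
        refine ⟨?_, ?_, ?_⟩
        · have h3 := norm_sub_le_norm_sub_add_norm_sub w (x + θ • (z - x)) x
          have h4 := norm_sub_le_norm_sub_add_norm_sub w x x0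
          have h5 : ‖x + θ • (z - x) - x‖ ≤ d := by
            rw [add_sub_cancel_left, norm_smul, norm_sub_rev, ← hd, Real.norm_eq_abs, abs_of_nonneg hθ.1]
            nlinarith [hθ.2]
          simp only; linarith
        · simp only; nlinarith
        · simp only; nlinarith
      have hg := hgood _ hm (fun h => by
        have h6 : τ ∈ Prod.snd '' F := ⟨_, h, rfl⟩
        by_cases h7 : t < τ
        · have := hb τ h6 h7
          nlinarith
        · have h7 : τ = t := by nlinarith
          exact ht (h7 ▸ h6))
      exact ⟨hg.1, hg.2, hpos _ hm⟩

end growth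

lemma continuousAt_of_cross {m : ℕ} {u : Spc m × ℝ → ℝ} {x0 : Spc m} {t0 r0 N : ℝ} {F : Set (Spc m × ℝ)}
    (hr0 : 0 < r0) (hN : 0 ≤ N) (hF : IsClosed F) (h0 : (x0, t0) ∈ F)
    (hgood : ∀ p ∈ sBox x0 t0 r0, p ∉ F → ContinuousAt u p ∧ HeatOp u p 0)
    (hpos : ∀ p ∈ sBox x0 t0 r0, 0 ≤ u p)
    (hcross : ∀ r, 0 < r → r ≤ r0 → ∀ p ∈ sBox x0 t0 r,
      p.1 ∈ Prod.fst '' (F ∩ sBox x0 t0 r) ∨ p.2 ∈ Prod.snd '' (F ∩ sBox x0 t0 r) →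
      |u p - u (x0, t0)| ≤ N * r) : ContinuousAt u (x0, t0) := by
  obtain ⟨H, hH⟩ : ∃ H, H = harnackC m ^ 100 := ⟨_, rfl⟩
  have hH1 : 1 ≤ H := hH ▸ one_le_pow₀ (one_le_harnackC m)
  obtain ⟨c0, hc0⟩ : ∃ c0, c0 = u (x0, t0) := ⟨_, rfl⟩
  rw [← hc0] at hcross
  have hmem : ∀ r, 0 < r → (x0, t0) ∈ sBox x0 t0 r := fun r hr => mem_of_mem_nhds (sBox_mem_nhds x0 t0 hr)
  have hshift : ∀ r, 0 < r → r ≤ r0 → ∀ k : ℝ, ∀ p ∈ sBox x0 t0 r, p ∉ F ∩ sBox x0 t0 r →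
      ContinuousAt (fun q => u q + k) p ∧ HeatOp (fun q => u q + k) p 0 := by
    intro r hr hr' k p hp hpF
    obtain ⟨h1, h2⟩ := hgood p (sBox_mono x0 t0 hr.le hr' hp) (fun h => hpF ⟨h, hp⟩)
    refine ⟨h1.add continuousAt_const, ?_⟩
    simpa using h2.add (heatOp_const k p)
  have hcpt : ∀ r, IsCompact (F ∩ sBox x0 t0 r) := fun r => (isCompact_sBox x0 t0 r).inter_left hF
  obtain ⟨A, hA⟩ : ∃ A : Set ℝ, A = {a | 0 ≤ a ∧ ∃ r, 0 < r ∧ r ≤ r0 ∧ ∀ p ∈ sBox x0 t0 r, c0 - a ≤ u p} := ⟨_, rfl⟩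
  have hAb : BddBelow A := ⟨0, fun a ha => by rw [hA] at ha; exact ha.1⟩
  have hAne : A.Nonempty := by
    refine ⟨c0, ?_⟩
    rw [hA]
    refine ⟨hc0 ▸ hpos _ (hmem r0 hr0), r0, hr0, le_rfl, fun p hp => ?_⟩
    simpa using hpos p hp
  have hAstep : ∀ a ∈ A, ∀ ε > 0, a - a / (2 * H) + ε ∈ A := by
    intro a ha ε hε
    rw [hA] at ha ⊢
    obtain ⟨ha0, r, hr, hrr, h⟩ := ha
    obtain ⟨r', hr', hr'r, hr'ε⟩ : ∃ r', 0 < r' ∧ r' ≤ r ∧ N * r' ≤ ε := by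
      refine ⟨min r (ε / (N + 1)), by positivity, min_le_left _ _, ?_⟩
      calc N * min r (ε / (N + 1)) ≤ (N + 1) * (ε / (N + 1)) :=
            mul_le_mul (by linarith) (min_le_right _ _) (by positivity) (by positivity)
        _ = ε := by field_simp
    have haH : a / (2 * H) ≤ a := div_le_self ha0 (by linarith)
    refine ⟨by linarith, r' / 8, by positivity, by linarith, fun p hp => ?_⟩
    have hpr : p ∈ sBox x0 t0 r := sBox_mono x0 t0 (by positivity) (by linarith) hp
    have h1 := ge_of_ge_on_cross (f := fun q => u q + (a - c0)) (S := a - N * r') (hcpt r') inter_subset_right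
      ⟨h0, hmem r' hr'⟩ (hshift r' hr' (hr'r.trans hrr) _)
      (fun q hq => by have := h q (sBox_mono x0 t0 hr'.le hr'r hq); linarith)
      (fun q hq hc => by
        have := (abs_le.1 (hcross r' hr' (hr'r.trans hrr) q hq hc)).1
        linarith) p hp
    rw [← hH] at h1
    have h2 : 0 ≤ u p + (a - c0) := by have := h p hpr; linarith
    have h3 : (a - ε) / H ≤ u p + (a - c0) := by
      rw [div_le_iff₀ (by linarith)]
      linarith
    have h4 : ε / H ≤ ε := div_le_self hε.le hH1
    have h5 : a / (2 * H) ≤ a / H := div_le_div_of_nonneg_left ha0 (by linarith) (by linarith)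
    rw [sub_div] at h3
    linarith
  have hA0 : sInf A ≤ 0 := by
    have h1 : ∀ a ∈ A, sInf A ≤ a * (1 - 1 / (2 * H)) := fun a ha =>
      le_of_forall_pos_le_add fun ε hε => by
        have := csInf_le hAb (hAstep a ha ε hε)
        have e : a * (1 - 1 / (2 * H)) = a - a / (2 * H) := by ring
        linarith
    have hk : 0 < 1 - 1 / (2 * H) := by
      rw [sub_pos, div_lt_one (by linarith)]; linarith
    have h2 : sInf A / (1 - 1 / (2 * H)) ≤ sInf A :=
      le_csInf hAne fun a ha => (div_le_iff₀ hk).2 (h1 a ha)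
    rw [div_le_iff₀ hk] at h2
    have h3 : 0 < 1 / (2 * H) := by positivity
    nlinarith
  rw [Metric.continuousAt_iff']
  intro ε hε
  obtain ⟨a, haA, ha⟩ := exists_lt_of_csInf_lt hAne (show sInf A < ε / (4 * H) from
    lt_of_le_of_lt hA0 (by positivity))
  rw [hA] at haA
  obtain ⟨ha0, r, hr, hrr, h⟩ := haA
  obtain ⟨r', hr', hr'r, hr'ε⟩ : ∃ r', 0 < r' ∧ r' ≤ r ∧ N * r' ≤ ε / (4 * H) := by
    refine ⟨min r (ε / (4 * H) / (N + 1)), by positivity, min_le_left _ _, ?_⟩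
    calc N * min r (ε / (4 * H) / (N + 1)) ≤ (N + 1) * (ε / (4 * H) / (N + 1)) :=
          mul_le_mul (by linarith) (min_le_right _ _) (by positivity) (by positivity)
      _ = ε / (4 * H) := by field_simp
  filter_upwards [sBox_mem_nhds x0 t0 (show 0 < r' / 8 by positivity)] with p hp
  have hpr : p ∈ sBox x0 t0 r := sBox_mono x0 t0 (by positivity) (by linarith) hp
  have h1 := le_of_le_on_cross (f := fun q => u q + (a - c0)) (S := a + N * r') (hcpt r') inter_subset_right
    ⟨h0, hmem r' hr'⟩ (hshift r' hr' (hr'r.trans hrr) _)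
    (fun q hq => by have := h q (sBox_mono x0 t0 hr'.le hr'r hq); linarith)
    (fun q hq hc => by
      have := (abs_le.1 (hcross r' hr' (hr'r.trans hrr) q hq hc)).2
      linarith) p hp
  rw [← hH] at h1
  have h2 := h p hpr
  have h3 : H * (a + N * r') < ε := by
    have : a + N * r' < ε / (4 * H) + ε / (4 * H) := by linarith
    calc H * (a + N * r') < H * (ε / (4 * H) + ε / (4 * H)) := mul_lt_mul_of_pos_left this (by linarith)
      _ = ε / 2 := by field_simp; ring
      _ < ε := by linarith
  have h4 : ε / (4 * H) < ε := div_lt_self hε (by linarith)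
  rw [Real.dist_eq, ← hc0, abs_lt]
  constructor <;> linarith

/-- Points around which `u` is Lipschitz in each variable separately, quantitatively. -/
def lipPts {m : ℕ} (u : Spc m × ℝ → ℝ) (Ω : Set (Spc m × ℝ)) (N δ : ℝ) : Set (Spc m × ℝ) :=
  {p | Metric.ball p δ ⊆ Ω ∧
    (∀ y y', dist y p.1 < δ → dist y' p.1 < δ → |u (y, p.2) - u (y', p.2)| ≤ N * dist y y') ∧
    ∀ s, dist s p.2 < δ → |u (p.1, s) - u p| ≤ N * dist s p.2}

lemma isClosed_lipPts {m : ℕ} {u : Spc m × ℝ → ℝ} {Ω : Set (Spc m × ℝ)} {N δ : ℝ} (hδ : 0 < δ)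
    (hx : ∀ p ∈ Ω, ContinuousAt (fun y => u (y, p.2)) p.1)
    (ht : ∀ p ∈ Ω, ContinuousAt (fun s => u (p.1, s)) p.2) : IsClosed (lipPts u Ω N δ) := by
  refine IsSeqClosed.isClosed fun w p hw hlim => ?_
  have h1 : Tendsto (fun k => (w k).1) atTop (𝓝 p.1) := (continuous_fst.tendsto p).comp hlim
  have h2 : Tendsto (fun k => (w k).2) atTop (𝓝 p.2) := (continuous_snd.tendsto p).comp hlim
  have hball : Metric.ball p δ ⊆ Ω := fun q hq => by
    have : ∀ᶠ k in atTop, dist q (w k) < δ :=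
      (tendsto_const_nhds.dist hlim).eventually_lt_const hq
    obtain ⟨k, hk⟩ := this.exists
    exact (hw k).1 hk
  have hfst : ∀ y, dist y p.1 < δ → (y, p.2) ∈ Ω := fun y hy =>
    hball (by rw [Metric.mem_ball, Prod.dist_eq]; exact max_lt hy (by simpa using hδ))
  have hsnd : ∀ s, dist s p.2 < δ → (p.1, s) ∈ Ω := fun y hy =>
    hball (by rw [Metric.mem_ball, Prod.dist_eq]; exact max_lt (by simpa using hδ) hy)
  have hev1 : ∀ y, dist y p.1 < δ → ∀ᶠ k in atTop, dist y (w k).1 < δ := fun y hy =>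
    (tendsto_const_nhds.dist h1).eventually_lt_const hy
  have htt : ∀ y, dist y p.1 < δ → Tendsto (fun k => u (y, (w k).2)) atTop (𝓝 (u (y, p.2))) := fun y hy =>
    (ht _ (hfst y hy)).tendsto.comp h2
  refine ⟨hball, fun y y' hy hy' => ?_, fun s hs => ?_⟩
  · refine le_of_tendsto ((htt y hy).sub (htt y' hy')).abs ?_
    filter_upwards [hev1 y hy, hev1 y' hy'] with k hk hk'
    exact (hw k).2.1 y y' hk hk'
  · have hA : Tendsto (fun k => u (w k)) atTop (𝓝 (u p)) := by
      have hself : dist p.1 p.1 < δ := by simpa using hδ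
      have e : Tendsto (fun k => u (p.1, (w k).2) + (u (w k) - u (p.1, (w k).2))) atTop (𝓝 (u (p.1, p.2) + 0)) := by
        refine (htt p.1 hself).add ?_
        refine squeeze_zero_norm' (a := fun k => N * dist (w k).1 p.1) ?_ ?_
        · filter_upwards [hev1 p.1 hself] with k hk
          exact (hw k).2.1 (w k).1 p.1 (by simpa using hδ) hk
        · simpa using (tendsto_const_nhds (x := N)).mul (h1.dist (tendsto_const_nhds (x := p.1)))
      simpa using e
    have hB : Tendsto (fun k => u ((w k).1, s)) atTop (𝓝 (u (p.1, s))) := (hx _ (hsnd s hs)).tendsto.comp h1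
    refine le_of_tendsto_of_tendsto (hB.sub hA).abs
      ((tendsto_const_nhds (x := N)).mul ((tendsto_const_nhds (x := s)).dist h2)) ?_
    filter_upwards [(tendsto_const_nhds (x := s)).dist h2 |>.eventually_lt_const hs] with k hk
    exact (hw k).2.2 s hk

lemma exists_mem_lipPts {m : ℕ} {u : Spc m × ℝ → ℝ} {Ω : Set (Spc m × ℝ)} {p : Spc m × ℝ} (hΩ : IsOpen Ω) (hp : p ∈ Ω)
    (hx : ContDiffAt ℝ 2 (fun y => u (y, p.2)) p.1) {d : ℝ} (ht : HasDerivAt (fun s => u (p.1, s)) d p.2) :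
    ∃ N : ℕ, p ∈ lipPts u Ω N (1 / ((N : ℝ) + 1)) := by
  obtain ⟨ε1, hε1, h1⟩ := Metric.isOpen_iff.1 hΩ p hp
  obtain ⟨L, V, hV, hL⟩ := (hx.of_le (by norm_num : (1 : WithTop ℕ∞) ≤ 2)).exists_lipschitzOnWith
  obtain ⟨ε2, hε2, h2⟩ := Metric.mem_nhds_iff.1 hV
  obtain ⟨c, hc⟩ := ht.differentiableAt.isBigO_sub.bound
  obtain ⟨ε3, hε3, h3⟩ := Metric.eventually_nhds_iff.1 hc
  obtain ⟨N1, hN1⟩ := exists_nat_gt (max (1 / ε1) (max (1 / ε2) (max (1 / ε3) (max L c))))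
  simp only [max_lt_iff] at hN1
  obtain ⟨ha, hb, hc', hd, he⟩ := hN1
  have key : ∀ ε > 0, 1 / ε < (N1 : ℝ) → 1 / ((N1 : ℝ) + 1) ≤ ε := fun ε hε h => by
    rw [div_lt_iff₀ hε] at h
    rw [div_le_iff₀ (by positivity)]
    nlinarith
  refine ⟨N1, (Metric.ball_subset_ball (key _ hε1 ha)).trans h1, fun y y' hy hy' => ?_, fun s hs => ?_⟩
  · have := hL.dist_le_mul y (h2 (hy.trans_le (key _ hε2 hb))) y' (h2 (hy'.trans_le (key _ hε2 hb)))
    exact this.trans (mul_le_mul_of_nonneg_right hd.le dist_nonneg)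
  · have := h3 (hs.trans_le (key _ hε3 hc'))
    simp only [Real.norm_eq_abs] at this
    exact this.trans (mul_le_mul_of_nonneg_right he.le (abs_nonneg _))

lemma abs_sub_le_of_lipPts {m : ℕ} {u : Spc m × ℝ → ℝ} {Ω F : Set (Spc m × ℝ)} {N δ r : ℝ} {x0 : Spc m} {t0 : ℝ}
    (hr : 0 < r) (hr1 : r ≤ 1) (hrδ : 2 * r < δ) (hN0 : 0 ≤ N) (h0P : (x0, t0) ∈ lipPts u Ω N δ)
    (hF : ∀ q ∈ F ∩ sBox x0 t0 r, q ∈ lipPts u Ω N δ) {p : Spc m × ℝ} (hp : p ∈ sBox x0 t0 r)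
    (hc : p.1 ∈ Prod.fst '' (F ∩ sBox x0 t0 r) ∨ p.2 ∈ Prod.snd '' (F ∩ sBox x0 t0 r)) :
    |u p - u (x0, t0)| ≤ 4 * N * r := by
  obtain ⟨x, t⟩ := p
  have hδ0 : 0 < δ := by linarith
  have hr2 : r ^ 2 ≤ r := by nlinarith
  obtain ⟨hx, ht1, ht2⟩ := hp
  simp only at hx ht1 ht2 hc
  have hdx : ∀ {y : Spc m}, ‖y - x0‖ ≤ r → dist y x0 ≤ r := fun h => by rwa [dist_eq_norm]
  have hdt : ∀ {s : ℝ}, t0 - r ^ 2 ≤ s → s ≤ t0 + r ^ 2 → dist s t0 ≤ r := fun h h' => by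
    rw [Real.dist_eq, abs_le]; constructor <;> linarith
  rcases hc with ⟨⟨x', s⟩, hq, rfl⟩ | ⟨⟨y, s⟩, hq, rfl⟩
  · have hqP := hF _ hq
    obtain ⟨-, -, hs1, hs2⟩ := hq
    simp only at hs1 hs2
    have hts : dist t s ≤ 2 * r := by
      rw [Real.dist_eq, abs_le]; constructor <;> linarith
    have a1 := hqP.2.2 t (lt_of_le_of_lt hts hrδ)
    have a2 := hqP.2.1 x' x0 (by simpa using hδ0)
      (by rw [dist_comm]; exact lt_of_le_of_lt (hdx hx) (by linarith))
    have a3 := h0P.2.2 s (lt_of_le_of_lt (hdt hs1 hs2) (by linarith))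
    have b1 := a1.trans (mul_le_mul_of_nonneg_left hts hN0)
    have b2 := a2.trans (mul_le_mul_of_nonneg_left (hdx hx) hN0)
    have b3 := a3.trans (mul_le_mul_of_nonneg_left (hdt hs1 hs2) hN0)
    simp only at b1 b2 b3 ⊢
    rw [abs_le] at b1 b2 b3 ⊢
    constructor <;> linarith
  · have hqP := hF _ hq
    obtain ⟨-, hy, -⟩ := hq
    simp only at hy
    have a1 := hqP.2.1 x x0
      (by
        have h1 := dist_triangle_right x y x0
        have h2 := hdx hx
        have h3 := hdx hy
        exact lt_of_le_of_lt (by linarith : dist x y ≤ 2 * r) hrδ)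
      (by rw [dist_comm]; exact lt_of_le_of_lt (hdx hy) (by linarith))
    have a3 := h0P.2.2 s (lt_of_le_of_lt (hdt ht1 ht2) (by linarith))
    have b1 := a1.trans (mul_le_mul_of_nonneg_left (hdx hx) hN0)
    have b3 := a3.trans (mul_le_mul_of_nonneg_left (hdt ht1 ht2) hN0)
    have : 0 ≤ N * r := by positivity
    simp only at b1 b3 ⊢
    rw [abs_le] at b1 b3 ⊢
    constructor <;> linarith

lemma exists_open_inter_subset_of_isLocallyClosed {X : Type*} [TopologicalSpace X] [LocallyCompactSpace X] [T2Space X]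
    {S : Set X} (hS : IsLocallyClosed S) (hne : S.Nonempty) {f : ℕ → Set X} (hf : ∀ n, IsClosed (f n))
    (hU : ∀ x ∈ S, ∃ n, x ∈ f n) : ∃ n, ∃ V, IsOpen V ∧ (V ∩ S).Nonempty ∧ V ∩ S ⊆ f n := by
  have := hS.locallyCompactSpace
  have := hne.to_subtype
  obtain ⟨n, e, he⟩ := nonempty_interior_of_iUnion_of_closed (f := fun n => ((↑) : S → X) ⁻¹' f n)
    (fun n => (hf n).preimage continuous_subtype_val)
    (by
      rw [Set.eq_univ_iff_forall]
      intro p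
      rw [Set.mem_iUnion]
      exact hU p p.2)
  obtain ⟨W, hWs, hWo, heW⟩ := mem_interior.1 he
  obtain ⟨V, hVo, rfl⟩ := isOpen_induced_iff.1 hWo
  exact ⟨n, V, hVo, ⟨e, heW, e.2⟩, fun p hp => hWs (show (⟨p, hp.2⟩ : S) ∈ _ from hp.1)⟩

lemma exists_open_subset_lipPts {m : ℕ} {u : Spc m × ℝ → ℝ} {Ω G : Set (Spc m × ℝ)} (hΩ : IsOpen Ω)
    (hs : SolvesHeat u Ω) (hGo : IsOpen G) (hne : (Ω ∩ Gᶜ).Nonempty) :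
    ∃ (N : ℕ) (V : Set (Spc m × ℝ)), IsOpen V ∧ (∃ e ∈ V, e ∈ Ω ∩ Gᶜ) ∧
      ∀ p ∈ V, p ∈ Ω → p ∉ G → p ∈ lipPts u Ω N (1 / ((N : ℝ) + 1)) := by
  obtain ⟨N, V, hV, ⟨e, he⟩, h⟩ := exists_open_inter_subset_of_isLocallyClosed
    (f := fun N : ℕ => lipPts u Ω N (1 / ((N : ℝ) + 1)))
    (⟨Ω, Gᶜ, hΩ, hGo.isClosed_compl, rfl⟩ : IsLocallyClosed (Ω ∩ Gᶜ)) hne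
    (fun N => isClosed_lipPts (by positivity) (fun p hp => (hs p hp).1.continuousAt)
      (fun p hp => (hs p hp).2.continuousAt))
    (fun p hp => exists_mem_lipPts hΩ hp.1 (hs p hp.1).1 (hs p hp.1).2)
  exact ⟨N, V, hV, ⟨e, he.1, he.2⟩, fun p h1 h2 h3 => h ⟨h1, h2, h3⟩⟩

/-- Nonnegative classical solutions are jointly continuous. -/
theorem SolvesHeat.continuousAt {m : ℕ} {u : Spc m × ℝ → ℝ} {Ω : Set (Spc m × ℝ)} (hΩ : IsOpen Ω)
    (hs : SolvesHeat u Ω) (hpos : ∀ p ∈ Ω, 0 ≤ u p) : ∀ p ∈ Ω, ContinuousAt u p := by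
  obtain ⟨G, hG⟩ : ∃ G, G = interior {p | ContinuousAt u p} := ⟨_, rfl⟩
  have hGo : IsOpen G := hG ▸ isOpen_interior
  intro p hp
  by_contra h
  obtain ⟨N, V, hVo, ⟨e, heW, he⟩, hP⟩ := exists_open_subset_lipPts hΩ hs hGo
    ⟨p, hp, fun hpG => h (interior_subset (hG ▸ hpG))⟩
  clear h hp p
  obtain ⟨δ, hδ⟩ : ∃ δ : ℝ, δ = 1 / ((N : ℝ) + 1) := ⟨_, rfl⟩
  have hδ0 : 0 < δ := by rw [hδ]; positivity
  rw [← hδ] at hP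
  suffices hc : ∀ p ∈ V ∩ Ω, ContinuousAt u p by
    refine he.2 ?_
    rw [hG]
    exact mem_interior.2 ⟨V ∩ Ω, hc, hVo.inter hΩ, heW, he.1⟩
  rintro ⟨x0, t0⟩ ⟨hpV, hpΩ⟩
  by_cases hpG : (x0, t0) ∈ G
  · exact interior_subset (hG ▸ hpG)
  obtain ⟨ε, hε, hεV⟩ := Metric.isOpen_iff.1 (hVo.inter hΩ) (x0, t0) ⟨hpV, hpΩ⟩
  obtain ⟨r0, hr0, hr01, hr0δ, hr0ε⟩ : ∃ r0 : ℝ, 0 < r0 ∧ r0 ≤ 1 ∧ 2 * r0 < δ ∧ r0 < ε :=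
    ⟨min 1 (min (δ / 3) (ε / 2)), by positivity, min_le_left _ _, by
      have := (min_le_right 1 (min (δ / 3) (ε / 2))).trans (min_le_left _ _)
      linarith, by
      have := (min_le_right 1 (min (δ / 3) (ε / 2))).trans (min_le_right _ _)
      linarith⟩
  have hsub : sBox x0 t0 r0 ⊆ V ∩ Ω := fun p hp => hεV (by
    rw [Metric.mem_ball, Prod.dist_eq, max_lt_iff, dist_eq_norm, Real.dist_eq]
    refine ⟨lt_of_le_of_lt hp.1 hr0ε, lt_of_le_of_lt (abs_le.2 ?_) hr0ε⟩
    have := hp.2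
    constructor <;> simp only <;> nlinarith)
  have hN0 : (0 : ℝ) ≤ N := Nat.cast_nonneg N
  refine continuousAt_of_cross (F := Gᶜ) (N := 4 * N) hr0 (by positivity) hGo.isClosed_compl hpG ?_ ?_ ?_
  · intro p hp hpF
    rw [Set.notMem_compl_iff] at hpF
    exact ⟨interior_subset (hG ▸ hpF), HeatOp.of_solves (hs p (hsub hp).2).1 (hs p (hsub hp).2).2⟩
  · exact fun p hp => hpos p (hsub hp).2
  · intro r hr hrr p hp hc
    refine abs_sub_le_of_lipPts hr (hrr.trans hr01) (by linarith) hN0 (hP _ hpV hpΩ hpG) (fun q hq => ?_) hp hc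
    have hq' := hsub (sBox_mono x0 t0 hr.le hrr hq.2)
    exact hP _ hq'.1 hq'.2 hq.1

lemma le_pow_mul_of_forall_le_mul {H : ℝ} (hH : 0 ≤ H) {a : ℕ → ℝ} (J : ℕ) (h : ∀ j < J, a j ≤ H * a (j + 1)) :
    a 0 ≤ H ^ J * a J := by
  induction J with
  | zero => simp
  | succ J ih =>
    refine (ih fun j hj => h j (by omega)).trans ?_
    rw [pow_succ, mul_assoc]
    exact mul_le_mul_of_nonneg_left (h J (by omega)) (by positivity)

lemma rpow_small_bounds {α ε : ℝ} (hα : 0 < α) (hα1 : α ≤ 1) (hε : 0 < ε) (hε1 : ε ≤ 1) :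
    0 < ε ^ (α / 2) ∧ ε ^ (α / 2) ≤ 1 ∧ ε ≤ ε ^ (α / 2) ∧ (2 * ε) ^ α ≤ 2 * ε ^ (α / 2) ∧
      (2 * ε) ^ (1 / 2 : ℝ) ≤ 2 * ε ^ (α / 2) ∧ ε ^ (α / 2) ≤ (ε ^ (α / 2)) ^ α := by
  have h0 : 0 < ε ^ (α / 2) := Real.rpow_pos_of_pos hε _
  have h1 : ε ^ (α / 2) ≤ 1 := Real.rpow_le_one hε.le hε1 (by positivity)
  have hexp : ∀ a, α / 2 ≤ a → a ≤ 1 → (2 * ε) ^ a ≤ 2 * ε ^ (α / 2) := fun a ha ha1 => by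
    rw [Real.mul_rpow (by norm_num) hε.le]
    refine mul_le_mul ?_ (Real.rpow_le_rpow_of_exponent_ge hε hε1 ha) (Real.rpow_nonneg hε.le _) (by norm_num)
    exact (Real.rpow_le_rpow_of_exponent_le (by norm_num) ha1).trans (Real.rpow_one 2).le
  refine ⟨h0, h1, ?_, hexp _ (by linarith) hα1, hexp _ (by linarith) (by norm_num), ?_⟩
  · simpa using Real.rpow_le_rpow_of_exponent_ge hε hε1 (show α / 2 ≤ 1 by linarith)
  · simpa using Real.rpow_le_rpow_of_exponent_ge h0 h1 hα1

section chain

variable {m : ℕ} {K α : ℝ} {g : Spc' m → ℝ → ℝ}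

/-- The point at depth `(1-θ) d0 + θ d1` above `(1-θ) x0 + θ x1`. -/
def pathPt (g : Spc' m → ℝ → ℝ) (x0 x1 : Spc' m) (d0 d1 t0 t1 θ : ℝ) : Spc m :=
  mkPt (x0 + θ • (x1 - x0)) (g (x0 + θ • (x1 - x0)) (t0 + θ * (t1 - t0)) + (d0 + θ * (d1 - d0)))

lemma norm_pathPt_sub_le (hK : 0 ≤ K) (hα : 0 < α) (hα1 : α ≤ 1) (hg : HolderSemi α (1 / 2) K g) {x0 x1 : Spc' m}
    {d0 d1 t0 t1 θ ε : ℝ} (hx : ‖x1 - x0‖ ≤ 2) (hd : |d1 - d0| ≤ 1) (ht : t0 ≤ t1) (ht' : t1 - t0 ≤ 2)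
    (hε : 0 < ε) (hε1 : ε ≤ 1) :
    ‖pathPt g x0 x1 d0 d1 t0 t1 (θ + ε) - pathPt g x0 x1 d0 d1 t0 t1 θ‖ ≤ (3 + 4 * K) * ε ^ (α / 2) := by
  obtain ⟨h0, h1, h2, h3, h4, h5⟩ := rpow_small_bounds hα hα1 hε hε1
  have hxd : ‖x0 + (θ + ε) • (x1 - x0) - (x0 + θ • (x1 - x0))‖ ≤ 2 * ε := by
    have : x0 + (θ + ε) • (x1 - x0) - (x0 + θ • (x1 - x0)) = ε • (x1 - x0) := by module
    rw [this, norm_smul, Real.norm_eq_abs, abs_of_pos hε]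
    nlinarith
  have htd : |t0 + (θ + ε) * (t1 - t0) - (t0 + θ * (t1 - t0))| ≤ 2 * ε := by
    have : t0 + (θ + ε) * (t1 - t0) - (t0 + θ * (t1 - t0)) = ε * (t1 - t0) := by ring
    rw [this, abs_of_nonneg (mul_nonneg hε.le (by linarith))]
    nlinarith
  have hgd := hg (x0 + (θ + ε) • (x1 - x0)) (x0 + θ • (x1 - x0)) (t0 + (θ + ε) * (t1 - t0)) (t0 + θ * (t1 - t0))
  have e1 := (Real.rpow_le_rpow (norm_nonneg _) hxd hα.le).trans h3
  have e2 := (Real.rpow_le_rpow (abs_nonneg _) htd (by norm_num : (0 : ℝ) ≤ 1 / 2)).trans h4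
  have e3 := hgd.trans (mul_le_mul_of_nonneg_left (add_le_add e1 e2) hK)
  refine (norm_le_xprime_xlast _).trans ?_
  rw [xprime_sub, xlast_sub]
  simp only [pathPt, xprime_mkPt, xlast_mkPt]
  have e4 : ∀ a b : ℝ, a + (d0 + (θ + ε) * (d1 - d0)) - (b + (d0 + θ * (d1 - d0))) = (a - b) + ε * (d1 - d0) :=
    fun a b => by ring
  rw [e4]
  have e5 : |ε * (d1 - d0)| ≤ ε := by
    rw [abs_mul, abs_of_pos hε]; nlinarith
  have e6 := abs_add_le (g (x0 + (θ + ε) • (x1 - x0)) (t0 + (θ + ε) * (t1 - t0)) -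
    g (x0 + θ • (x1 - x0)) (t0 + θ * (t1 - t0))) (ε * (d1 - d0))
  nlinarith

lemma chain_region (hK : 0 ≤ K) (hα : 0 < α) (hα1 : α ≤ 1) (hg : HolderSemi α (1 / 2) K g) {A B ε h : ℝ}
    (hA : A = 21 + 4 * K) (hB : B = A + K * (A + 2)) (hε : 0 < ε) (hε1 : ε ≤ 1)
    (hμ : B * (ε ^ (α / 2)) ^ α ≤ h / 2) {x w : Spc m} {s t : ℝ} (hw : ‖w - x‖ ≤ A * ε ^ (α / 2))
    (hs : |s - t| ≤ 2 * ε) : ‖w - x‖ ≤ h ∧ |hGamma g (w, s) - hGamma g (x, t)| ≤ h / 2 := by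
  obtain ⟨h0, h1, h2, h3, h4, h5⟩ := rpow_small_bounds hα hα1 hε hε1
  have hA1 : 1 ≤ A := by linarith
  have e1 : ‖w - x‖ ^ α ≤ A * (ε ^ (α / 2)) ^ α := by
    refine (Real.rpow_le_rpow (norm_nonneg _) hw hα.le).trans ?_
    rw [Real.mul_rpow (by linarith) h0.le]
    refine mul_le_mul_of_nonneg_right ?_ (Real.rpow_nonneg h0.le _)
    simpa using Real.rpow_le_rpow_of_exponent_le hA1 hα1
  have e2 := (Real.rpow_le_rpow (abs_nonneg _) hs (by norm_num : (0 : ℝ) ≤ 1 / 2)).trans h4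
  have e3 := abs_hGamma_sub_le hK hα.le hg w x s t
  have e4 : K * (‖w - x‖ ^ α + |s - t| ^ (1 / 2 : ℝ)) ≤ K * ((A + 2) * (ε ^ (α / 2)) ^ α) :=
    mul_le_mul_of_nonneg_left (by nlinarith) hK
  have e5 : A * ε ^ (α / 2) ≤ A * (ε ^ (α / 2)) ^ α := by gcongr
  have e6 : 0 ≤ K * (A + 2) * (ε ^ (α / 2)) ^ α := by positivity
  rw [hB, add_mul] at hμ
  have e7 : 0 ≤ A * (ε ^ (α / 2)) ^ α := by positivity
  constructor <;> nlinarith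

lemma exists_chain_length {B h β : ℝ} {P : ℕ} (hB : 1 ≤ B) (hh : 0 < h) (hh1 : h ≤ 1) (hβ : 1 ≤ P * β) :
    ∃ J : ℕ, 1 ≤ J ∧ B * (1 / (J : ℝ)) ^ β ≤ h / 2 ∧ (J : ℝ) ≤ (4 * B / h) ^ P := by
  have h1 : 1 ≤ 2 * B / h := by rw [le_div_iff₀ hh]; linarith
  obtain ⟨M, hM⟩ : ∃ M, M = ⌈2 * B / h⌉₊ := ⟨_, rfl⟩
  have hM1 : 2 * B / h ≤ M := hM ▸ Nat.le_ceil _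
  have hM2 : (M : ℝ) ≤ 4 * B / h := by
    have := (Nat.ceil_lt_add_one (by positivity : (0 : ℝ) ≤ 2 * B / h)).le
    rw [← hM] at this
    have e : 4 * B / h = 2 * B / h + 2 * B / h := by ring
    linarith
  have hM0 : (1 : ℝ) ≤ M := h1.trans hM1
  have hMn : 1 ≤ M := by exact_mod_cast hM0
  refine ⟨M ^ P, Nat.one_le_pow _ _ hMn, ?_, ?_⟩
  · have e : (1 / ((M ^ P : ℕ) : ℝ)) ^ β = (1 / (M : ℝ)) ^ (P * β) := by
      rw [Real.rpow_mul (by positivity), Real.rpow_natCast]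
      push_cast
      rw [one_div_pow]
    have e2 : (1 / (M : ℝ)) ^ (P * β) ≤ 1 / M := by
      have := Real.rpow_le_rpow_of_exponent_ge (by positivity : 0 < 1 / (M : ℝ))
        (by rw [div_le_one (by linarith)]; exact hM0) hβ
      simpa using this
    rw [e]
    calc B * (1 / (M : ℝ)) ^ (P * β) ≤ B * (1 / M) := by gcongr
      _ ≤ h / 2 := by
        rw [mul_one_div, div_le_iff₀ (by linarith)]
        rw [div_le_iff₀ hh] at hM1
        linarith
  · push_cast
    exact pow_le_pow_left₀ (by positivity) hM2 P

lemma exists_chain_const (m : ℕ) {K α : ℝ} (hK : 0 < K) (hα : 0 < α) : ∃ (C : ℝ) (κ : ℕ), 1 ≤ C ∧ 1 ≤ κ ∧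
    ∀ h : ℝ, 0 < h → h ≤ 1 → ∃ J k : ℕ, 1 ≤ J ∧ 1 ≤ k ∧
      (21 + 4 * K + K * (21 + 4 * K + 2)) * ((1 / (J : ℝ)) ^ (α / 2)) ^ α ≤ h / 2 ∧
      (21 + 4 * K) ^ 2 ≤ k * (h ^ 2 / J) ∧ (harnackC m ^ k) ^ J ≤ Real.exp (C / h ^ κ) := by
  obtain ⟨P, hP⟩ := exists_nat_ge (2 / α ^ 2)
  obtain ⟨A, hA⟩ : ∃ A, A = 21 + 4 * K := ⟨_, rfl⟩
  obtain ⟨B, hB⟩ : ∃ B, B = 21 + 4 * K + K * (21 + 4 * K + 2) := ⟨_, rfl⟩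
  have hA1 : 1 ≤ A := by linarith
  have hB1 : 1 ≤ B := by nlinarith
  have hH := one_le_harnackC m
  have hlog := Real.log_nonneg hH
  refine ⟨2 * A ^ 2 * (4 * B) ^ (2 * P) * (Real.log (harnackC m) + 1), 2 * P + 2, ?_, by omega, fun h hh hh1 => ?_⟩
  · have := one_le_pow₀ hA1 (n := 2)
    have := one_le_pow₀ (by linarith : 1 ≤ 4 * B) (n := 2 * P)
    have h1 : 1 ≤ 2 * A ^ 2 := by linarith
    exact one_le_mul_of_one_le_of_one_le (one_le_mul_of_one_le_of_one_le h1 this) (by linarith)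
  obtain ⟨J, hJ1, hJ2, hJ3⟩ := exists_chain_length (β := α / 2 * α) (P := P) hB1 hh hh1 (by
    rw [div_le_iff₀ (by positivity)] at hP
    nlinarith)
  rw [Real.rpow_mul (by positivity)] at hJ2
  have hJ1' : (1 : ℝ) ≤ J := by exact_mod_cast hJ1
  have hk0 : 1 ≤ A ^ 2 * J / h ^ 2 := by
    rw [le_div_iff₀ (by positivity)]
    have := one_le_pow₀ hA1 (n := 2)
    nlinarith
  obtain ⟨k, hk⟩ : ∃ k, k = ⌈A ^ 2 * J / h ^ 2⌉₊ := ⟨_, rfl⟩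
  have hk1 : A ^ 2 * J / h ^ 2 ≤ k := hk ▸ Nat.le_ceil _
  have hk2 : (k : ℝ) ≤ 2 * A ^ 2 * J / h ^ 2 := by
    have := (Nat.ceil_lt_add_one (by positivity : (0 : ℝ) ≤ A ^ 2 * J / h ^ 2)).le
    rw [← hk] at this
    have e : 2 * A ^ 2 * J / h ^ 2 = A ^ 2 * J / h ^ 2 + A ^ 2 * J / h ^ 2 := by ring
    linarith
  refine ⟨J, k, hJ1, by exact_mod_cast hk0.trans hk1, hB ▸ hJ2, ?_, ?_⟩
  · rw [← hA, mul_div_assoc', le_div_iff₀ (by positivity)]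
    rwa [div_le_iff₀ (by positivity)] at hk1
  · rw [← pow_mul, ← Real.exp_log (by linarith : 0 < harnackC m), ← Real.exp_nat_mul]
    rw [Real.exp_le_exp, Real.log_exp, le_div_iff₀ (by positivity)]
    push_cast
    have e1 : (k : ℝ) * J * h ^ (2 * P + 2) ≤ 2 * A ^ 2 * (4 * B) ^ (2 * P) := by
      calc (k : ℝ) * J * h ^ (2 * P + 2) ≤ (2 * A ^ 2 * J / h ^ 2) * J * h ^ (2 * P + 2) := by gcongr
        _ = 2 * A ^ 2 * (J ^ 2 * h ^ (2 * P)) := by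
          rw [pow_add]; field_simp
        _ ≤ 2 * A ^ 2 * (((4 * B / h) ^ P) ^ 2 * h ^ (2 * P)) := by gcongr
        _ = 2 * A ^ 2 * (4 * B) ^ (2 * P) := by
          rw [div_pow, div_pow, ← pow_mul, ← pow_mul, mul_comm P 2]; field_simp
    have e0 : 0 ≤ 2 * A ^ 2 * (4 * B) ^ (2 * P) := by positivity
    nlinarith [mul_le_mul_of_nonneg_right e1 hlog]

lemma chain_step (hK : 0 ≤ K) (hα : 0 < α) (hα1 : α ≤ 1) (hg : HolderSemi α (1 / 2) K g) {f : Spc m × ℝ → ℝ}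
    {x0 x1 : Spc' m} {d0 d1 t0 t1 h θ ε ρ τ : ℝ} {k : ℕ} (hx : ‖x1 - x0‖ ≤ 2) (hd : |d1 - d0| ≤ 1)
    (ht : t0 ≤ t1) (ht' : t1 - t0 ≤ 2) (hε : 0 < ε) (hε1 : ε ≤ 1) (hρ : 0 < ρ) (hρh : ρ ≤ h) (hτ : τ = ε * (t1 - t0))
    (hρ2 : k * ρ ^ 2 = τ) (hρτ : ρ ^ 2 ≤ τ) (hρl : ρ ≤ 2 * ε ^ (α / 2)) (hkρ : (3 + 4 * K) * ε ^ (α / 2) ≤ k * ρ)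
    (hμ : (21 + 4 * K + K * (21 + 4 * K + 2)) * (ε ^ (α / 2)) ^ α ≤ h / 2)
    (hgood : ∀ y s, (∃ θ ∈ Icc (0 : ℝ) 1, ‖xprime y - (x0 + θ • (x1 - x0))‖ ≤ h) → t0 - h ^ 2 ≤ s → s ≤ t1 →
        min d0 d1 - h / 2 ≤ hGamma g (y, s) → hGamma g (y, s) ≤ max d0 d1 + h / 2 →
        ContinuousAt f (y, s) ∧ HeatOp f (y, s) 0 ∧ 0 ≤ f (y, s))
    (hθ : 0 ≤ θ) (hθ1 : θ + ε ≤ 1) :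
    f (pathPt g x0 x1 d0 d1 t0 t1 θ, t0 + θ * (t1 - t0)) ≤
      harnackC m ^ k * f (pathPt g x0 x1 d0 d1 t0 t1 (θ + ε), t0 + (θ + ε) * (t1 - t0)) := by
  have hmove := norm_pathPt_sub_le hK hα hα1 hg hx hd (θ := θ) ht ht' hε hε1
  have et : t0 + (θ + ε) * (t1 - t0) = t0 + θ * (t1 - t0) + k * ρ ^ 2 := by rw [hρ2, hτ]; ring
  rw [et]
  have b0 := (rpow_small_bounds hα hα1 hε hε1).1
  have hτ0 : 0 ≤ τ := by rw [hτ]; exact mul_nonneg hε.le (by linarith)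
  have hτ2 : τ ≤ 2 * ε := by rw [hτ]; nlinarith
  have hθt : 0 ≤ θ * (t1 - t0) := mul_nonneg hθ (by linarith)
  refine harnack_chain hρ k (hmove.trans hkρ) ?_
  rintro w s ⟨ϑ, hϑ, hw⟩ hs1 hs2
  rw [hρ2] at hs2
  have hwx : ‖w - pathPt g x0 x1 d0 d1 t0 t1 θ‖ ≤ (21 + 4 * K) * ε ^ (α / 2) := by
    obtain ⟨a, ha⟩ : ∃ a, a = pathPt g x0 x1 d0 d1 t0 t1 θ := ⟨_, rfl⟩
    obtain ⟨b, hb⟩ : ∃ b, b = pathPt g x0 x1 d0 d1 t0 t1 (θ + ε) := ⟨_, rfl⟩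
    rw [← ha, ← hb] at hw hmove
    rw [← ha]
    have h1 := norm_sub_le_norm_sub_add_norm_sub w (a + ϑ • (b - a)) a
    have h2 : ‖a + ϑ • (b - a) - a‖ ≤ ‖b - a‖ := by
      rw [add_sub_cancel_left, norm_smul, Real.norm_eq_abs, abs_of_nonneg hϑ.1]
      exact mul_le_of_le_one_left (norm_nonneg _) hϑ.2
    linarith
  have hst : |s - (t0 + θ * (t1 - t0))| ≤ 2 * ε := by
    rw [abs_le]; constructor <;> linarith
  obtain ⟨c1, c2⟩ := chain_region hK hα hα1 hg rfl rfl hε hε1 hμ hwx hst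
  have hdep : hGamma g (pathPt g x0 x1 d0 d1 t0 t1 θ, t0 + θ * (t1 - t0)) = d0 + θ * (d1 - d0) := by
    simp [hGamma, pathPt]
  rw [hdep, abs_le] at c2
  have hdm : min d0 d1 ≤ d0 + θ * (d1 - d0) ∧ d0 + θ * (d1 - d0) ≤ max d0 d1 := by
    have hθ2 : θ ≤ 1 := by linarith
    rcases le_total d0 d1 with h | h
    · rw [min_eq_left h, max_eq_right h]; constructor <;> nlinarith
    · rw [min_eq_right h, max_eq_left h]; constructor <;> nlinarith
  refine hgood w s ⟨θ, ⟨hθ, by linarith⟩, ?_⟩ ?_ ?_ (by linarith [hdm.1]) (by linarith [hdm.2])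
  · refine le_trans (le_trans (le_of_eq ?_) (norm_xprime_le _)) c1
    rw [xprime_sub]
    simp [pathPt]
  · have : ρ ^ 2 ≤ h ^ 2 := pow_le_pow_left₀ hρ.le hρh 2
    linarith
  · have : (θ + ε) * (t1 - t0) ≤ t1 - t0 := mul_le_of_le_one_left (by linarith) hθ1
    rw [hτ] at hs2
    linarith

/-- Harnack chains above the graph. -/
theorem exists_chain (m : ℕ) {K α : ℝ} (hK : 0 < K) (hα : 0 < α) (hα1 : α ≤ 1) : ∃ (C : ℝ) (κ : ℕ), 1 ≤ C ∧ 1 ≤ κ ∧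
    ∀ (g : Spc' m → ℝ → ℝ), HolderSemi α (1 / 2) K g → ∀ (f : Spc m × ℝ → ℝ) (x0 x1 : Spc' m) (d0 d1 t0 t1 h : ℝ),
      0 < h → h ≤ 1 → ‖x1 - x0‖ ≤ 2 → |d1 - d0| ≤ 1 → t0 + h ^ 2 ≤ t1 → t1 - t0 ≤ 2 →
      (∀ y s, (∃ θ ∈ Icc (0 : ℝ) 1, ‖xprime y - (x0 + θ • (x1 - x0))‖ ≤ h) → t0 - h ^ 2 ≤ s → s ≤ t1 →
        min d0 d1 - h / 2 ≤ hGamma g (y, s) → hGamma g (y, s) ≤ max d0 d1 + h / 2 →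
        ContinuousAt f (y, s) ∧ HeatOp f (y, s) 0 ∧ 0 ≤ f (y, s)) →
      f (mkPt x0 (g x0 t0 + d0), t0) ≤ Real.exp (C / h ^ κ) * f (mkPt x1 (g x1 t1 + d1), t1) := by
  obtain ⟨C, κ, hC, hκ, hCκ⟩ := exists_chain_const m hK hα
  refine ⟨C, κ, hC, hκ, fun g hg f x0 x1 d0 d1 t0 t1 h hh hh1 hx hd ht ht' hgood => ?_⟩
  obtain ⟨J, k, hJ, hk, hμ, hkJ, hexp⟩ := hCκ h hh hh1
  have hJ0 : (0 : ℝ) < J := by exact_mod_cast hJ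
  have hk1 : (1 : ℝ) ≤ k := by exact_mod_cast hk
  obtain ⟨ε, hε⟩ : ∃ ε, ε = 1 / (J : ℝ) := ⟨_, rfl⟩
  have hε0 : 0 < ε := by rw [hε]; positivity
  have hε1 : ε ≤ 1 := by rw [hε, div_le_one hJ0]; exact_mod_cast hJ
  have hJε : J * ε = 1 := by rw [hε]; field_simp
  rw [← hε] at hμ
  obtain ⟨b0, b1, b2, b3, b4, b5⟩ := rpow_small_bounds hα hα1 hε0 hε1
  obtain ⟨τ, hτ⟩ : ∃ τ, τ = ε * (t1 - t0) := ⟨_, rfl⟩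
  have hτ2 : τ ≤ 2 * ε := by rw [hτ]; nlinarith
  have hh2 : 0 < h ^ 2 := by positivity
  have hτh : h ^ 2 / J ≤ τ := by
    rw [hτ, div_eq_mul_one_div, ← hε]; nlinarith
  have hτ0 : 0 < τ := lt_of_lt_of_le (by positivity) hτh
  obtain ⟨ρ, hρ⟩ : ∃ ρ, ρ = Real.sqrt (τ / k) := ⟨_, rfl⟩
  have hρ0 : 0 < ρ := hρ ▸ Real.sqrt_pos.2 (by positivity)
  have hρ2 : k * ρ ^ 2 = τ := by
    rw [hρ, Real.sq_sqrt (by positivity)]; field_simp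
  have hρτ : ρ ^ 2 ≤ τ := by nlinarith [sq_nonneg ρ]
  have hρl : ρ ≤ 2 * ε ^ (α / 2) := by
    refine le_trans ?_ b4
    rw [← Real.sqrt_eq_rpow]
    exact Real.le_sqrt_of_sq_le (hρτ.trans hτ2)
  have hkρ : (3 + 4 * K) * ε ^ (α / 2) ≤ k * ρ := by
    refine abs_le_of_sq_le_sq' ?_ (by positivity) |>.2
    calc ((3 + 4 * K) * ε ^ (α / 2)) ^ 2 ≤ ((21 + 4 * K) * 1) ^ 2 := by gcongr; norm_num
      _ = (21 + 4 * K) ^ 2 := by ring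
      _ ≤ k * (h ^ 2 / J) := hkJ
      _ ≤ k * τ := by gcongr
      _ = (k * ρ) ^ 2 := by rw [← hρ2]; ring
  have hρh : ρ ≤ h := by
    have e1 : 2 * ε ^ (α / 2) ≤ (21 + 4 * K + K * (21 + 4 * K + 2)) * (ε ^ (α / 2)) ^ α :=
      mul_le_mul (by nlinarith) b5 b0.le (by positivity)
    linarith
  have hstep : ∀ j < J, f (pathPt g x0 x1 d0 d1 t0 t1 (j * ε), t0 + j * ε * (t1 - t0)) ≤
      harnackC m ^ k * f (pathPt g x0 x1 d0 d1 t0 t1 ((j + 1 : ℕ) * ε), t0 + (j + 1 : ℕ) * ε * (t1 - t0)) := by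
    intro j hj
    have hj1 : (j : ℝ) * ε + ε ≤ 1 := by
      rw [← hJε]
      have : (j : ℝ) + 1 ≤ J := by exact_mod_cast hj
      calc (j : ℝ) * ε + ε = (j + 1) * ε := by ring
        _ ≤ J * ε := by gcongr
    have ee : ((j + 1 : ℕ) : ℝ) * ε = (j : ℝ) * ε + ε := by push_cast; ring
    rw [ee]
    exact chain_step hK.le hα hα1 hg hx hd (by linarith) ht' hε0 hε1 hρ0 hρh hτ hρ2 hρτ hρl hkρ hμ hgood
      (by positivity) hj1
  have h1 := le_pow_mul_of_forall_le_mul (H := harnackC m ^ k) (pow_nonneg (zero_le_one.trans (one_le_harnackC m)) k)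
    (a := fun j => f (pathPt g x0 x1 d0 d1 t0 t1 (j * ε), t0 + j * ε * (t1 - t0))) J hstep
  have e0 : pathPt g x0 x1 d0 d1 t0 t1 ((0 : ℕ) * ε) = mkPt x0 (g x0 t0 + d0) := by simp [pathPt]
  have e1 : pathPt g x0 x1 d0 d1 t0 t1 (J * ε) = mkPt x1 (g x1 t1 + d1) := by
    rw [hJε]; simp [pathPt]
  have e2 : t0 + J * ε * (t1 - t0) = t1 := by rw [hJε]; ring
  simp only [e0, e1, e2] at h1
  simp only [Nat.cast_zero, zero_mul, add_zero] at h1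
  refine h1.trans (mul_le_mul_of_nonneg_right hexp ?_)
  refine (hgood _ _ ⟨1, ⟨zero_le_one, le_rfl⟩, ?_⟩ ?_ le_rfl ?_ ?_).2.2
  · simp [hh.le]
  · linarith
  · simp only [hGamma, xprime_mkPt, xlast_mkPt, add_sub_cancel_left]
    linarith [min_le_right d0 d1]
  · simp only [hGamma, xprime_mkPt, xlast_mkPt, add_sub_cancel_left]
    linarith [le_max_right d0 d1]

end chain

section LocalMin

variable {m : ℕ}

/-- The cube of half-width `ρ` about `x0` for times in `[t0 - T, t0]`. -/
def tBox (x0 : Spc m) (t0 ρ T : ℝ) : Set (Spc m × ℝ) :=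
  {p | (∀ j, |p.1 j - x0 j| ≤ ρ) ∧ t0 - T ≤ p.2 ∧ p.2 ≤ t0}

lemma continuous_coord_fst (j : Fin (m + 1)) : Continuous (fun p : Spc m × ℝ => p.1 j) :=
  (EuclideanSpace.proj (𝕜 := ℝ) j).continuous.comp continuous_fst

lemma norm_sub_le_of_mem_tBox {x0 : Spc m} {t0 ρ T : ℝ} {p : Spc m × ℝ} (hp : p ∈ tBox x0 t0 ρ T) :
    ‖p.1 - x0‖ ≤ (m + 1) * ρ :=
  norm_le_of_coord fun j => by simpa using hp.1 j

lemma isCompact_tBox (x0 : Spc m) (t0 T ρ : ℝ) : IsCompact (tBox x0 t0 ρ T) := by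
  refine ((isCompact_closedBall x0 ((m + 1) * ρ)).prod (isCompact_Icc (a := t0 - T) (b := t0))).of_isClosed_subset ?_ ?_
  · have e : tBox x0 t0 ρ T = (⋂ j, {p : Spc m × ℝ | |p.1 j - x0 j| ≤ ρ}) ∩ ({p | t0 - T ≤ p.2} ∩ {p | p.2 ≤ t0}) := by
      ext p; simp [tBox]
    rw [e]
    refine IsClosed.inter (isClosed_iInter fun j => ?_) (IsClosed.inter ?_ ?_)
    · exact isClosed_le ((continuous_coord_fst j).sub continuous_const).abs continuous_const
    · exact isClosed_le continuous_const continuous_snd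
    · exact isClosed_le continuous_snd continuous_const
  · intro p hp
    exact ⟨by simpa [dist_eq_norm] using norm_sub_le_of_mem_tBox hp, hp.2⟩

/-- A caloric function that is large on the lateral faces of a thin cube and small at its centre. -/
def faceBarrier (x0 : Spc m) (t0 ρ T : ℝ) (q : Spc m × ℝ) : ℝ :=
  ∑ i, 2 * Real.exp (-(ρ / (2 * T) * ρ)) *
    (Real.exp ((ρ / (2 * T)) ^ 2 * (q.2 - (t0 - T))) * Real.cosh (ρ / (2 * T) * (q.1 i - x0 i)))

lemma continuous_faceBarrier (x0 : Spc m) (t0 ρ T : ℝ) : Continuous (faceBarrier x0 t0 ρ T) := by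
  unfold faceBarrier
  refine continuous_finsetSum _ fun i _ => continuous_const.mul (Continuous.mul (by fun_prop) ?_)
  exact Real.continuous_cosh.comp (continuous_const.mul ((continuous_coord_fst i).sub continuous_const))

lemma heatOp_faceBarrier (x0 : Spc m) (t0 ρ T : ℝ) (p : Spc m × ℝ) : HeatOp (faceBarrier x0 t0 ρ T) p 0 := by
  have := HeatOp.sum Finset.univ (p := p) (c := fun _ => 2 * Real.exp (-(ρ / (2 * T) * ρ)) * 0) (fun i _ =>
    (heatOp_cosh (ρ / (2 * T)) (x0 i) (t0 - T) i p).const_mul (2 * Real.exp (-(ρ / (2 * T) * ρ))))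
  simp only [mul_zero, Finset.sum_const_zero] at this
  exact this

lemma faceBarrier_nonneg (x0 : Spc m) (t0 ρ T : ℝ) (p : Spc m × ℝ) : 0 ≤ faceBarrier x0 t0 ρ T p :=
  Finset.sum_nonneg fun i _ => mul_nonneg (by positivity) (mul_nonneg (by positivity) (Real.cosh_pos _).le)

lemma one_le_faceBarrier {x0 : Spc m} {t0 ρ T : ℝ} {p : Spc m × ℝ} (ht : t0 - T ≤ p.2) {i : Fin (m + 1)}
    (hi : |p.1 i - x0 i| = ρ) : 1 ≤ faceBarrier x0 t0 ρ T p := by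
  refine le_trans ?_ (Finset.single_le_sum (f := fun i => 2 * Real.exp (-(ρ / (2 * T) * ρ)) *
    (Real.exp ((ρ / (2 * T)) ^ 2 * (p.2 - (t0 - T))) * Real.cosh (ρ / (2 * T) * (p.1 i - x0 i))))
    (fun j _ => mul_nonneg (by positivity) (mul_nonneg (by positivity) (Real.cosh_pos _).le)) (Finset.mem_univ i))
  have h1 : 1 ≤ Real.exp ((ρ / (2 * T)) ^ 2 * (p.2 - (t0 - T))) :=
    Real.one_le_exp (mul_nonneg (sq_nonneg _) (by linarith))
  have h2 : Real.cosh (ρ / (2 * T) * (p.1 i - x0 i)) = Real.cosh (ρ / (2 * T) * ρ) := by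
    rw [← Real.cosh_abs, abs_mul, hi, ← Real.cosh_abs (ρ / (2 * T) * ρ), abs_mul, abs_of_nonneg (hi ▸ abs_nonneg _ : 0 ≤ ρ)]
  have h3 : Real.exp (ρ / (2 * T) * ρ) ≤ 2 * Real.cosh (ρ / (2 * T) * ρ) := by
    rw [Real.cosh_eq]; linarith [Real.exp_pos (-(ρ / (2 * T) * ρ))]
  have h4 : Real.exp (-(ρ / (2 * T) * ρ)) * Real.exp (ρ / (2 * T) * ρ) = 1 := by rw [← Real.exp_add]; simp
  simp only [h2]
  have h5 := Real.exp_pos (-(ρ / (2 * T) * ρ))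
  have h6 := Real.cosh_pos (ρ / (2 * T) * ρ)
  calc (1 : ℝ) = Real.exp (-(ρ / (2 * T) * ρ)) * Real.exp (ρ / (2 * T) * ρ) := h4.symm
    _ ≤ Real.exp (-(ρ / (2 * T) * ρ)) * (2 * Real.cosh (ρ / (2 * T) * ρ)) := by gcongr
    _ = 2 * Real.exp (-(ρ / (2 * T) * ρ)) * (1 * Real.cosh (ρ / (2 * T) * ρ)) := by ring
    _ ≤ _ := by gcongr

lemma faceBarrier_center (x0 : Spc m) (t0 ρ : ℝ) {T : ℝ} (hT : 0 < T) :
    faceBarrier x0 t0 ρ T (x0, t0) = 2 * (m + 1) * Real.exp (-(ρ ^ 2 / (4 * T))) := by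
  have e : -(ρ ^ 2 / (4 * T)) = -(ρ / (2 * T) * ρ) + (ρ / (2 * T)) ^ 2 * (t0 - (t0 - T)) := by
    field_simp; ring
  rw [e, Real.exp_add]
  simp [faceBarrier]
  ring

/-- Minimum principle in a thin cube, the lateral faces contributing only an exponentially small amount. -/
theorem local_min_principle {F D : Spc m × ℝ → ℝ} (hD : Continuous D) {x0 : Spc m} {t0 ρ T δ M : ℝ} (hρ : 0 < ρ)
    (hT : 0 < T) (hM : 0 ≤ M)
    (h : ∀ p ∈ tBox x0 t0 ρ T, δ ≤ D p → ContinuousAt F p ∧ HeatOp F p 0 ∧ -M ≤ F p)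
    (hbot : ∀ p ∈ tBox x0 t0 ρ T, D p = δ → 0 ≤ F p)
    (hinit : ∀ p ∈ tBox x0 t0 ρ T, p.2 = t0 - T → δ ≤ D p → 0 ≤ F p) (h0 : δ ≤ D (x0, t0)) :
    -(M * (2 * (m + 1) * Real.exp (-(ρ ^ 2 / (4 * T))))) ≤ F (x0, t0) := by
  have key := heat_min_principle (Q := tBox x0 t0 ρ T ∩ {p | δ ≤ D p}) (w := fun p => F p + M * faceBarrier x0 t0 ρ T p)
    ((isCompact_tBox x0 t0 T ρ).inter_right (isClosed_le continuous_const hD))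
    (fun p hp => ((h p hp.1 hp.2).1.add
      (continuous_const.mul (continuous_faceBarrier x0 t0 ρ T)).continuousAt).continuousWithinAt) ?_ (x0, t0) ?_
  · simp only [faceBarrier_center x0 t0 ρ hT] at key
    linarith
  · rintro ⟨x, t⟩ ⟨hp, hpD⟩
    have hb := faceBarrier_nonneg x0 t0 ρ T (x, t)
    by_cases c1 : D (x, t) = δ
    · exact Or.inl (add_nonneg (hbot _ hp c1) (mul_nonneg hM hb))
    by_cases c2 : t = t0 - T
    · exact Or.inl (add_nonneg (hinit _ hp c2 hpD) (mul_nonneg hM hb))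
    by_cases c3 : ∃ i, |x i - x0 i| = ρ
    · obtain ⟨i, hi⟩ := c3
      have h1 := one_le_faceBarrier (p := (x, t)) (T := T) hp.2.1 hi
      have h2 := (h _ hp hpD).2.2
      exact Or.inl (by nlinarith [mul_le_mul_of_nonneg_left h1 hM])
    · push Not at c3
      have hDlt : δ < D (x, t) := lt_of_le_of_ne hpD (Ne.symm c1)
      have hev : ∀ᶠ p in 𝓝 (x, t), δ < D p := hD.continuousAt.eventually (lt_mem_nhds hDlt)
      refine Or.inr ⟨?_, ?_, 0, le_rfl, ?_⟩
      · have e1 : Tendsto (fun y : Spc m => (y, t)) (𝓝 x) (𝓝 (x, t)) := (Continuous.prodMk_left t).continuousAt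
        have e2 : ∀ᶠ y : Spc m in 𝓝 x, ∀ i, |y i - x0 i| < ρ := by
          refine eventually_all.2 fun i => ?_
          have : Continuous (fun y : Spc m => |y i - x0 i|) :=
            ((EuclideanSpace.proj (𝕜 := ℝ) i).continuous.sub continuous_const).abs
          exact this.continuousAt.eventually (gt_mem_nhds (lt_of_le_of_ne (hp.1 i) (c3 i)))
        filter_upwards [e1.eventually hev, e2] with y hy1 hy2
        exact ⟨⟨fun i => (hy2 i).le, hp.2⟩, hy1.le⟩
      · have e1 : Tendsto (fun s : ℝ => (x, s)) (𝓝[<] t) (𝓝 (x, t)) :=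
          ((Continuous.prodMk_right x).continuousAt (x := t)).mono_left nhdsWithin_le_nhds
        have e2 : ∀ᶠ s in 𝓝[<] t, t0 - T < s :=
          nhdsWithin_le_nhds (lt_mem_nhds (lt_of_le_of_ne hp.2.1 (Ne.symm c2)))
        filter_upwards [e1.eventually hev, e2, self_mem_nhdsWithin] with s hs1 hs2 hs3
        exact ⟨⟨hp.1, hs2.le, le_trans (le_of_lt hs3) hp.2.2⟩, hs1.le⟩
      · have := (h _ hp hpD).2.1.add ((heatOp_faceBarrier x0 t0 ρ T (x, t)).const_mul M)
        simpa using this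
  · exact ⟨⟨fun j => by simp [hρ.le], by linarith, le_rfl⟩, h0⟩

end LocalMin

section Steps

variable {m : ℕ}

/-- The Galilean boost of `w` in the vertical direction, with speed `-2 * c`, normalised at `(x0, t0)`. -/
def vBoost (w : Spc m × ℝ → ℝ) (x0 : Spc m) (t0 c ξ0 : ℝ) (q : Spc m × ℝ) : ℝ :=
  Real.exp (c * (q.1 (Fin.last m) - x0 (Fin.last m)) + c ^ 2 * (q.2 - t0)) *
    w (q.1 + (ξ0 + 2 * c * (q.2 - t0)) • eVec m (Fin.last m), q.2)

lemma vBoost_center (w : Spc m × ℝ → ℝ) (x0 : Spc m) (t0 c ξ0 : ℝ) :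
    vBoost w x0 t0 c ξ0 (x0, t0) = w (x0 + ξ0 • eVec m (Fin.last m), t0) := by
  simp [vBoost]

lemma heatOp_vBoost {w : Spc m × ℝ → ℝ} {Ω : Set (Spc m × ℝ)} (hΩ : IsOpen Ω)
    (hw : ∀ p ∈ Ω, ContinuousAt w p) (hs : ∀ p ∈ Ω, HeatOp w p 0) {x0 : Spc m} {t0 c ξ0 : ℝ} {p : Spc m × ℝ}
    (hp : (p.1 + (ξ0 + 2 * c * (p.2 - t0)) • eVec m (Fin.last m), p.2) ∈ Ω) :
    HeatOp (vBoost w x0 t0 c ξ0) p 0 := by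
  refine HeatOp.boost (ξ := fun t => ξ0 + 2 * c * (t - t0)) hΩ (fun p hp => (hw p hp).continuousWithinAt) hs
    (Fin.last m) ?_ hp
  simpa using (((hasDerivAt_id p.2).sub_const t0).const_mul (2 * c)).const_add ξ0

lemma continuousAt_vBoost {w : Spc m × ℝ → ℝ} {x0 : Spc m} {t0 c ξ0 : ℝ} {p : Spc m × ℝ}
    (hp : ContinuousAt w (p.1 + (ξ0 + 2 * c * (p.2 - t0)) • eVec m (Fin.last m), p.2)) :
    ContinuousAt (vBoost w x0 t0 c ξ0) p := by
  unfold vBoost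
  refine ContinuousAt.mul ?_ ?_
  · have := continuous_coord_fst (m := m) (Fin.last m)
    exact Continuous.continuousAt (by fun_prop)
  · have hc : Continuous (fun q : Spc m × ℝ => (q.1 + (ξ0 + 2 * c * (q.2 - t0)) • eVec m (Fin.last m), q.2)) := by
      fun_prop
    exact ContinuousAt.comp (f := fun q : Spc m × ℝ => (q.1 + (ξ0 + 2 * c * (q.2 - t0)) • eVec m (Fin.last m), q.2))
      (x := p) (g := w) hp hc.continuousAt

lemma hGamma_add_smul_eVec (g : Spc' m → ℝ → ℝ) (x : Spc m) (t c : ℝ) :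
    hGamma g (x + c • eVec m (Fin.last m), t) = hGamma g (x, t) + c := by
  simp only [hGamma, xprime_add_smul_eVec, xlast_add_smul_eVec]; ring

lemma abs_vBoost_exponent_le {x0 : Spc m} {t0 h L c : ℝ} (hh : 0 < h) (hL : 0 < L)
    (hc : |c| = L / (512 * h)) {p : Spc m × ℝ} (hp : p ∈ tBox x0 t0 (64 * h) (256 * h ^ 2 / L)) :
    |c * (p.1 (Fin.last m) - x0 (Fin.last m)) + c ^ 2 * (p.2 - t0)| ≤ L / 7 := by
  have h1 : |c * (p.1 (Fin.last m) - x0 (Fin.last m))| ≤ L / 8 := by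
    rw [abs_mul, hc]
    calc L / (512 * h) * |p.1 (Fin.last m) - x0 (Fin.last m)| ≤ L / (512 * h) * (64 * h) := by
          gcongr; exact hp.1 _
      _ = L / 8 := by field_simp; norm_num
  have h2 : |c ^ 2 * (p.2 - t0)| ≤ L / 1024 := by
    rw [abs_mul, abs_of_nonneg (sq_nonneg c), ← sq_abs, hc]
    have : |p.2 - t0| ≤ 256 * h ^ 2 / L := by
      rw [abs_le]; constructor <;> linarith [hp.2.1, hp.2.2, show 0 < 256 * h ^ 2 / L by positivity]
    calc (L / (512 * h)) ^ 2 * |p.2 - t0| ≤ (L / (512 * h)) ^ 2 * (256 * h ^ 2 / L) := by gcongr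
      _ = L / 1024 := by field_simp; norm_num
  linarith [abs_add_le (c * (p.1 (Fin.last m) - x0 (Fin.last m))) (c ^ 2 * (p.2 - t0))]

lemma two_mul_exp_neg_le {L : ℝ} (hL : 4 * m + 12 ≤ L) : 2 * ((m : ℝ) + 1) * Real.exp (-L) ≤ 1 := by
  rw [Real.exp_neg, ← div_eq_mul_inv, div_le_one (Real.exp_pos _)]
  have h0 : (0 : ℝ) ≤ m := Nat.cast_nonneg m
  linarith [Real.add_one_le_exp L]

/-- Hypotheses on a small cube used in both iterations. -/
structure GoodCube (g : Spc' m → ℝ → ℝ) (x0 : Spc m) (t0 h L : ℝ) : Prop where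
  h_pos : 0 < h
  h_le : h ≤ 1 / 16
  L_ge : 256 ≤ L
  L_dim : 4 * m + 12 ≤ L
  depth_pos : 0 < hGamma g (x0, t0)
  subset : ∀ p ∈ tBox x0 t0 (64 * h) (256 * h ^ 2 / L),
    ‖xprime p.1‖ < 1 ∧ -1 < p.2 ∧ p.2 < 1 ∧ hGamma g p ≤ 1 / 2

variable {g : Spc' m → ℝ → ℝ} {x0 : Spc m} {t0 h L : ℝ}

lemma GoodCube.mem_Cyl (hc : GoodCube g x0 t0 h L) {p : Spc m × ℝ} (hp : p ∈ tBox x0 t0 (64 * h) (256 * h ^ 2 / L))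
    (hd : 0 < hGamma g p) {ξ : ℝ} (hξ : 0 ≤ ξ) (hξ1 : ξ ≤ h) : (p.1 + ξ • eVec m (Fin.last m), p.2) ∈ Cyl g 1 := by
  obtain ⟨h1, h2, h3, h4⟩ := hc.subset p hp
  rw [mem_Cyl_iff]
  have := hc.h_le
  have e : hGamma g (p.1 + ξ • eVec m (Fin.last m), p.2) = hGamma g p + ξ := hGamma_add_smul_eVec g p.1 p.2 ξ
  simp only [xprime_add_smul_eVec, e]
  exact ⟨h1, by linarith, by linarith, by linarith, by linarith⟩

/-- One step of the Carleson iteration. -/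
theorem carleson_step (hg : Continuous (fun q : Spc' m × ℝ => g q.1 q.2)) {u : Spc m × ℝ → ℝ}
    (hc : GoodCube g x0 t0 h L) (hcont : ∀ p ∈ Cyl g 1, ContinuousAt u p) (hheat : ∀ p ∈ Cyl g 1, HeatOp u p 0)
    (hpos : ∀ p ∈ Cyl g 1, 0 ≤ u p)
    (hvan : ∀ ε > 0, ∃ δ > 0, ∀ p ∈ tBox x0 t0 (64 * h) (256 * h ^ 2 / L), 0 < hGamma g p → hGamma g p ≤ δ → u p ≤ ε)
    (hM : ∀ p ∈ tBox x0 t0 (64 * h) (256 * h ^ 2 / L), 0 < hGamma g p → u p ≤ Real.exp (2 * L))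
    (hup : u (x0 + h • eVec m (Fin.last m), t0) ≤ Real.exp (L / 4)) : u (x0, t0) < Real.exp L := by
  have hh := hc.h_pos
  have hL0 : 0 < L := by linarith [hc.L_ge]
  obtain ⟨T, hT⟩ : ∃ T, T = 256 * h ^ 2 / L := ⟨_, rfl⟩
  have hT0 : 0 < T := by rw [hT]; positivity
  obtain ⟨c, hcd⟩ : ∃ c, c = L / (512 * h) := ⟨_, rfl⟩
  have hc0 : 0 < c := by rw [hcd]; positivity
  have hcT : 2 * c * T = h := by rw [hcd, hT]; field_simp; norm_num
  have habs : |c| = L / (512 * h) := by rw [abs_of_pos hc0, hcd]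
  have hcube := @GoodCube.mem_Cyl m g x0 t0 h L hc
  have hexp := fun p hp => abs_vBoost_exponent_le (x0 := x0) (t0 := t0) (p := p) hh hL0 habs hp
  rw [← hT] at hvan hM hcube hexp
  have hρ : -((64 * h) ^ 2 / (4 * T)) = -(4 * L) := by rw [hT]; field_simp; norm_num
  have main : ∀ ε > 0, u (x0, t0) ≤ Real.exp (L / 7) * Real.exp (L / 4) +
      Real.exp (2 * L) * (2 * (m + 1) * Real.exp (-(4 * L))) + ε := by
    intro ε hε
    obtain ⟨δ, hδ, hδu⟩ := hvan ε hε
    have hdp := hc.depth_pos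
    have hδ' : 0 < min δ (hGamma g (x0, t0)) := lt_min hδ hdp
    have hξ : ∀ p ∈ tBox x0 t0 (64 * h) T, 0 ≤ h + 2 * c * (p.2 - t0) ∧ h + 2 * c * (p.2 - t0) ≤ h := by
      intro p hp
      have h1 := hp.2.1
      have h2 := hp.2.2
      constructor <;> nlinarith
    have hcyl : ∀ p ∈ tBox x0 t0 (64 * h) T, min δ (hGamma g (x0, t0)) ≤ hGamma g p →
        p ∈ Cyl g 1 ∧ (p.1 + (h + 2 * c * (p.2 - t0)) • eVec m (Fin.last m), p.2) ∈ Cyl g 1 := by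
      intro p hp hd
      refine ⟨?_, hcube hp (hδ'.trans_le hd) (hξ p hp).1 (hξ p hp).2⟩
      simpa using hcube hp (hδ'.trans_le hd) le_rfl hh.le
    have hnn : ∀ p ∈ tBox x0 t0 (64 * h) T, min δ (hGamma g (x0, t0)) ≤ hGamma g p → 0 ≤ vBoost u x0 t0 c h p :=
      fun p hp hd => mul_nonneg (Real.exp_pos _).le (hpos _ (hcyl p hp hd).2)
    have key := local_min_principle (F := fun p => Real.exp (L / 7) * vBoost u x0 t0 c h p + ε - u p)
      (D := hGamma g) (continuous_hGamma hg) (x0 := x0) (t0 := t0) (ρ := 64 * h) (T := T)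
      (δ := min δ (hGamma g (x0, t0))) (M := Real.exp (2 * L)) (by positivity) hT0 (Real.exp_pos _).le ?_ ?_ ?_
      (min_le_right _ _)
    · simp only [vBoost_center, hρ] at key
      have := mul_le_mul_of_nonneg_left hup (Real.exp_pos (L / 7)).le
      linarith
    · intro p hp hd
      obtain ⟨k1, k2⟩ := hcyl p hp hd
      have k3 := mul_nonneg (Real.exp_pos (L / 7)).le (hnn p hp hd)
      refine ⟨?_, ?_, ?_⟩
      · exact (((continuousAt_vBoost (hcont _ k2)).const_mul _).add continuousAt_const).sub (hcont _ k1)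
      · have := (((heatOp_vBoost (isOpen_Cyl hg 1) hcont hheat (x0 := x0) k2).const_mul (Real.exp (L / 7))).add
          (heatOp_const ε p)).sub (hheat _ k1)
        simpa using this
      · linarith [hM p hp (hδ'.trans_le hd)]
    · intro p hp hd
      have k3 := mul_nonneg (Real.exp_pos (L / 7)).le (hnn p hp hd.ge)
      linarith [hδu p hp (hd ▸ hδ') (hd ▸ min_le_left _ _)]
    · intro p hp ht hd
      have e0 : h + 2 * c * (p.2 - t0) = 0 := by rw [ht]; linarith
      have k4 := (abs_le.1 (hexp p hp)).1
      have k5 := hpos _ (hcyl p hp hd).1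
      have k6 : 1 ≤ Real.exp (L / 7) *
          Real.exp (c * (p.1 (Fin.last m) - x0 (Fin.last m)) + c ^ 2 * (p.2 - t0)) := by
        rw [← Real.exp_add]; exact Real.one_le_exp (by linarith)
      have k7 : vBoost u x0 t0 c h p =
          Real.exp (c * (p.1 (Fin.last m) - x0 (Fin.last m)) + c ^ 2 * (p.2 - t0)) * u p := by
        simp only [vBoost, e0, zero_smul, add_zero]
      simp only [k7, ← mul_assoc]
      linarith [mul_le_mul_of_nonneg_right k6 k5]
  have h1 := le_of_forall_pos_le_add main
  have e1 : Real.exp (2 * L) * (2 * (m + 1) * Real.exp (-(4 * L))) =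
      (2 * (m + 1) * Real.exp (-L)) * Real.exp (-L) := by
    have : Real.exp (2 * L) * Real.exp (-(4 * L)) = Real.exp (-L) * Real.exp (-L) := by
      rw [← Real.exp_add, ← Real.exp_add]; ring_nf
    linear_combination (2 * ((m : ℝ) + 1)) * this
  have e2 : Real.exp (-L) ≤ 1 := Real.exp_le_one_iff.2 (by linarith)
  have e3 : Real.exp (L / 7) * Real.exp (L / 4) ≤ Real.exp (L / 2) := by
    rw [← Real.exp_add, Real.exp_le_exp]; linarith
  have e4 : Real.exp L = Real.exp (L / 2) * Real.exp (L / 2) := by rw [← Real.exp_add]; ring_nf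
  have e5 := Real.add_one_le_exp (L / 2)
  have e6 : (2 * ((m : ℝ) + 1) * Real.exp (-L)) * Real.exp (-L) ≤ 1 :=
    mul_le_one₀ (two_mul_exp_neg_le hc.L_dim) (Real.exp_pos _).le e2
  rw [e4]
  rw [e1] at h1
  have := hc.L_ge
  nlinarith

/-- One step of the iteration showing that an almost positive caloric function is positive. -/
theorem decay_step (hg : Continuous (fun q : Spc' m × ℝ => g q.1 q.2)) {w : Spc m × ℝ → ℝ}
    (hc : GoodCube g x0 t0 h L) (hcont : ∀ p ∈ Cyl g 1, ContinuousAt w p) (hheat : ∀ p ∈ Cyl g 1, HeatOp w p 0)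
    (hvan : ∀ ε > 0, ∃ δ > 0, ∀ p ∈ tBox x0 t0 (64 * h) (256 * h ^ 2 / L), 0 < hGamma g p → hGamma g p ≤ δ → -ε ≤ w p)
    (hM : ∀ p ∈ tBox x0 t0 (64 * h) (256 * h ^ 2 / L), 0 < hGamma g p → ∀ ξ, 0 ≤ ξ → ξ ≤ h →
      -Real.exp (-L) ≤ w (p.1 + ξ • eVec m (Fin.last m), p.2))
    (hup : ∀ p ∈ tBox x0 t0 (64 * h) (256 * h ^ 2 / L), 0 < hGamma g p → p.2 = t0 - 256 * h ^ 2 / L →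
      Real.exp (-(L / 2)) ≤ w (p.1 + h • eVec m (Fin.last m), p.2)) :
    -Real.exp (-(21 / 20 * L)) ≤ w (x0, t0) := by
  have hh := hc.h_pos
  have hL0 : 0 < L := by linarith [hc.L_ge]
  obtain ⟨T, hT⟩ : ∃ T, T = 256 * h ^ 2 / L := ⟨_, rfl⟩
  have hT0 : 0 < T := by rw [hT]; positivity
  obtain ⟨c, hcd⟩ : ∃ c, c = -(L / (512 * h)) := ⟨_, rfl⟩
  have hc0 : c < 0 := by rw [hcd]; exact neg_neg_of_pos (by positivity)
  have hcT : 2 * c * T = -h := by rw [hcd, hT]; field_simp; norm_num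
  have habs : |c| = L / (512 * h) := by rw [abs_of_neg hc0, hcd, neg_neg]
  have hcube := @GoodCube.mem_Cyl m g x0 t0 h L hc
  have hexp := fun p hp => abs_vBoost_exponent_le (x0 := x0) (t0 := t0) (p := p) hh hL0 habs hp
  rw [← hT] at hvan hM hcube hexp hup
  have hρ : -((64 * h) ^ 2 / (4 * T)) = -(4 * L) := by rw [hT]; field_simp; norm_num
  have main : ∀ ε > 0, -(Real.exp (-L) * (2 * (m + 1) * Real.exp (-(4 * L)))) ≤
      (1 + Real.exp (-(L / 4))) * w (x0, t0) + Real.exp (-(31 / 28 * L)) + ε := by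
    intro ε hε
    obtain ⟨δ, hδ, hδu⟩ := hvan ε hε
    have hdp := hc.depth_pos
    have hδ' : 0 < min δ (hGamma g (x0, t0)) := lt_min hδ hdp
    have hξ : ∀ p ∈ tBox x0 t0 (64 * h) T, 0 ≤ 0 + 2 * c * (p.2 - t0) ∧ 0 + 2 * c * (p.2 - t0) ≤ h := by
      intro p hp
      have h1 := hp.2.1
      have h2 := hp.2.2
      constructor <;> nlinarith
    have hcyl : ∀ p ∈ tBox x0 t0 (64 * h) T, min δ (hGamma g (x0, t0)) ≤ hGamma g p →
        p ∈ Cyl g 1 ∧ (p.1 + (0 + 2 * c * (p.2 - t0)) • eVec m (Fin.last m), p.2) ∈ Cyl g 1 := by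
      intro p hp hd
      refine ⟨?_, hcube hp (hδ'.trans_le hd) (hξ p hp).1 (hξ p hp).2⟩
      simpa using hcube hp (hδ'.trans_le hd) le_rfl hh.le
    have hw0 : ∀ p ∈ tBox x0 t0 (64 * h) T, min δ (hGamma g (x0, t0)) ≤ hGamma g p → -Real.exp (-L) ≤ w p := by
      intro p hp hd
      simpa using hM p hp (hδ'.trans_le hd) 0 le_rfl hh.le
    have hbw : ∀ p ∈ tBox x0 t0 (64 * h) T, min δ (hGamma g (x0, t0)) ≤ hGamma g p →
        -Real.exp (-(31 / 28 * L)) ≤ Real.exp (-(L / 4)) * vBoost w x0 t0 c 0 p := by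
      intro p hp hd
      have k1 := hM p hp (hδ'.trans_le hd) _ (hξ p hp).1 (hξ p hp).2
      have k4 := (abs_le.1 (hexp p hp)).2
      have k5 : Real.exp (-(L / 4)) * Real.exp (c * (p.1 (Fin.last m) - x0 (Fin.last m)) + c ^ 2 * (p.2 - t0)) *
          Real.exp (-L) ≤ Real.exp (-(31 / 28 * L)) := by
        rw [← Real.exp_add, ← Real.exp_add, Real.exp_le_exp]; linarith
      have k6 := mul_le_mul_of_nonneg_left k1 (by positivity : 0 ≤ Real.exp (-(L / 4)) *
        Real.exp (c * (p.1 (Fin.last m) - x0 (Fin.last m)) + c ^ 2 * (p.2 - t0)))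
      rw [vBoost, ← mul_assoc]
      linarith
    have key := local_min_principle
      (F := fun p => w p + Real.exp (-(L / 4)) * vBoost w x0 t0 c 0 p + (Real.exp (-(31 / 28 * L)) + ε))
      (D := hGamma g) (continuous_hGamma hg) (x0 := x0) (t0 := t0) (ρ := 64 * h) (T := T)
      (δ := min δ (hGamma g (x0, t0))) (M := Real.exp (-L)) (by positivity) hT0 (Real.exp_pos _).le ?_ ?_ ?_
      (min_le_right _ _)
    · simp only [vBoost_center, hρ, zero_smul, add_zero] at key
      linarith
    · intro p hp hd
      obtain ⟨k1, k2⟩ := hcyl p hp hd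
      refine ⟨?_, ?_, ?_⟩
      · exact ((hcont _ k1).add ((continuousAt_vBoost (hcont _ k2)).const_mul _)).add continuousAt_const
      · have := ((hheat _ k1).add ((heatOp_vBoost (isOpen_Cyl hg 1) hcont hheat (x0 := x0) k2).const_mul
          (Real.exp (-(L / 4))))).add (heatOp_const (Real.exp (-(31 / 28 * L)) + ε) p)
        simpa using this
      · linarith [hw0 p hp hd, hbw p hp hd]
    · intro p hp hd
      linarith [hδu p hp (hd ▸ hδ') (hd ▸ min_le_left _ _), hbw p hp hd.ge]
    · intro p hp ht hd
      have e0 : 0 + 2 * c * (p.2 - t0) = h := by rw [ht]; linarith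
      have k1 := hup p hp (hδ'.trans_le hd) ht
      have k4 := (abs_le.1 (hexp p hp)).1
      have k5 : Real.exp (-L) ≤ Real.exp (-(L / 4)) *
          Real.exp (c * (p.1 (Fin.last m) - x0 (Fin.last m)) + c ^ 2 * (p.2 - t0)) * Real.exp (-(L / 2)) := by
        rw [← Real.exp_add, ← Real.exp_add, Real.exp_le_exp]; linarith
      have k6 := mul_le_mul_of_nonneg_left k1 (by positivity : 0 ≤ Real.exp (-(L / 4)) *
        Real.exp (c * (p.1 (Fin.last m) - x0 (Fin.last m)) + c ^ 2 * (p.2 - t0)))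
      have k7 := hw0 p hp hd
      have k8 := Real.exp_pos (-(31 / 28 * L))
      simp only [vBoost, e0, ← mul_assoc]
      linarith
  have h1 := main _ (Real.exp_pos (-(31 / 28 * L)))
  rcases le_total 0 (w (x0, t0)) with hw | hw
  · linarith [Real.exp_pos (-(21 / 20 * L))]
  have e1 : Real.exp (-L) * (2 * (m + 1) * Real.exp (-(4 * L))) ≤ Real.exp (-(31 / 28 * L)) := by
    have a2 : Real.exp (-(4 * L)) ≤ Real.exp (-(31 / 28 * L)) := by rw [Real.exp_le_exp]; linarith
    calc Real.exp (-L) * (2 * (m + 1) * Real.exp (-(4 * L)))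
        = (2 * (m + 1) * Real.exp (-L)) * Real.exp (-(4 * L)) := by ring
      _ ≤ 1 * Real.exp (-(4 * L)) := by gcongr; exact two_mul_exp_neg_le hc.L_dim
      _ ≤ _ := by rw [one_mul]; exact a2
  have e2 : Real.exp (-(21 / 20 * L)) = Real.exp (-(31 / 28 * L)) * Real.exp (2 / 35 * L) := by
    rw [← Real.exp_add]; ring_nf
  have e3 := Real.add_one_le_exp (2 / 35 * L)
  have e4 := hc.L_ge
  have e5 := Real.exp_pos (-(31 / 28 * L))
  have e6 : Real.exp (-(L / 4)) * w (x0, t0) ≤ 0 := mul_nonpos_of_nonneg_of_nonpos (Real.exp_pos _).le hw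
  rw [e2]
  nlinarith

end Steps

section Compactness

variable {m : ℕ} {g : Spc' m → ℝ → ℝ}

/-- A compact part of the closure of `Cyl g 1`. -/
def coreSet (g : Spc' m → ℝ → ℝ) : Set (Spc m × ℝ) :=
  {p | ‖xprime p.1‖ ≤ 7 / 8 ∧ |p.2| ≤ 7 / 8 ∧ 0 ≤ hGamma g p ∧ hGamma g p ≤ 3 / 4}

lemma isCompact_coreSet (hg : Continuous (fun q : Spc' m × ℝ => g q.1 q.2)) : IsCompact (coreSet g) := by
  have hK := (isCompact_closedBall (0 : Spc' m) (7 / 8)).prod (isCompact_Icc (a := -(7 / 8 : ℝ)) (b := 7 / 8))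
  obtain ⟨B, hB⟩ := hK.exists_bound_of_continuousOn hg.continuousOn
  refine ((isCompact_closedBall (0 : Spc m) (7 / 8 + (B + 3 / 4))).prod
    (isCompact_Icc (a := -(7 / 8 : ℝ)) (b := 7 / 8))).of_isClosed_subset ?_ ?_
  · have h := continuous_hGamma hg
    exact ((isClosed_le (continuous_xprime.comp continuous_fst).norm continuous_const).inter
      ((isClosed_le continuous_snd.abs continuous_const).inter
      ((isClosed_le continuous_const h).inter (isClosed_le h continuous_const))))
  · rintro ⟨x, t⟩ ⟨h1, h2, h3, h4⟩
    have ht := abs_le.1 h2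
    refine ⟨?_, ht⟩
    have h5 := hB (xprime x, t) ⟨by simpa [dist_eq_norm] using h1, ht⟩
    have h6 := norm_le_xprime_xlast x
    have h7 : |xlast x| ≤ B + 3 / 4 := by
      have h8 := abs_le.1 h5
      simp only [hGamma] at h3 h4
      rw [abs_le]; constructor <;> linarith
    simp only [Metric.mem_closedBall, dist_zero_right]
    simp only at h1
    linarith

lemma mem_Cyl_of_mem_coreSet {p : Spc m × ℝ} (hp : p ∈ coreSet g) (hd : 0 < hGamma g p) : p ∈ Cyl g 1 := by
  obtain ⟨h1, h2, h3, h4⟩ := hp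
  have ht := abs_le.1 h2
  rw [mem_Cyl_iff]
  exact ⟨by linarith, by linarith, by linarith, hd, by linarith⟩

lemma mem_closure_Cyl {p : Spc m × ℝ} (hp : p ∈ coreSet g) (hd : hGamma g p = 0) : p ∈ closure (Cyl g 1) := by
  have hc : Continuous (fun s : ℝ => ((p.1 + s • eVec m (Fin.last m), p.2) : Spc m × ℝ)) := by fun_prop
  have ht : Tendsto (fun s : ℝ => ((p.1 + s • eVec m (Fin.last m), p.2) : Spc m × ℝ)) (𝓝[>] 0) (𝓝 p) := by
    have := hc.tendsto 0
    simp only [zero_smul, add_zero] at this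
    exact this.mono_left nhdsWithin_le_nhds
  refine mem_closure_of_tendsto ht ?_
  filter_upwards [self_mem_nhdsWithin, nhdsWithin_le_nhds (gt_mem_nhds (show (0 : ℝ) < 1 / 2 by norm_num))] with s hs hs1
  have hs : 0 < s := hs
  have e : hGamma g (p.1 + s • eVec m (Fin.last m), p.2) = s := by
    rw [hGamma_add_smul_eVec, Prod.mk.eta, hd, zero_add]
  refine mem_Cyl_of_mem_coreSet ⟨?_, hp.2.1, ?_, ?_⟩ ?_
  · simpa only [xprime_add_smul_eVec] using hp.1
  all_goals rw [e]; linarith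

lemma VanishesOn.exists_le (hg : Continuous (fun q : Spc' m × ℝ => g q.1 q.2)) {u : Spc m × ℝ → ℝ}
    (hu : VanishesOn u (Cyl g 1) (graphSet g)) {ε : ℝ} (hε : 0 < ε) :
    ∃ δ, 0 < δ ∧ δ ≤ 3 / 4 ∧ ∀ p : Spc m × ℝ, ‖xprime p.1‖ ≤ 7 / 8 → |p.2| ≤ 7 / 8 → 0 < hGamma g p → hGamma g p ≤ δ →
      u p ≤ ε := by
  have hcomp : IsCompact (coreSet g \ {p | ∀ᶠ q in 𝓝 p, q ∈ Cyl g 1 → u q ≤ ε}) :=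
    (isCompact_coreSet hg).diff isOpen_setOfPred_eventually_nhds
  have hpos : ∀ p ∈ coreSet g \ {p | ∀ᶠ q in 𝓝 p, q ∈ Cyl g 1 → u q ≤ ε}, 0 < hGamma g p := by
    rintro p ⟨hp, hp2⟩
    refine lt_of_le_of_ne hp.2.2.1 fun h0 => hp2 ?_
    have hgr : p ∈ graphSet g := by
      simp only [hGamma] at h0
      simp only [graphSet, mem_ofPred_eq]
      linarith
    have := (hu p ⟨hgr, mem_closure_Cyl hp h0.symm⟩).eventually (gt_mem_nhds hε)
    rw [eventually_nhdsWithin_iff] at this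
    exact this.mono fun q hq hq2 => (hq hq2).le
  obtain ⟨δ, hδ, hδ2⟩ : ∃ δ > 0, ∀ p ∈ coreSet g \ {p | ∀ᶠ q in 𝓝 p, q ∈ Cyl g 1 → u q ≤ ε}, δ ≤ hGamma g p := by
    rcases (coreSet g \ {p | ∀ᶠ q in 𝓝 p, q ∈ Cyl g 1 → u q ≤ ε}).eq_empty_or_nonempty with he | hne
    · exact ⟨1, one_pos, by simp [he]⟩
    · obtain ⟨p, hp, hmin⟩ := hcomp.exists_isMinOn hne (continuous_hGamma hg).continuousOn
      exact ⟨_, hpos p hp, fun q hq => hmin hq⟩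
  refine ⟨min (δ / 2) (3 / 4), by positivity, min_le_right _ _, fun p h1 h2 h3 h4 => ?_⟩
  have h5 : p ∈ coreSet g := ⟨h1, h2, h3.le, h4.trans (min_le_right _ _)⟩
  by_contra hcon
  have := hδ2 p ⟨h5, fun hev => hcon (hev.self_of_nhds (mem_Cyl_of_mem_coreSet h5 h3))⟩
  linarith [min_le_left (δ / 2) (3 / 4 : ℝ)]

lemma VanishesOn.exists_bound (hg : Continuous (fun q : Spc' m × ℝ => g q.1 q.2)) {u : Spc m × ℝ → ℝ}
    (hu : VanishesOn u (Cyl g 1) (graphSet g)) (hcont : ∀ p ∈ Cyl g 1, ContinuousAt u p) :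
    ∃ B, ∀ p ∈ coreSet g, 0 < hGamma g p → u p ≤ B := by
  obtain ⟨δ, hδ, -, hδu⟩ := hu.exists_le hg one_pos
  have hcomp : IsCompact (coreSet g ∩ {p | δ ≤ hGamma g p}) :=
    (isCompact_coreSet hg).inter_right (isClosed_le continuous_const (continuous_hGamma hg))
  obtain ⟨B, hB⟩ := hcomp.exists_bound_of_continuousOn (f := u) fun p hp =>
    (hcont p (mem_Cyl_of_mem_coreSet hp.1 (hδ.trans_le hp.2))).continuousWithinAt
  refine ⟨max B 1, fun p hp hd => ?_⟩
  rcases le_total (hGamma g p) δ with h | h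
  · exact (hδu p hp.1 hp.2.1 hd h).trans (le_max_right _ _)
  · exact (le_of_abs_le (hB p ⟨hp, h⟩)).trans (le_max_left _ _)

end Compactness

section Scales

/-- Radii `h`, exponents `L` and safety margins `R` used in the two iterations. -/
structure Scales (m : ℕ) (K α C : ℝ) (κ : ℕ) (h L R : ℕ → ℝ) : Prop where
  h_pos : ∀ k, 0 < h k
  h_le : ∀ k, h k ≤ 1 / 16
  L_ge : ∀ k, 256 ≤ L k
  L_dim : ∀ k, 4 * m + 12 ≤ L k
  L_succ : ∀ k, L (k + 1) = 21 / 20 * L k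
  L_tendsto : Tendsto L atTop atTop
  chain : ∀ k, C / h k ^ κ ≤ L k / 4
  R_nonneg : ∀ k, 0 ≤ R k
  R_le : ∀ k, R k ≤ 1 / 8
  R_succ : ∀ k, R (k + 1) + 65 * (m + 1) * h k ≤ R k
  osc : ∀ k, 64 * (m + 1) * h k + K * ((64 * (m + 1) * h k) ^ α + h k) + 2 * h k ≤ 1 / 2

lemma exists_small_radius (m : ℕ) {K α A : ℝ} (hα : 0 < α) : ∃ h : ℝ, 0 < h ∧ h ≤ 1 / 16 ∧ A * h ≤ 1 / 8 ∧
    64 * (m + 1) * h + K * ((64 * (m + 1) * h) ^ α + h) + 2 * h ≤ 1 / 2 := by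
  have hc : Continuous (fun h : ℝ => 64 * (m + 1) * h + K * ((64 * (m + 1) * h) ^ α + h) + 2 * h) := by
    have := Real.continuous_rpow_const hα.le
    have h2 : Continuous (fun h : ℝ => (64 * (m + 1) * h) ^ α) := this.comp (by fun_prop)
    fun_prop
  have h1 : ∀ᶠ h in 𝓝 (0 : ℝ), 64 * (m + 1) * h + K * ((64 * (m + 1) * h) ^ α + h) + 2 * h < 1 / 2 := by
    refine hc.continuousAt.eventually (gt_mem_nhds ?_)
    simp [Real.zero_rpow hα.ne']
  have h2 : ∀ᶠ h in 𝓝 (0 : ℝ), A * h < 1 / 8 :=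
    (continuous_const.mul continuous_id).continuousAt.eventually (gt_mem_nhds (by simp))
  have h3 : ∀ᶠ h in 𝓝 (0 : ℝ), h < 1 / 16 := gt_mem_nhds (by norm_num)
  have h4 : ∀ᶠ h in 𝓝[>] (0 : ℝ), 0 < h := self_mem_nhdsWithin
  obtain ⟨h, a, b, c, d⟩ := (h4.and (nhdsWithin_le_nhds (h1.and (h2.and h3)))).exists
  exact ⟨h, a, d.le, c.le, b.le⟩

theorem exists_scales (m : ℕ) {K α C : ℝ} {κ : ℕ} (hK : 0 < K) (hα : 0 < α) (hκ : 1 ≤ κ) :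
    ∃ h L R, Scales m K α C κ h L R := by
  have hκ1 : (1 : ℝ) ≤ κ := by exact_mod_cast hκ
  have hm : (0 : ℝ) ≤ m := Nat.cast_nonneg m
  obtain ⟨A, hA⟩ : ∃ A : ℝ, A = 21 * κ * (65 * (m + 1)) := ⟨_, rfl⟩
  obtain ⟨h0, hh0, hh1, hh2, hh3⟩ := exists_small_radius m (K := K) (A := A) hα
  obtain ⟨q, hq⟩ : ∃ q : ℝ, q = 1 + -(1 / (21 * κ)) := ⟨_, rfl⟩
  have hd : 1 / (21 * (κ : ℝ)) ≤ 1 / 21 := by gcongr; linarith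
  have hd0 : 0 < 1 / (21 * (κ : ℝ)) := by positivity
  have hq0 : 0 < q := by rw [hq]; linarith
  have hq1 : q ≤ 1 := by rw [hq]; linarith
  have hqκ : 20 / 21 ≤ q ^ κ := by
    have := one_add_mul_le_pow (a := -(1 / (21 * (κ : ℝ)))) (by linarith) κ
    rw [← hq] at this
    refine le_trans (le_of_eq ?_) this
    field_simp; norm_num
  obtain ⟨L0, hL0⟩ : ∃ L0 : ℝ, L0 = max (4 * C / h0 ^ κ) (max 256 (4 * m + 12)) := ⟨_, rfl⟩
  have l1 : 4 * C / h0 ^ κ ≤ L0 := hL0 ▸ le_max_left _ _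
  have l2 : 256 ≤ L0 := hL0 ▸ (le_max_left _ _).trans (le_max_right _ _)
  have l3 : 4 * m + 12 ≤ L0 := hL0 ▸ (le_max_right _ _).trans (le_max_right _ _)
  have hpow : ∀ k : ℕ, (1 : ℝ) ≤ (21 / 20) ^ k := fun k => one_le_pow₀ (by norm_num)
  have hLk : ∀ k : ℕ, L0 ≤ L0 * (21 / 20) ^ k := fun k => le_mul_of_one_le_right (by linarith) (hpow k)
  have hhk : ∀ k : ℕ, h0 * q ^ k ≤ h0 := fun k => mul_le_of_le_one_right hh0.le (pow_le_one₀ hq0.le hq1)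
  have hh : ∀ k : ℕ, 0 < h0 * q ^ k := fun k => mul_pos hh0 (pow_pos hq0 k)
  have hA0 : 0 ≤ A := by rw [hA]; positivity
  refine ⟨fun k => h0 * q ^ k, fun k => L0 * (21 / 20) ^ k, fun k => A * (h0 * q ^ k), hh, fun k => (hhk k).trans hh1,
    fun k => l2.trans (hLk k), fun k => l3.trans (hLk k), fun k => by ring, ?_, ?_, ?_, ?_, ?_, ?_⟩
  · exact (tendsto_pow_atTop_atTop_of_one_lt (by norm_num)).const_mul_atTop (by linarith)
  · intro k
    induction k with
    | zero => simp only [pow_zero, mul_one]; linarith [mul_div_assoc 4 C (h0 ^ κ)]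
    | succ k ih =>
      have hp : 0 < (h0 * q ^ k) ^ κ := pow_pos (hh k) _
      have e : (h0 * q ^ (k + 1)) ^ κ = (h0 * q ^ k) ^ κ * q ^ κ := by rw [← mul_pow]; ring
      rw [e, div_mul_eq_div_div, div_le_iff₀ (by positivity)]
      have hl : 0 ≤ L0 * (21 / 20) ^ k := by linarith [hLk k]
      calc C / (h0 * q ^ k) ^ κ ≤ L0 * (21 / 20) ^ k / 4 := ih
        _ = L0 * (21 / 20) ^ (k + 1) / 4 * (20 / 21) := by ring
        _ ≤ _ := by gcongr
  · intro k
    exact mul_nonneg hA0 (hh k).le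
  · intro k
    exact (mul_le_mul_of_nonneg_left (hhk k) hA0).trans hh2
  · intro k
    have : A * (1 - q) = 65 * (m + 1) := by rw [hA, hq]; field_simp; ring
    refine le_of_eq ?_
    rw [← this]; ring
  · intro k
    refine le_trans ?_ hh3
    have := hhk k
    have h5 := (hh k).le
    gcongr

end Scales

section Iteration

variable {m : ℕ} {g : Spc' m → ℝ → ℝ} {K α C : ℝ} {κ : ℕ} {h L R : ℕ → ℝ}

lemma Scales.time_le (hS : Scales m K α C κ h L R) (k : ℕ) : 256 * h k ^ 2 / L k ≤ h k ^ 2 := by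
  have := hS.L_ge k
  rw [div_le_iff₀ (by linarith)]
  nlinarith [sq_nonneg (h k)]

lemma Scales.cube_bounds (hS : Scales m K α C κ h L R) (hK : 0 ≤ K) (hα : 0 < α) (hg : HolderSemi α (1 / 2) K g) {k : ℕ}
    {x0 : Spc m} {t0 : ℝ} {p : Spc m × ℝ} (hp : p ∈ tBox x0 t0 (64 * h k) (256 * h k ^ 2 / L k)) :
    ‖xprime p.1‖ ≤ ‖xprime x0‖ + 64 * (m + 1) * h k ∧ t0 - h k ^ 2 ≤ p.2 ∧ p.2 ≤ t0 ∧
      hGamma g p + 2 * h k ≤ hGamma g (x0, t0) + 1 / 2 := by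
  have hh := hS.h_pos k
  have h1 := norm_sub_le_of_mem_tBox hp
  have h2 := hS.time_le k
  have h3 : t0 - h k ^ 2 ≤ p.2 := by linarith [hp.2.1]
  refine ⟨?_, h3, hp.2.2, ?_⟩
  · have h4 := norm_xprime_le (p.1 - x0)
    rw [xprime_sub] at h4
    have h5 := norm_le_norm_add_norm_sub' (xprime p.1) (xprime x0)
    linarith
  · have h4 := abs_hGamma_sub_le hK hα.le hg p.1 x0 p.2 t0
    have h5 : ‖p.1 - x0‖ ^ α ≤ (64 * (m + 1) * h k) ^ α :=
      Real.rpow_le_rpow (norm_nonneg _) (by linarith) hα.le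
    have h6 : |p.2 - t0| ^ (1 / 2 : ℝ) ≤ h k := by
      rw [← Real.sqrt_eq_rpow]
      refine Real.sqrt_le_iff.2 ⟨hh.le, ?_⟩
      rw [abs_le]; constructor <;> linarith [hp.2.2, sq_nonneg (h k)]
    have h7 := (abs_le.1 h4).2
    have h8 := mul_le_mul_of_nonneg_left (add_le_add h5 h6) hK
    have h9 := hS.osc k
    rw [Prod.mk.eta] at h7
    linarith

lemma Scales.goodCube (hS : Scales m K α C κ h L R) (hK : 0 ≤ K) (hα : 0 < α) (hg : HolderSemi α (1 / 2) K g) {k : ℕ}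
    {x0 : Spc m} {t0 : ℝ} (hx : ‖xprime x0‖ + R (k + 1) ≤ 7 / 8) (ht : -(7 / 8) + R (k + 1) ≤ t0) (ht1 : t0 ≤ 3 / 8)
    (hd : 0 < hGamma g (x0, t0)) (hd1 : hGamma g (x0, t0) ≤ h k) : GoodCube g x0 t0 (h k) (L k) := by
  refine ⟨hS.h_pos k, hS.h_le k, hS.L_ge k, hS.L_dim k, hd, fun p hp => ?_⟩
  obtain ⟨h1, h2, h3, h4⟩ := hS.cube_bounds hK hα hg hp
  have hh := hS.h_pos k
  have hh1 := hS.h_le k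
  have a1 := hS.R_succ k
  have a2 := hS.R_le k
  have a3 := hS.R_nonneg (k + 1)
  have hm : (0 : ℝ) ≤ m := Nat.cast_nonneg m
  have a4 : 0 ≤ (m : ℝ) * h k := by positivity
  refine ⟨?_, ?_, ?_, ?_⟩ <;> nlinarith

lemma norm_le_of_near_segment {x0 x1 y : Spc' m} {θ a b : ℝ} (hθ : θ ∈ Icc (0 : ℝ) 1) (h0 : ‖x0‖ ≤ a) (h1 : ‖x1‖ ≤ a)
    (hy : ‖y - (x0 + θ • (x1 - x0))‖ ≤ b) : ‖y‖ ≤ a + b := by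
  have e : x0 + θ • (x1 - x0) = (1 - θ) • x0 + θ • x1 := by module
  have h2 := norm_le_norm_add_norm_sub' y (x0 + θ • (x1 - x0))
  have h3 : ‖x0 + θ • (x1 - x0)‖ ≤ a := by
    rw [e]
    refine (norm_add_le _ _).trans ?_
    rw [norm_smul, norm_smul, Real.norm_eq_abs, Real.norm_eq_abs, abs_of_nonneg hθ.1, abs_of_nonneg (by linarith [hθ.2])]
    nlinarith [hθ.1, hθ.2]
  linarith

/-- The property of the constants supplied by `exists_chain`. -/
def ChainProp (m : ℕ) (K α C : ℝ) (κ : ℕ) : Prop :=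
  ∀ (g : Spc' m → ℝ → ℝ), HolderSemi α (1 / 2) K g → ∀ (f : Spc m × ℝ → ℝ) (x0 x1 : Spc' m) (d0 d1 t0 t1 h : ℝ),
      0 < h → h ≤ 1 → ‖x1 - x0‖ ≤ 2 → |d1 - d0| ≤ 1 → t0 + h ^ 2 ≤ t1 → t1 - t0 ≤ 2 →
      (∀ y s, (∃ θ ∈ Icc (0 : ℝ) 1, ‖xprime y - (x0 + θ • (x1 - x0))‖ ≤ h) → t0 - h ^ 2 ≤ s → s ≤ t1 →
        min d0 d1 - h / 2 ≤ hGamma g (y, s) → hGamma g (y, s) ≤ max d0 d1 + h / 2 →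
        ContinuousAt f (y, s) ∧ HeatOp f (y, s) 0 ∧ 0 ≤ f (y, s)) →
      f (mkPt x0 (g x0 t0 + d0), t0) ≤ Real.exp (C / h ^ κ) * f (mkPt x1 (g x1 t1 + d1), t1)

lemma le_mul_Ebar (hch : ChainProp m K α C κ) (hg : HolderSemi α (1 / 2) K g) {u : Spc m × ℝ → ℝ}
    (hcont : ∀ p ∈ Cyl g 1, ContinuousAt u p) (hheat : ∀ p ∈ Cyl g 1, HeatOp u p 0) (hpos : ∀ p ∈ Cyl g 1, 0 ≤ u p)
    {p : Spc m × ℝ} {r : ℝ} (hr : 0 < r) (hr1 : r ≤ 1 / 16) (hx : ‖xprime p.1‖ ≤ 7 / 8) (ht : -(7 / 8) ≤ p.2)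
    (ht1 : p.2 ≤ 3 / 8) (hd : r ≤ hGamma g p) (hd1 : hGamma g p ≤ 3 / 4) :
    u p ≤ Real.exp (C / r ^ κ) * u (Ebar g) := by
  obtain ⟨x, t⟩ := p
  simp only at hx ht ht1
  have hr2 : r ^ 2 ≤ 1 / 16 := by nlinarith
  have := hch g hg u (xprime x) 0 (hGamma g (x, t)) (1 / 2) t (1 / 2) r hr (by linarith)
    (by simpa using hx.trans (by norm_num)) (by rw [abs_le]; constructor <;> linarith) (by linarith) (by linarith) ?_
  · rwa [← eq_mkPt_hGamma] at this
  · rintro y s ⟨θ, hθ, hy⟩ hs1 hs2 h1 h2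
    have hy' := norm_le_of_near_segment hθ hx (by simp; norm_num) hy
    have hmem : (y, s) ∈ Cyl g 1 := by
      rw [mem_Cyl_iff]
      have h3 : r ≤ min (hGamma g (x, t)) (1 / 2) := le_min hd (by linarith)
      have h4 : max (hGamma g (x, t)) (1 / 2) ≤ 3 / 4 := max_le hd1 (by norm_num)
      refine ⟨?_, ?_, ?_, ?_, ?_⟩ <;> (try simp only) <;> linarith
    exact ⟨hcont _ hmem, hheat _ hmem, hpos _ hmem⟩

lemma Eund_le_mul (hch : ChainProp m K α C κ) (hg : HolderSemi α (1 / 2) K g) {v : Spc m × ℝ → ℝ}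
    (hcont : ∀ p ∈ Cyl g 1, ContinuousAt v p) (hheat : ∀ p ∈ Cyl g 1, HeatOp v p 0) (hpos : ∀ p ∈ Cyl g 1, 0 ≤ v p)
    {p : Spc m × ℝ} (hx : ‖xprime p.1‖ ≤ 7 / 8) (ht : -(3 / 8) ≤ p.2)
    (ht1 : p.2 ≤ 3 / 8) (hd : 1 / 2 ≤ hGamma g p) (hd1 : hGamma g p ≤ 3 / 4) :
    v (Eund g) ≤ Real.exp (C / (1 / 16) ^ κ) * v p := by
  obtain ⟨x, t⟩ := p
  simp only at hx ht ht1
  have := hch g hg v 0 (xprime x) (1 / 2) (hGamma g (x, t)) (-(1 / 2)) t (1 / 16) (by norm_num) (by norm_num)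
    (by simpa using hx.trans (by norm_num)) (by rw [abs_le]; constructor <;> linarith) (by linarith) (by linarith) ?_
  · rwa [← eq_mkPt_hGamma] at this
  · rintro y s ⟨θ, hθ, hy⟩ hs1 hs2 h1 h2
    have hy' := norm_le_of_near_segment hθ (by simp; norm_num) hx hy
    have hmem : (y, s) ∈ Cyl g 1 := by
      rw [mem_Cyl_iff]
      have h3 : 1 / 2 ≤ min (1 / 2) (hGamma g (x, t)) := le_min le_rfl hd
      have h4 : max (1 / 2) (hGamma g (x, t)) ≤ 3 / 4 := max_le (by norm_num) hd1
      refine ⟨?_, ?_, ?_, ?_, ?_⟩ <;> (try simp only) <;> linarith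
    exact ⟨hcont _ hmem, hheat _ hmem, hpos _ hmem⟩

/-- Carleson estimate: `u` is bounded near the graph by its value at the forward corkscrew point. -/
theorem carleson_estimate (hS : Scales m K α C κ h L R) (hch : ChainProp m K α C κ) (hK : 0 < K) (hα : 0 < α)
    (hgc : Continuous (fun q : Spc' m × ℝ => g q.1 q.2)) (hg : HolderSemi α (1 / 2) K g) {u : Spc m × ℝ → ℝ}
    (hcont : ∀ p ∈ Cyl g 1, ContinuousAt u p) (hheat : ∀ p ∈ Cyl g 1, HeatOp u p 0) (hpos : ∀ p ∈ Cyl g 1, 0 ≤ u p)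
    (hvan : VanishesOn u (Cyl g 1) (graphSet g)) (hE : u (Ebar g) = 1) {p : Spc m × ℝ} (hx : ‖xprime p.1‖ ≤ 3 / 4)
    (ht : -(3 / 4) ≤ p.2) (ht1 : p.2 ≤ 3 / 8) (hd : 0 < hGamma g p) (hd1 : hGamma g p ≤ 3 / 4) :
    u p ≤ Real.exp (L 0) := by
  by_contra! hcon
  have hchain : ∀ k (q : Spc m × ℝ), ‖xprime q.1‖ ≤ 7 / 8 → -(7 / 8) ≤ q.2 → q.2 ≤ 3 / 8 → h k ≤ hGamma g q →
      hGamma g q ≤ 3 / 4 → u q ≤ Real.exp (L k / 4) := by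
    intro k q h1 h2 h3 h4 h5
    refine (le_mul_Ebar hch hg hcont hheat hpos (hS.h_pos k) (hS.h_le k) h1 h2 h3 h4 h5).trans ?_
    rw [hE, mul_one, Real.exp_le_exp]
    exact hS.chain k
  have key : ∀ k, ∃ q : Spc m × ℝ, ‖xprime q.1‖ + R k ≤ 7 / 8 ∧ -(7 / 8) + R k ≤ q.2 ∧ q.2 ≤ 3 / 8 ∧
      0 < hGamma g q ∧ hGamma g q ≤ 3 / 4 ∧ Real.exp (L k) < u q := by
    intro k
    induction k with
    | zero => exact ⟨p, by linarith [hS.R_le 0], by linarith [hS.R_le 0], ht1, hd, hd1, hcon⟩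
    | succ k ih =>
      obtain ⟨⟨x0, t0⟩, h1, h2, h3, h4, h5, h6⟩ := ih
      simp only at h1 h2 h3
      by_contra! hno
      have hh := hS.h_pos k
      have hh1 := hS.h_le k
      have a1 := hS.R_succ k
      have a2 := hS.R_le k
      have a3 := hS.R_nonneg k
      have a5 := hS.L_ge k
      have hm : (0 : ℝ) ≤ m := Nat.cast_nonneg m
      have a4 : 0 ≤ (m : ℝ) * h k := by positivity
      have a6 : h k ^ 2 ≤ h k := by nlinarith
      have a7 := hS.R_nonneg (k + 1)
      have hdk : hGamma g (x0, t0) ≤ h k := by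
        by_contra! hc
        have b1 := hchain k (x0, t0) (by simp only; linarith) (by simp only; linarith) h3 hc.le h5
        have b2 : Real.exp (L k / 4) ≤ Real.exp (L k) := Real.exp_le_exp.2 (by linarith)
        linarith
      refine absurd h6 (not_lt.2 (le_of_lt ?_))
      refine carleson_step hgc (hS.goodCube hK.le hα hg (by linarith) (by linarith) h3 h4 hdk) hcont hheat hpos ?_ ?_ ?_
      · intro ε hε
        obtain ⟨δ, hδ, -, hδu⟩ := hvan.exists_le hgc hε
        refine ⟨δ, hδ, fun q hq hq1 hq2 => ?_⟩
        obtain ⟨c1, c2, c3, c4⟩ := hS.cube_bounds hK.le hα hg hq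
        refine hδu q ?_ ?_ hq1 hq2
        · linarith
        · rw [abs_le]; constructor <;> linarith
      · intro q hq hq1
        obtain ⟨c1, c2, c3, c4⟩ := hS.cube_bounds hK.le hα hg hq
        refine (hno q ?_ ?_ ?_ hq1 ?_).trans ?_
        any_goals linarith
        rw [Real.exp_le_exp, hS.L_succ k]; linarith
      · refine hchain k _ ?_ ?_ ?_ ?_ ?_
        · simp only [xprime_add_smul_eVec]; linarith
        · simp only; linarith
        · exact h3
        · rw [hGamma_add_smul_eVec]; linarith
        · rw [hGamma_add_smul_eVec]; linarith
  obtain ⟨B, hB⟩ := hvan.exists_bound hgc hcont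
  obtain ⟨k, hk⟩ := (hS.L_tendsto.eventually_ge_atTop B).exists
  obtain ⟨q, h1, h2, h3, h4, h5, h6⟩ := key k
  have a3 := hS.R_nonneg k
  have := hB q ⟨by linarith, by rw [abs_le]; constructor <;> linarith, h4.le, h5⟩ h4
  linarith [Real.add_one_le_exp (L k)]

lemma decay_at_depth (hS : Scales m K α C κ h L R) (hch : ChainProp m K α C κ)
    (hg : HolderSemi α (1 / 2) K g) {w : Spc m × ℝ → ℝ} (hcont : ∀ p ∈ Cyl g 1, ContinuousAt w p)
    (hheat : ∀ p ∈ Cyl g 1, HeatOp w p 0) {k : ℕ}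
    (hk : ∀ p, ‖xprime p.1‖ ≤ 1 / 2 + R k → -(1 / 4) - R k ≤ p.2 → p.2 ≤ 1 / 4 → 0 < hGamma g p → hGamma g p ≤ 3 / 4 →
      -Real.exp (-L k) ≤ w p)
    (h1 : ∀ p, ‖xprime p.1‖ ≤ 5 / 8 → -(3 / 8) ≤ p.2 → p.2 ≤ 1 / 4 → 1 / 2 ≤ hGamma g p → hGamma g p ≤ 3 / 4 →
      1 ≤ w p)
    {p : Spc m × ℝ} (hx : ‖xprime p.1‖ + h k ≤ 1 / 2 + R k) (ht : -(1 / 4) - R k + 2 * h k ^ 2 ≤ p.2) (ht1 : p.2 ≤ 1 / 4)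
    (hd : h k ≤ hGamma g p) (hd1 : hGamma g p ≤ 1 / 2) : Real.exp (-(L k / 2)) ≤ w p := by
  obtain ⟨x, t⟩ := p
  simp only at hx ht ht1
  have hh := hS.h_pos k
  have hh1 := hS.h_le k
  have a2 := hS.R_le k
  have a5 := hS.L_ge k
  have a6 : h k ^ 2 ≤ h k := by nlinarith
  have hch' := hch g hg (fun p => w p + Real.exp (-L k)) (xprime x) (xprime x) (1 / 2) (hGamma g (x, t)) (t - h k ^ 2) t
    (h k) hh (by linarith) (by simp) (by rw [abs_le]; constructor <;> linarith) (by linarith) (by linarith) ?_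
  · rw [← eq_mkPt_hGamma] at hch'
    have b1 := h1 (mkPt (xprime x) (g (xprime x) (t - h k ^ 2) + 1 / 2), t - h k ^ 2) (by simp only [xprime_mkPt]; linarith)
      (by simp only; linarith [sq_nonneg (h k)]) (by simp only; linarith [sq_nonneg (h k)]) (by simp [hGamma])
      (by simp only [hGamma, xprime_mkPt, xlast_mkPt]; linarith)
    have b2 : Real.exp (C / h k ^ κ) ≤ Real.exp (L k / 4) := Real.exp_le_exp.2 (hS.chain k)
    have b3 := hk (x, t) (by simp only; linarith) (by simp only; nlinarith [sq_nonneg (h k)]) ht1 (by linarith)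
      (by linarith)
    have b4 : 1 ≤ Real.exp (L k / 4) * (w (x, t) + Real.exp (-L k)) := by
      have := mul_le_mul_of_nonneg_right b2 (by linarith : 0 ≤ w (x, t) + Real.exp (-L k))
      linarith [Real.exp_pos (-L k)]
    obtain ⟨y, hy⟩ : ∃ y, y = Real.exp (-(L k / 4)) := ⟨_, rfl⟩
    have y0 : 0 < y := hy ▸ Real.exp_pos _
    have y1 : y * Real.exp (L k / 4) = 1 := by rw [hy, ← Real.exp_add]; simp
    have y2 : Real.exp (-(L k / 2)) = y ^ 2 := by rw [hy, ← Real.exp_nat_mul]; congr 1; push_cast; ring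
    have y3 : Real.exp (-L k) = y ^ 4 := by rw [hy, ← Real.exp_nat_mul]; congr 1; push_cast; ring
    have y4 : y ≤ 1 / 2 := by
      have := Real.add_one_le_exp (L k / 4)
      nlinarith
    have y5 : y ≤ w (x, t) + Real.exp (-L k) := by
      have := mul_le_mul_of_nonneg_left b4 y0.le
      rwa [mul_one, ← mul_assoc, y1, one_mul] at this
    rw [y2]
    rw [y3] at y5
    have y6 : y ^ 2 + y ^ 4 ≤ y := by
      have : y ^ 3 ≤ 1 / 2 := by nlinarith [sq_nonneg y, mul_pos y0 y0]
      nlinarith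
    linarith
  · rintro y s ⟨θ, hθ, hy⟩ hs1 hs2 e1 e2
    have hy' := norm_le_of_near_segment hθ le_rfl le_rfl hy
    have e3 : h k ≤ min (1 / 2) (hGamma g (x, t)) := le_min (by linarith) hd
    have e4 : max (1 / 2) (hGamma g (x, t)) ≤ 1 / 2 := max_le le_rfl hd1
    have hmem : (y, s) ∈ Cyl g 1 := by
      rw [mem_Cyl_iff]
      refine ⟨?_, ?_, ?_, ?_, ?_⟩ <;> (try simp only) <;> linarith [sq_nonneg (h k)]
    refine ⟨(hcont _ hmem).add continuousAt_const, ?_, ?_⟩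
    · simpa using (hheat _ hmem).add (heatOp_const (Real.exp (-L k)) (y, s))
    · have := hk (y, s) (by simp only; linarith) (by simp only; linarith) (by simp only; linarith) (by linarith)
        (by linarith)
      linarith

/-- A caloric function which is large away from the graph and not too negative near it is nonnegative. -/
theorem nonneg_of_almost_nonneg (hS : Scales m K α C κ h L R) (hch : ChainProp m K α C κ) (hK : 0 < K) (hα : 0 < α)
    (hgc : Continuous (fun q : Spc' m × ℝ => g q.1 q.2)) (hg : HolderSemi α (1 / 2) K g) {w : Spc m × ℝ → ℝ}
    (hcont : ∀ p ∈ Cyl g 1, ContinuousAt w p) (hheat : ∀ p ∈ Cyl g 1, HeatOp w p 0)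
    (hvan : ∀ ε > 0, ∃ δ > 0, ∀ p : Spc m × ℝ, ‖xprime p.1‖ ≤ 7 / 8 → |p.2| ≤ 7 / 8 → 0 < hGamma g p →
      hGamma g p ≤ δ → -ε ≤ w p)
    (h0 : ∀ p, ‖xprime p.1‖ ≤ 5 / 8 → -(3 / 8) ≤ p.2 → p.2 ≤ 1 / 4 → 0 < hGamma g p → hGamma g p ≤ 3 / 4 →
      -Real.exp (-L 0) ≤ w p)
    (h1 : ∀ p, ‖xprime p.1‖ ≤ 5 / 8 → -(3 / 8) ≤ p.2 → p.2 ≤ 1 / 4 → 1 / 2 ≤ hGamma g p → hGamma g p ≤ 3 / 4 →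
      1 ≤ w p)
    {p : Spc m × ℝ} (hx : ‖xprime p.1‖ ≤ 1 / 2) (ht : -(1 / 4) ≤ p.2) (ht1 : p.2 ≤ 1 / 4)
    (hd : 0 < hGamma g p) (hd1 : hGamma g p ≤ 3 / 4) : 0 ≤ w p := by
  have key : ∀ k (p : Spc m × ℝ), ‖xprime p.1‖ ≤ 1 / 2 + R k → -(1 / 4) - R k ≤ p.2 → p.2 ≤ 1 / 4 → 0 < hGamma g p →
      hGamma g p ≤ 3 / 4 → -Real.exp (-L k) ≤ w p := by
    intro k
    induction k with
    | zero =>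
      intro p e1 e2 e3 e4 e5
      have := hS.R_le 0
      exact h0 p (by linarith) (by linarith) e3 e4 e5
    | succ k ih =>
      rintro ⟨x0, t0⟩ e1 e2 e3 e4 e5
      simp only at e1 e2 e3
      have hh := hS.h_pos k
      have hh1 := hS.h_le k
      have a1 := hS.R_succ k
      have a2 := hS.R_le k
      have a5 := hS.L_ge k
      have hm : (0 : ℝ) ≤ m := Nat.cast_nonneg m
      have a4 : 0 ≤ (m : ℝ) * h k := by positivity
      have a6 : h k ^ 2 ≤ h k := by nlinarith
      have a7 := hS.R_nonneg (k + 1)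
      rcases le_total (1 / 2) (hGamma g (x0, t0)) with hd2 | hd2
      · have := h1 (x0, t0) (by simp only; linarith) (by simp only; linarith) e3 hd2 e5
        linarith [Real.exp_pos (-L (k + 1))]
      rcases le_total (h k) (hGamma g (x0, t0)) with hd3 | hd3
      · have := decay_at_depth hS hch hg hcont hheat ih h1 (p := (x0, t0)) (by simp only; linarith)
          (by simp only; linarith) e3 hd3 hd2
        linarith [Real.exp_pos (-L (k + 1)), Real.exp_pos (-(L k / 2))]
      rw [hS.L_succ k]
      refine decay_step hgc (hS.goodCube hK.le hα hg (by linarith) (by linarith) (by linarith) e4 hd3) hcont hheat ?_ ?_ ?_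
      · intro ε hε
        obtain ⟨δ, hδ, hδu⟩ := hvan ε hε
        refine ⟨δ, hδ, fun q hq hq1 hq2 => ?_⟩
        obtain ⟨c1, c2, c3, c4⟩ := hS.cube_bounds hK.le hα hg hq
        refine hδu q ?_ ?_ hq1 hq2
        · linarith
        · rw [abs_le]; constructor <;> linarith
      · intro q hq hq1 ξ hξ hξ1
        obtain ⟨c1, c2, c3, c4⟩ := hS.cube_bounds hK.le hα hg hq
        have e : hGamma g (q.1 + ξ • eVec m (Fin.last m), q.2) = hGamma g q + ξ := hGamma_add_smul_eVec g q.1 q.2 ξ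
        refine ih _ ?_ ?_ ?_ ?_ ?_
        all_goals simp only [xprime_add_smul_eVec, e]; linarith
      · intro q hq hq1 hqt
        obtain ⟨c1, c2, c3, c4⟩ := hS.cube_bounds hK.le hα hg hq
        have e : hGamma g (q.1 + h k • eVec m (Fin.last m), q.2) = hGamma g q + h k :=
          hGamma_add_smul_eVec g q.1 q.2 (h k)
        refine decay_at_depth hS hch hg hcont hheat ih h1 ?_ ?_ ?_ ?_ ?_
        all_goals simp only [xprime_add_smul_eVec, e]; linarith
  have hlim : Tendsto (fun k => -Real.exp (-L k)) atTop (𝓝 (-0)) :=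
    (Real.tendsto_exp_neg_atTop_nhds_zero.comp hS.L_tendsto).neg
  rw [neg_zero] at hlim
  refine le_of_tendsto' hlim fun k => key k p ?_ ?_ ht1 hd hd1
  · linarith [hS.R_nonneg k]
  · linarith [hS.R_nonneg k]

end Iteration

section Main

variable {m : ℕ} {g : Spc' m → ℝ → ℝ} {K α C : ℝ} {κ : ℕ} {h L R : ℕ → ℝ}

lemma Ebar_mem_Cyl (g : Spc' m → ℝ → ℝ) : Ebar g ∈ Cyl g 1 := by
  rw [mem_Cyl_iff]
  simp only [Ebar, hGamma, xprime_mkPt, xlast_mkPt, norm_zero]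
  norm_num

lemma Eund_mem_Cyl (g : Spc' m → ℝ → ℝ) : Eund g ∈ Cyl g 1 := by
  rw [mem_Cyl_iff]
  simp only [Eund, hGamma, xprime_mkPt, xlast_mkPt, norm_zero]
  norm_num

/-- The boundary Harnack inequality for solutions normalised at the corkscrew points. -/
theorem le_mul_of_normalized (hS : Scales m K α C κ h L R) (hch : ChainProp m K α C κ) (hK : 0 < K) (hα : 0 < α)
    (hgc : Continuous (fun q : Spc' m × ℝ => g q.1 q.2)) (hg : HolderSemi α (1 / 2) K g) {u v : Spc m × ℝ → ℝ}
    (hcu : ∀ p ∈ Cyl g 1, ContinuousAt u p) (hhu : ∀ p ∈ Cyl g 1, HeatOp u p 0) (hu : ∀ p ∈ Cyl g 1, 0 ≤ u p)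
    (hcv : ∀ p ∈ Cyl g 1, ContinuousAt v p) (hhv : ∀ p ∈ Cyl g 1, HeatOp v p 0) (hv : ∀ p ∈ Cyl g 1, 0 ≤ v p)
    (hvan : VanishesOn u (Cyl g 1) (graphSet g)) (hEu : u (Ebar g) = 1) (hEv : v (Eund g) = 1)
    {p : Spc m × ℝ} (hp : p ∈ Cyl g (1 / 2)) :
    u p ≤ Real.exp (L 0) * (Real.exp (C / (1 / 16) ^ κ) * (1 + Real.exp (L 0))) * v p := by
  obtain ⟨Λ, hΛ⟩ : ∃ Λ, Λ = Real.exp (C / (1 / 16) ^ κ) * (1 + Real.exp (L 0)) := ⟨_, rfl⟩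
  have hΛ0 : 0 < Λ := by rw [hΛ]; positivity
  obtain ⟨b, hb⟩ : ∃ b, b = Real.exp (-L 0) := ⟨_, rfl⟩
  have hb0 : 0 < b := hb ▸ Real.exp_pos _
  have hbe : b * Real.exp (L 0) = 1 := by rw [hb, ← Real.exp_add]; simp
  have hmem : ∀ p : Spc m × ℝ, ‖xprime p.1‖ ≤ 5 / 8 → -(3 / 8) ≤ p.2 → p.2 ≤ 1 / 4 → 0 < hGamma g p →
      hGamma g p ≤ 3 / 4 → p ∈ Cyl g 1 ∧ b * u p ≤ 1 := by
    intro p e1 e2 e3 e4 e5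
    refine ⟨?_, ?_⟩
    · rw [mem_Cyl_iff]
      refine ⟨?_, ?_, ?_, e4, ?_⟩ <;> linarith
    · have := carleson_estimate hS hch hK hα hgc hg hcu hhu hu hvan hEu (p := p) (by linarith) (by linarith)
        (by linarith) e4 e5
      calc b * u p ≤ b * Real.exp (L 0) := by gcongr
        _ = 1 := hbe
  have key : 0 ≤ b * (Λ * v p - b * u p) := by
    rw [mem_Cyl_iff] at hp
    obtain ⟨e1, e2, e3, e4, e5⟩ := hp
    refine nonneg_of_almost_nonneg (w := fun p => b * (Λ * v p - b * u p)) hS hch hK hα hgc hg ?_ ?_ ?_ ?_ ?_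
      e1.le (by linarith) (by linarith) e4 (by linarith)
    · intro p hp
      exact (((hcv p hp).const_mul Λ).sub ((hcu p hp).const_mul b)).const_mul b
    · intro p hp
      simpa using (((hhv p hp).const_mul Λ).sub ((hhu p hp).const_mul b)).const_mul b
    · intro ε hε
      obtain ⟨δ, hδ, hδ1, hδu⟩ := hvan.exists_le hgc (div_pos hε (mul_pos hb0 hb0))
      refine ⟨δ, hδ, fun p c1 c2 c3 c4 => ?_⟩
      have c5 := hδu p c1 c2 c3 c4
      rw [le_div_iff₀ (mul_pos hb0 hb0)] at c5
      have c6 := hv p (mem_Cyl_of_mem_coreSet ⟨c1, c2, c3.le, c4.trans hδ1⟩ c3)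
      have c7 := mul_nonneg hb0.le (mul_nonneg hΛ0.le c6)
      linarith
    · intro p c1 c2 c3 c4 c5
      obtain ⟨c6, c7⟩ := hmem p c1 c2 c3 c4 c5
      have c8 := mul_nonneg hb0.le (mul_nonneg hΛ0.le (hv p c6))
      rw [← hb]
      nlinarith
    · intro p c1 c2 c3 c4 c5
      obtain ⟨c6, c7⟩ := hmem p c1 c2 c3 (by linarith) c5
      have c8 := Eund_le_mul hch hg hcv hhv hv (p := p) (by linarith) c2 (by linarith) c4 c5
      rw [hEv] at c8
      have c9 : 1 + Real.exp (L 0) ≤ Λ * v p := by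
        have := mul_le_mul_of_nonneg_left c8 (by positivity : 0 ≤ 1 + Real.exp (L 0))
        rw [hΛ]
        linarith
      calc (1 : ℝ) = b * (1 + Real.exp (L 0) - 1) := by rw [add_sub_cancel_left, hbe]
        _ ≤ b * (Λ * v p - b * u p) := by gcongr
  have key2 : 0 ≤ Λ * v p - b * u p := nonneg_of_mul_nonneg_right key hb0
  have key3 := mul_nonneg (Real.exp_pos (L 0)).le key2
  rw [← hΛ]
  linear_combination key3 - u p * hbe

end Main

/-- **Boundary Harnack principle for the heat equation in `C^{α,1/2}` domains,
any `α > 0`** (Theorem 1.3). -/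
theorem boundary_harnack_heat_Calpha_half (m : ℕ) (hm : 1 ≤ m) (K α : ℝ)
    (hK : 0 < K) (hα : 0 < α) (hα1 : α ≤ 1) :
    ∃ C : ℝ, 0 < C ∧
      ∀ g : Spc' m → ℝ → ℝ,
        Continuous (fun q : Spc' m × ℝ => g q.1 q.2) → g 0 0 = 0 →
        HolderSemi α (1 / 2) K g →
      ∀ u v : Spc m × ℝ → ℝ,
        SolvesHeat u (Cyl g 1) → SolvesHeat v (Cyl g 1) →
        (∀ p ∈ Cyl g 1, 0 < u p) → (∀ p ∈ Cyl g 1, 0 < v p) →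
        VanishesOn u (Cyl g 1) (graphSet g) →
        ∀ p ∈ Cyl g (1 / 2), u p / v p ≤ C * (u (Ebar g) / v (Eund g)) := by
  obtain ⟨C, κ, -, hκ, hch⟩ := exists_chain m hK hα hα1
  obtain ⟨h, L, R, hS⟩ := exists_scales m (C := C) hK hα hκ
  refine ⟨Real.exp (L 0) * (Real.exp (C / (1 / 16) ^ κ) * (1 + Real.exp (L 0))), by positivity, ?_⟩
  intro g hgc _ hg u v hsu hsv hu hv hvan p hp
  have hΩ := isOpen_Cyl hgc 1
  have hEu := hu _ (Ebar_mem_Cyl g)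
  have hEv := hv _ (Eund_mem_Cyl g)
  have hcu := hsu.continuousAt hΩ fun p hp => (hu p hp).le
  have hcv := hsv.continuousAt hΩ fun p hp => (hv p hp).le
  have hhu : ∀ p ∈ Cyl g 1, HeatOp u p 0 := fun p hp => HeatOp.of_solves (hsu p hp).1 (hsu p hp).2
  have hhv : ∀ p ∈ Cyl g 1, HeatOp v p 0 := fun p hp => HeatOp.of_solves (hsv p hp).1 (hsv p hp).2
  have hp1 : p ∈ Cyl g 1 := by
    rw [mem_Cyl_iff] at hp ⊢
    obtain ⟨e1, e2, e3, e4, e5⟩ := hp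
    refine ⟨?_, ?_, ?_, e4, ?_⟩ <;> linarith
  have key := le_mul_of_normalized (u := fun p => (u (Ebar g))⁻¹ * u p) (v := fun p => (v (Eund g))⁻¹ * v p)
    hS hch hK hα hgc hg (fun p hp => (hcu p hp).const_mul _)
    (fun p hp => by simpa using (hhu p hp).const_mul (u (Ebar g))⁻¹)
    (fun p hp => mul_nonneg (inv_nonneg.2 hEu.le) (hu p hp).le)
    (fun p hp => (hcv p hp).const_mul _) (fun p hp => by simpa using (hhv p hp).const_mul (v (Eund g))⁻¹)
    (fun p hp => mul_nonneg (inv_nonneg.2 hEv.le) (hv p hp).le)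
    (fun P hP => by simpa using (hvan P hP).const_mul (u (Ebar g))⁻¹)
    (inv_mul_cancel₀ hEu.ne') (inv_mul_cancel₀ hEv.ne') hp
  rw [div_le_iff₀ (hv p hp1)]
  have := mul_le_mul_of_nonneg_left key hEu.le
  rw [mul_inv_cancel_left₀ hEu.ne'] at this
  refine this.trans (le_of_eq ?_)
  field_simp
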